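/- For any fixed η ∈ P(𝕋^d) there exists a sequence δₙ → 0⁺ such that the functions V_{δₙ}(·) − V_{δₙ}(η) converge uniformly on P(𝕋^d) to a continuous function χ : P(𝕋^d) → ℝ, and along the same sequence the functions δₙ V_{δₙ}(·) converge uniformly on P(𝕋^d) to a constant function, denoted −λ. -/

import Mathlib

/- Common framework for "On the long time convergence of potential MFG" (M. Masoero).

We work on the flat torus `𝕋^d`, modeled as `Td d := Fin d → AddCircle 1`.
Smooth functions on the torus are represented by `ℤ^d`-periodic functions on
`Vd d := Fin d → ℝ`; a function on `Vd d` is transported to the torus through the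
canonical (measurable) section `secT : Td d → Vd d`.  Probability measures on the
torus are `PTd d := ProbabilityMeasure (Td d)`, endowed with the 1-Wasserstein
distance `W1` defined through Kantorovich duality.  The Fokker--Planck equations
and their stationary analogues are stated in the sense of distributions, i.e.
against smooth periodic test functions; `σ` is the viscosity parameter
(everywhere `σ = 1` except in the non-convex example). -/

open MeasureTheory Real Set Filter

noncomputable section

abbrev Vd (d : ℕ) : Type := Fin d → ℝ
abbrev Td (d : ℕ) : Type := Fin d → AddCircle (1 : ℝ)

instance factOneposR : Fact ((0:ℝ) < 1) := ⟨one_pos⟩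

/-- The canonical measurable section of the torus, with values in `[0,1)^d`. -/
def secT {d : ℕ} (y : Td d) : Vd d := fun i => ((AddCircle.equivIco 1 0) (y i)).1

/-- The vector of `ℝ^d` associated with an integer vector. -/
def intVec {d : ℕ} (z : Fin d → ℤ) : Vd d := fun i => (z i : ℝ)

/-- Euclidean scalar product on `ℝ^d`. -/
def dotp {d : ℕ} (a b : Vd d) : ℝ := ∑ i, a i * b i

/-- Squared euclidean norm on `ℝ^d`. -/
def sqnorm {d : ℕ} (a : Vd d) : ℝ := ∑ i, (a i)^2

/-- Spatial gradient. -/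
def gradv {d : ℕ} (g : Vd d → ℝ) (x : Vd d) : Vd d := fun i => fderiv ℝ g x (Pi.single i 1)

/-- Second derivative of `g` at `x` in the directions `v, w`. -/
def D2 {d : ℕ} (g : Vd d → ℝ) (x v w : Vd d) : ℝ := fderiv ℝ (fun y => fderiv ℝ g y v) x w

/-- Laplacian. -/
def lapl {d : ℕ} (g : Vd d → ℝ) (x : Vd d) : ℝ := ∑ i, D2 g x (Pi.single i 1) (Pi.single i 1)

/-- Divergence of a vector field. -/
def divv {d : ℕ} (b : Vd d → Vd d) (x : Vd d) : ℝ :=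
  ∑ i, fderiv ℝ (fun y => b y i) x (Pi.single i 1)

/-- Time derivative of a time dependent function. -/
def tderiv {d : ℕ} (u : ℝ → Vd d → ℝ) (t : ℝ) (x : Vd d) : ℝ := deriv (fun s => u s x) t

abbrev PTd (d : ℕ) := ProbabilityMeasure (Td d)

/-- The 1-Wasserstein (Monge--Kantorovich) distance, via Kantorovich duality. -/
def W1 {d : ℕ} (μ ν : PTd d) : ℝ :=
  sSup { r | ∃ φ : Td d → ℝ, LipschitzWith 1 φ ∧
    r = (∫ y, φ y ∂(μ : Measure (Td d))) - ∫ y, φ y ∂(ν : Measure (Td d)) }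

/-- The convex combination `(1-t) μ + t ν`. -/
def lineComb {d : ℕ} (t : ℝ) (μ ν : PTd d) : Measure (Td d) :=
  ENNReal.ofReal (1 - t) • (μ : Measure (Td d)) + ENNReal.ofReal t • (ν : Measure (Td d))

/-- The standing assumptions of the paper: a Hamiltonian `H` (a `ℤ^d`-periodic function of
`(x,p)`), its convex conjugate `Hstar` in the `p` variable, a `C²` coupling function
`Fc` on `P(𝕋^d)` with flat derivative `Fd` (represented by periodic functions on `ℝ^d`),
with the regularity and growth conditions of the paper. -/
structure MFGSetting (d : ℕ) where
  H : Vd d → Vd d → ℝ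
  Hstar : Vd d → Vd d → ℝ
  Fc : PTd d → ℝ
  Fd : Measure (Td d) → Vd d → ℝ
  Cbar : ℝ
  Cbar_pos : 0 < Cbar
  θ : ℝ
  θ_mem : θ ∈ Set.Ioo (0:ℝ) 1
  Cg : ℝ
  Cg_pos : 0 < Cg
  CF : ℝ
  H_smooth : ContDiff ℝ 2 (fun q : Vd d × Vd d => H q.1 q.2)
  H_per : ∀ (x : Vd d) (z : Fin d → ℤ) (p : Vd d), H (x + intVec z) p = H x p
  Dpp_lip : ∃ L : ℝ, 0 ≤ L ∧ ∀ (x p₁ p₂ v w : Vd d),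
    |D2 (fun p => H x p) p₁ v w - D2 (fun p => H x p) p₂ v w| ≤ L * ‖p₁ - p₂‖ * ‖v‖ * ‖w‖
  Dpp_lower : ∀ x p v : Vd d, Cbar⁻¹ * sqnorm v ≤ D2 (fun p' => H x p') p v v
  Dpp_upper : ∀ x p v : Vd d, D2 (fun p' => H x p') p v v ≤ Cbar * sqnorm v
  Dxx_growth : ∀ x p v w : Vd d,
    |D2 (fun x' => H x' p) x v w| ≤ Cg * (1 + ‖p‖) ^ (1 + θ) * ‖v‖ * ‖w‖
  Dxp_growth : ∀ x p v w : Vd d,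
    |fderiv ℝ (fun x' => fderiv ℝ (fun p' => H x' p') p v) x w| ≤ Cg * (1 + ‖p‖) ^ θ * ‖v‖ * ‖w‖
  Hstar_eq : ∀ x q : Vd d, IsLUB (Set.range fun p => dotp q p - H x p) (Hstar x q)
  Fd_per : ∀ (μ : Measure (Td d)) (x : Vd d) (z : Fin d → ℤ), Fd μ (x + intVec z) = Fd μ x
  Fd_smooth : ∀ μ : Measure (Td d), IsProbabilityMeasure μ → ContDiff ℝ 2 (Fd μ)
  Fd_D2_bound : ∀ μ : Measure (Td d), IsProbabilityMeasure μ →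
    ∀ x v w : Vd d, |D2 (Fd μ) x v w| ≤ CF * ‖v‖ * ‖w‖
  flat_deriv : ∀ μ ν : PTd d,
    Fc ν - Fc μ = ∫ t in Set.Icc (0:ℝ) 1,
      ((∫ y, Fd (lineComb t μ ν) (secT y) ∂(ν : Measure (Td d))) -
        ∫ y, Fd (lineComb t μ ν) (secT y) ∂(μ : Measure (Td d)))
  Fd_normalized : ∀ μ : PTd d, (∫ y, Fd (μ : Measure (Td d)) (secT y) ∂(μ : Measure (Td d))) = 0
  Fc_bounded : ∃ M : ℝ, ∀ μ : PTd d, |Fc μ| ≤ M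
  Fd_bounded : ∃ M : ℝ, ∀ (μ : PTd d) (x : Vd d), |Fd (μ : Measure (Td d)) x| ≤ M

/-- Smooth periodic test functions on `[0,∞) × 𝕋^d` (resp. `ℝ × 𝕋^d`). -/
def IsTestFun {d : ℕ} (φ : ℝ → Vd d → ℝ) : Prop :=
  ContDiff ℝ 2 (fun q : ℝ × Vd d => φ q.1 q.2) ∧
  ∀ (t : ℝ) (x : Vd d) (z : Fin d → ℤ), φ t (x + intVec z) = φ t x

/-- The weak (distributional) formulation of the Fokker--Planck equation
`-∂ₜ m + σ Δ m + div(m α) = 0` between times `s₁` and `s₂`. -/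
def FPeq {d : ℕ} (σ : ℝ) (m : ℝ → PTd d) (α : ℝ → Td d → Vd d) (s₁ s₂ : ℝ) : Prop :=
  ∀ φ : ℝ → Vd d → ℝ, IsTestFun φ →
    (∫ y, φ s₂ (secT y) ∂(m s₂ : Measure (Td d))) -
      (∫ y, φ s₁ (secT y) ∂(m s₁ : Measure (Td d))) =
    ∫ s in s₁..s₂, ∫ y, (tderiv φ s (secT y) + σ * lapl (φ s) (secT y)
        - dotp (α s y) (gradv (φ s) (secT y))) ∂(m s : Measure (Td d))

/-- Continuity of a curve of measures with respect to the 1-Wasserstein distance. -/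
def W1ContOn {d : ℕ} (m : ℝ → PTd d) (I : Set ℝ) : Prop :=
  ∀ t ∈ I, ∀ ε > 0, ∃ η > 0, ∀ s ∈ I, |s - t| < η → W1 (m s) (m t) < ε

/-- Continuity of a function on `P(𝕋^d)` with respect to the 1-Wasserstein distance. -/
def W1Continuous {d : ℕ} (χ : PTd d → ℝ) : Prop :=
  ∀ μ : PTd d, ∀ ε > 0, ∃ η > 0, ∀ ν : PTd d, W1 μ ν < η → |χ ν - χ μ| < ε

/-- W1-closed subsets of `P(𝕋^d)`. -/
def IsClosedW1 {d : ℕ} (C : Set (PTd d)) : Prop :=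
  ∀ μ : PTd d, (∀ ε > 0, ∃ ν ∈ C, W1 μ ν < ε) → μ ∈ C

/-- The running cost `∫ H*(x,α(s)) dm(s) + 𝓕(m(s))`. -/
def runCost {d : ℕ} (S : MFGSetting d) (m : ℝ → PTd d) (α : ℝ → Td d → Vd d) (s : ℝ) : ℝ :=
  (∫ y, S.Hstar (secT y) (α s y) ∂(m s : Measure (Td d))) + S.Fc (m s)

/-- Admissible pairs `(m,α)` on `[0,T]` starting from `m₀` (with `α ∈ L²_m`). -/
def AdmOn {d : ℕ} (S : MFGSetting d) (σ : ℝ) (m₀ : PTd d) (T : ℝ)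
    (m : ℝ → PTd d) (α : ℝ → Td d → Vd d) : Prop :=
  m 0 = m₀ ∧ W1ContOn m (Set.Icc 0 T) ∧
  (∀ s₁ s₂ : ℝ, 0 ≤ s₁ → s₁ ≤ s₂ → s₂ ≤ T → FPeq σ m α s₁ s₂) ∧
  Measurable (fun q : ℝ × Td d => α q.1 q.2) ∧
  (∫⁻ s in Set.Ioc (0:ℝ) T, ∫⁻ y, ENNReal.ofReal (sqnorm (α s y)) ∂(m s : Measure (Td d))) < ⊤ ∧
  IntervalIntegrable (runCost S m α) volume 0 T

/-- Admissible pairs `(m,α)` on `[0,T]` starting from `m₀`, with `α` merely in `L¹_m`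
(the class `Π_T` used for problems with prescribed endpoints). -/
def AdmOn1 {d : ℕ} (S : MFGSetting d) (σ : ℝ) (m₀ : PTd d) (T : ℝ)
    (m : ℝ → PTd d) (α : ℝ → Td d → Vd d) : Prop :=
  m 0 = m₀ ∧ W1ContOn m (Set.Icc 0 T) ∧
  (∀ s₁ s₂ : ℝ, 0 ≤ s₁ → s₁ ≤ s₂ → s₂ ≤ T → FPeq σ m α s₁ s₂) ∧
  Measurable (fun q : ℝ × Td d => α q.1 q.2) ∧
  (∫⁻ s in Set.Ioc (0:ℝ) T, ∫⁻ y, ENNReal.ofReal (Real.sqrt (sqnorm (α s y)))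
      ∂(m s : Measure (Td d))) < ⊤ ∧
  IntervalIntegrable (runCost S m α) volume 0 T

/-- The finite horizon cost. -/
def costT {d : ℕ} (S : MFGSetting d) (m : ℝ → PTd d) (α : ℝ → Td d → Vd d) (T : ℝ) : ℝ :=
  ∫ s in (0:ℝ)..T, runCost S m α s

/-- The value `𝒰(T,m₀)` of the finite horizon problem. -/
def Ufun {d : ℕ} (S : MFGSetting d) (σ : ℝ) (T : ℝ) (m₀ : PTd d) : ℝ :=
  sInf { r | ∃ m α, AdmOn S σ m₀ T m α ∧ r = costT S m α T }

/-- Admissible pairs for the infinite horizon `δ`-discounted problem. -/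
def AdmDisc {d : ℕ} (S : MFGSetting d) (σ : ℝ) (δ : ℝ) (m₀ : PTd d)
    (m : ℝ → PTd d) (α : ℝ → Td d → Vd d) : Prop :=
  m 0 = m₀ ∧ W1ContOn m (Set.Ici 0) ∧
  (∀ s₁ s₂ : ℝ, 0 ≤ s₁ → s₁ ≤ s₂ → FPeq σ m α s₁ s₂) ∧
  Measurable (fun q : ℝ × Td d => α q.1 q.2) ∧
  (∫⁻ s in Set.Ioi (0:ℝ), ENNReal.ofReal (Real.exp (-δ * s)) *
      ∫⁻ y, ENNReal.ofReal (sqnorm (α s y)) ∂(m s : Measure (Td d))) < ⊤ ∧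
  Integrable (fun s => Real.exp (-δ * s) * runCost S m α s) (volume.restrict (Set.Ioi 0))

/-- The discounted cost. -/
def costDisc {d : ℕ} (S : MFGSetting d) (δ : ℝ) (m : ℝ → PTd d) (α : ℝ → Td d → Vd d) : ℝ :=
  ∫ s in Set.Ioi (0:ℝ), Real.exp (-δ * s) * runCost S m α s

/-- The value `𝒱_δ(m₀)` of the discounted problem. -/
def Vfun {d : ℕ} (S : MFGSetting d) (σ : ℝ) (δ : ℝ) (m₀ : PTd d) : ℝ :=
  sInf { r | ∃ m α, AdmDisc S σ δ m₀ m α ∧ r = costDisc S δ m α }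

/-- `D_p H (x, p)`. -/
def DpH {d : ℕ} (S : MFGSetting d) (x p : Vd d) : Vd d :=
  fun i => fderiv ℝ (fun p' => S.H x p') p (Pi.single i 1)

/-- `C^{1,2}` regularity on `I × 𝕋^d` of a (periodic) time-dependent function. -/
def Creg12 {d : ℕ} (u : ℝ → Vd d → ℝ) (I : Set ℝ) : Prop :=
  ContinuousOn (fun q : ℝ × Vd d => u q.1 q.2) (I ×ˢ Set.univ) ∧
  (∀ x : Vd d, ∀ t ∈ I, DifferentiableAt ℝ (fun s => u s x) t) ∧
  (∀ t ∈ I, ContDiff ℝ 2 (u t)) ∧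
  (∀ t ∈ I, ∀ (x : Vd d) (z : Fin d → ℤ), u t (x + intVec z) = u t x)

/-- `(u,m)` is a classical solution of the `δ`-discounted MFG system on `[0,∞) × 𝕋^d`:
`-∂ₜ u - Δ u + δ u + H(x,Du) = F(x,m)` and `-∂ₜ m + Δ m + div(m D_pH(x,Du)) = 0`. -/
def SolvesDiscMFG {d : ℕ} (S : MFGSetting d) (δ : ℝ) (u : ℝ → Vd d → ℝ) (m : ℝ → PTd d) : Prop :=
  Creg12 u (Set.Ici 0) ∧
  (∀ t ∈ Set.Ici (0:ℝ), ∀ x : Vd d,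
    - tderiv u t x - lapl (u t) x + δ * u t x + S.H x (gradv (u t) x)
      = S.Fd (m t : Measure (Td d)) x) ∧
  W1ContOn m (Set.Ici 0) ∧
  (∀ s₁ s₂ : ℝ, 0 ≤ s₁ → s₁ ≤ s₂ →
    FPeq 1 m (fun s y => DpH S (secT y) (gradv (u s) (secT y))) s₁ s₂)

/-- Admissible pairs for the stationary (ergodic) problem:
`σ Δ m + div(m α) = 0` in the sense of distributions and `α ∈ L²_m`. -/
def StatAdm {d : ℕ} (σ : ℝ) (m : PTd d) (α : Td d → Vd d) : Prop :=
  Measurable α ∧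
  (∫⁻ y, ENNReal.ofReal (sqnorm (α y)) ∂(m : Measure (Td d))) < ⊤ ∧
  ∀ g : Vd d → ℝ, ContDiff ℝ 2 g → (∀ (x : Vd d) (z : Fin d → ℤ), g (x + intVec z) = g x) →
    (∫ y, (σ * lapl g (secT y) - dotp (α y) (gradv g (secT y))) ∂(m : Measure (Td d))) = 0

/-- `ergInf S σ = -λ̄`, the value of the stationary minimization problem. -/
def ergInf {d : ℕ} (S : MFGSetting d) (σ : ℝ) : ℝ :=
  sInf { r | ∃ m α, StatAdm σ m α ∧
    r = (∫ y, S.Hstar (secT y) (α y) ∂(m : Measure (Td d))) + S.Fc m }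

/-- The set of values over which the dynamic programming principle for a corrector
`χ` takes its infimum. -/
def DPPval {d : ℕ} (S : MFGSetting d) (σ : ℝ) (χ : PTd d → ℝ) (lam t : ℝ) (m₀ : PTd d) :
    Set ℝ :=
  { r | ∃ m α, AdmOn S σ m₀ t m α ∧
      r = (∫ s in (0:ℝ)..t, runCost S m α s) + χ (m t) + lam * t }

/-- `χ` is a corrector function: it is continuous and satisfies the dynamic
programming principle with the critical value `λ`. -/
def IsCorrector {d : ℕ} (S : MFGSetting d) (σ : ℝ) (lam : ℝ) (χ : PTd d → ℝ) : Prop :=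
  W1Continuous χ ∧ ∀ (m₀ : PTd d) (t : ℝ), 0 < t → χ m₀ = sInf (DPPval S σ χ lam t m₀)

/-- `(m,α)` is a calibrated curve (defined on all of `ℝ`). -/
def IsCalibrated {d : ℕ} (S : MFGSetting d) (σ : ℝ) (lam : ℝ)
    (m : ℝ → PTd d) (α : ℝ → Td d → Vd d) : Prop :=
  W1ContOn m Set.univ ∧
  (∀ s₁ s₂ : ℝ, s₁ ≤ s₂ → FPeq σ m α s₁ s₂) ∧
  Measurable (fun q : ℝ × Td d => α q.1 q.2) ∧
  (∀ t₁ t₂ : ℝ, (∫⁻ s in Set.Ioc t₁ t₂,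
      ∫⁻ y, ENNReal.ofReal (sqnorm (α s y)) ∂(m s : Measure (Td d))) < ⊤) ∧
  (∀ t₁ t₂ : ℝ, IntervalIntegrable (runCost S m α) volume t₁ t₂) ∧
  ∃ χ : PTd d → ℝ, IsCorrector S σ lam χ ∧ ∀ t₁ t₂ : ℝ, t₁ < t₂ →
    χ (m t₁) = lam * (t₂ - t₁) + (∫ s in t₁..t₂, runCost S m α s) + χ (m t₂)

/-- The projected Mather set. -/
def MatherSet {d : ℕ} (S : MFGSetting d) (σ : ℝ) (lam : ℝ) : Set (PTd d) :=
  { μ | ∃ m α, IsCalibrated S σ lam m α ∧ m 0 = μ }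

/-- Invariant subsets of the projected Mather set. -/
def IsInvariantMFG {d : ℕ} (S : MFGSetting d) (σ : ℝ) (lam : ℝ) (C : Set (PTd d)) : Prop :=
  ∀ μ ∈ C, ∃ m α, IsCalibrated S σ lam m α ∧ m 0 = μ ∧ ∀ t : ℝ, m t ∈ C

/-- Minimal invariant subsets of the projected Mather set. -/
def IsMinimalInvariant {d : ℕ} (S : MFGSetting d) (σ : ℝ) (lam : ℝ) (N : Set (PTd d)) : Prop :=
  N.Nonempty ∧ N ⊆ MatherSet S σ lam ∧ IsClosedW1 N ∧ IsInvariantMFG S σ lam N ∧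
  ∀ C : Set (PTd d), C ⊆ N → C.Nonempty → IsClosedW1 C → IsInvariantMFG S σ lam C → C = N

/-- `δ 𝒱_δ → -λ` uniformly as `δ → 0⁺`. -/
def IsLimitValueV {d : ℕ} (S : MFGSetting d) (σ : ℝ) (lam : ℝ) : Prop :=
  ∀ ε > 0, ∃ δ₀ > 0, ∀ δ : ℝ, 0 < δ → δ ≤ δ₀ → ∀ μ : PTd d,
    |δ * Vfun S σ δ μ - (-lam)| < ε

/-- `𝒰(T,·)/T → -λ` uniformly as `T → ∞`. -/
def IsLimitValueU {d : ℕ} (S : MFGSetting d) (σ : ℝ) (lam : ℝ) : Prop :=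
  ∀ ε > 0, ∃ T₀ : ℝ, ∀ T : ℝ, T₀ ≤ T → ∀ μ : PTd d,
    |Ufun S σ T μ / T - (-lam)| < ε

/-- A function `Φ` on `P(𝕋^d)` is `C¹` with flat derivative `dΦ` (normalized so that
`∫ dΦ(m,·) dm = 0`, periodic in the space variable and jointly continuous). -/
def IsC1Flat {d : ℕ} (Φ : PTd d → ℝ) (dΦ : Measure (Td d) → Vd d → ℝ) : Prop :=
  (∀ (μ : Measure (Td d)) (x : Vd d) (z : Fin d → ℤ), dΦ μ (x + intVec z) = dΦ μ x) ∧
  (∀ μ ν : PTd d,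
    Φ ν - Φ μ = ∫ t in Set.Icc (0:ℝ) 1,
      ((∫ y, dΦ (lineComb t μ ν) (secT y) ∂(ν : Measure (Td d))) -
        ∫ y, dΦ (lineComb t μ ν) (secT y) ∂(μ : Measure (Td d)))) ∧
  (∀ μ : PTd d, (∫ y, dΦ (μ : Measure (Td d)) (secT y) ∂(μ : Measure (Td d))) = 0) ∧
  (∀ ε > 0, ∀ (μ : PTd d) (x : Vd d), ∃ η > 0, ∀ (ν : PTd d) (x' : Vd d),
    W1 μ ν < η → ‖x' - x‖ < η → |dΦ (ν : Measure (Td d)) x' - dΦ (μ : Measure (Td d)) x| < ε)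

/-! ### Torus basics -/

def prT {d : ℕ} (x : Vd d) : Td d := fun i => (x i : AddCircle (1:ℝ))

lemma prT_secT {d : ℕ} (y : Td d) : prT (secT y) = y := by
  funext i
  exact (AddCircle.equivIco 1 0).symm_apply_apply (y i)

lemma secT_prT {d : ℕ} (x : Vd d) : ∃ z : Fin d → ℤ, secT (prT x) = x + intVec z := by
  have h : ∀ i, ∃ n : ℤ, secT (prT x) i = x i + n := by
    intro i
    have h1 : ((secT (prT x) i : ℝ) : AddCircle (1:ℝ)) = (x i : AddCircle (1:ℝ)) :=
      congrFun (prT_secT (prT x)) i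
    have h2 : ((secT (prT x) i - x i : ℝ) : AddCircle (1:ℝ)) = 0 := by
      rw [AddCircle.coe_sub, h1, sub_self]
    obtain ⟨n, hn⟩ := (AddCircle.coe_eq_zero_iff (1:ℝ)).1 h2
    refine ⟨n, ?_⟩
    simp at hn
    linarith
  choose z hz using h
  exact ⟨z, funext hz⟩

lemma continuous_prT {d : ℕ} : Continuous (prT (d := d)) :=
  continuous_pi fun i => (AddCircle.continuous_mk' (1:ℝ)).comp (continuous_apply i)

lemma measurable_prT {d : ℕ} : Measurable (prT (d := d)) := by
  refine measurable_pi_lambda _ fun i => ?_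
  exact AddCircle.measurable_mk'.comp (measurable_pi_apply i)

lemma measurable_secT {d : ℕ} : Measurable (secT (d := d)) := by
  refine measurable_pi_lambda _ fun i => ?_
  exact measurable_subtype_coe.comp
    ((AddCircle.measurableEquivIco (1:ℝ) 0).measurable.comp (measurable_pi_apply i))

def vecT {d : ℕ} (a b : Td d) : Vd d :=
  fun i => ((AddCircle.equivIco (1:ℝ) (-1/2)) (b i - a i)).1

lemma measurable_vecT {d : ℕ} : Measurable (fun q : Td d × Td d => vecT q.1 q.2) := by
  refine measurable_pi_lambda _ fun i => ?_
  refine measurable_subtype_coe.comp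
    ((AddCircle.measurableEquivIco (1:ℝ) (-1/2)).measurable.comp ?_)
  exact ((measurable_pi_apply i).comp measurable_snd).sub
    ((measurable_pi_apply i).comp measurable_fst)

lemma prT_add_vecT {d : ℕ} (a b : Td d) : prT (secT a + vecT a b) = b := by
  funext i
  have h1 : ((secT a i : ℝ) : AddCircle (1:ℝ)) = a i := congrFun (prT_secT a) i
  have h2 : ((vecT a b i : ℝ) : AddCircle (1:ℝ)) = b i - a i :=
    (AddCircle.equivIco 1 (-1/2)).symm_apply_apply (b i - a i)
  show ((secT a i + vecT a b i : ℝ) : AddCircle (1:ℝ)) = b i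
  rw [AddCircle.coe_add, h1, h2]
  abel

lemma norm_vecT_le {d : ℕ} (a b : Td d) : ‖vecT a b‖ ≤ dist a b := by
  rw [pi_norm_le_iff_of_nonneg dist_nonneg]
  intro i
  have h2 : ((vecT a b i : ℝ) : AddCircle (1:ℝ)) = b i - a i :=
    (AddCircle.equivIco 1 (-1/2)).symm_apply_apply (b i - a i)
  have h3 : vecT a b i ∈ Set.Ico (-1/2:ℝ) (-1/2+1) :=
    ((AddCircle.equivIco (1:ℝ) (-1/2)) (b i - a i)).2
  have h4 : ‖((vecT a b i : ℝ) : AddCircle (1:ℝ))‖ = |vecT a b i| := by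
    rw [AddCircle.norm_coe_eq_abs_iff (1:ℝ) one_ne_zero, abs_le]
    simp only [abs_one]
    constructor <;> linarith [h3.1, h3.2]
  rw [Real.norm_eq_abs, ← h4, h2, ← dist_eq_norm, dist_comm]
  exact dist_le_pi_dist a b i

lemma dist_prT_le {d : ℕ} (x y : Vd d) : dist (prT x) (prT y) ≤ ‖x - y‖ := by
  rw [dist_pi_le_iff (norm_nonneg _)]
  intro i
  have h1 : dist (prT x i) (prT y i) = ‖((x i - y i : ℝ) : AddCircle (1:ℝ))‖ := by
    rw [dist_eq_norm, AddCircle.coe_sub]; rfl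
  rw [h1]
  refine le_trans (QuotientAddGroup.norm_mk_le_norm (S := AddSubgroup.zmultiples (1:ℝ)) (m := x i - y i)) (norm_le_pi_norm (x - y) i)

lemma dist_Td_le {d : ℕ} (a b : Td d) : dist a b ≤ 1 := by
  rw [dist_pi_le_iff zero_le_one]
  intro i
  rw [dist_eq_norm]
  have := AddCircle.norm_le_half_period (1:ℝ) one_ne_zero (x := a i - b i)
  simp at this
  linarith

def IsPer {d : ℕ} (g : Vd d → ℝ) : Prop := ∀ (x : Vd d) (z : Fin d → ℤ), g (x + intVec z) = g x

lemma IsPer.sec {d : ℕ} {g : Vd d → ℝ} (hg : IsPer g) (x : Vd d) : g (secT (prT x)) = g x := by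
  obtain ⟨z, hz⟩ := secT_prT x
  rw [hz, hg]

lemma secT_mem {d : ℕ} (y : Td d) : secT y ∈ Set.Icc (0 : Vd d) 1 := by
  have h : ∀ i, secT y i ∈ Set.Ico (0:ℝ) (0+1) := fun i => ((AddCircle.equivIco 1 0) (y i)).2
  exact ⟨fun i => (h i).1, fun i => by have := (h i).2; simp at this; simpa using this.le⟩

lemma sec_lip {d : ℕ} {g : Vd d → ℝ} (hg : IsPer g) {L : ℝ} (hL : 0 ≤ L)
    (hl : ∀ x y, |g x - g y| ≤ L * ‖x - y‖) (a b : Td d) :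
    |g (secT a) - g (secT b)| ≤ L * dist a b := by
  have h : g (secT b) = g (secT a + vecT a b) := by
    rw [← hg.sec (secT a + vecT a b), prT_add_vecT]
  rw [h]
  refine (hl _ _).trans ?_
  have : secT a - (secT a + vecT a b) = - vecT a b := by abel
  rw [this, norm_neg]
  exact mul_le_mul_of_nonneg_left (norm_vecT_le a b) hL

/-! ### W1 -/

lemma lip_bdd {d : ℕ} {φ : Td d → ℝ} {L : NNReal} (h : LipschitzWith L φ) :
    ∃ M, ∀ y, |φ y| ≤ M := by
  refine ⟨|φ 0| + L, fun y => ?_⟩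
  have h1 := h.dist_le_mul y 0
  rw [Real.dist_eq] at h1
  have h2 : (L:ℝ) * dist y 0 ≤ L := by
    have := mul_le_mul_of_nonneg_left (dist_Td_le y 0) L.2
    simpa using this
  have h3 : |φ y| ≤ |φ y - φ 0| + |φ 0| := by
    have := abs_add_le (φ y - φ 0) (φ 0); simpa using this
  linarith

lemma integrable_of_bdd {α : Type*} [MeasurableSpace α] {μ : Measure α} [IsFiniteMeasure μ]
    {f : α → ℝ} (hf : Measurable f) {M : ℝ} (hM : ∀ y, |f y| ≤ M) : Integrable f μ :=
  Integrable.of_bound hf.aestronglyMeasurable M (Eventually.of_forall fun y => hM y)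

lemma W1_bdd {d : ℕ} (μ ν : PTd d) : BddAbove { r | ∃ φ : Td d → ℝ, LipschitzWith 1 φ ∧
    r = (∫ y, φ y ∂(μ : Measure (Td d))) - ∫ y, φ y ∂(ν : Measure (Td d)) } := by
  refine ⟨2, ?_⟩
  rintro r ⟨φ, hφ, rfl⟩
  obtain ⟨M, hM⟩ := lip_bdd hφ
  have key : ∀ ρ : PTd d, |(∫ y, φ y ∂(ρ : Measure (Td d))) - φ 0| ≤ 1 := by
    intro ρ
    have h1 : (∫ y, φ y ∂(ρ : Measure (Td d))) - φ 0
        = ∫ y, (φ y - φ 0) ∂(ρ : Measure (Td d)) := by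
      rw [integral_sub (integrable_of_bdd hφ.continuous.measurable hM) (integrable_const _)]
      simp
    rw [h1]
    have h2 := norm_integral_le_of_norm_le_const (μ := (ρ : Measure (Td d)))
      (f := fun y => φ y - φ 0) (C := 1) (Eventually.of_forall fun y => by
        have := hφ.dist_le_mul y 0
        rw [Real.dist_eq] at this
        have h3 := dist_Td_le y 0
        simp only [NNReal.coe_one, one_mul] at this
        rw [Real.norm_eq_abs]; linarith)
    simpa using h2
  have h1 := abs_le.1 (key μ)
  have h2 := abs_le.1 (key ν)
  linarith [h1.1, h1.2, h2.1, h2.2]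

lemma W1_le {d : ℕ} {μ ν : PTd d} {B : ℝ}
    (h : ∀ φ : Td d → ℝ, LipschitzWith 1 φ →
      (∫ y, φ y ∂(μ : Measure (Td d))) - ∫ y, φ y ∂(ν : Measure (Td d)) ≤ B) : W1 μ ν ≤ B := by
  refine csSup_le ⟨_, fun _ => 0, (LipschitzWith.const 0).weaken zero_le_one, rfl⟩ ?_
  rintro r ⟨φ, hφ, rfl⟩
  exact h φ hφ

lemma le_W1 {d : ℕ} (μ ν : PTd d) {φ : Td d → ℝ} (hφ : LipschitzWith 1 φ) :
    |(∫ y, φ y ∂(μ : Measure (Td d))) - ∫ y, φ y ∂(ν : Measure (Td d))| ≤ W1 μ ν := by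
  rw [abs_le']
  refine ⟨le_csSup (W1_bdd μ ν) ⟨φ, hφ, rfl⟩, le_csSup (W1_bdd μ ν) ⟨fun y => - φ y, ?_, ?_⟩⟩
  · exact hφ.neg
  · rw [integral_neg, integral_neg]; ring

lemma lip_W1 {d : ℕ} (μ ν : PTd d) {φ : Td d → ℝ} {L : ℝ} (hL : 0 ≤ L)
    (hφ : ∀ a b, |φ a - φ b| ≤ L * dist a b) :
    |(∫ y, φ y ∂(μ : Measure (Td d))) - ∫ y, φ y ∂(ν : Measure (Td d))| ≤ L * W1 μ ν := by
  rcases hL.eq_or_lt with h0 | hpos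
  · have hc : ∀ a, φ a = φ 0 := fun a => by
      have := hφ a 0
      rw [← h0, zero_mul] at this
      linarith [abs_nonpos_iff.1 this]
    simp_rw [hc]
    simp [← h0]
  · have h1 : LipschitzWith 1 (fun y => L⁻¹ * φ y) := by
      refine LipschitzWith.of_dist_le_mul fun a b => ?_
      rw [Real.dist_eq, ← mul_sub, abs_mul, abs_of_pos (inv_pos.2 hpos)]
      calc L⁻¹ * |φ a - φ b| ≤ L⁻¹ * (L * dist a b) :=
            mul_le_mul_of_nonneg_left (hφ a b) (inv_pos.2 hpos).le
        _ = _ := by field_simp; simp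
    have h2 := le_W1 μ ν h1
    rw [integral_const_mul, integral_const_mul, ← mul_sub, abs_mul,
      abs_of_pos (inv_pos.2 hpos)] at h2
    calc _ = L * (L⁻¹ * |(∫ y, φ y ∂(μ : Measure (Td d))) - ∫ y, φ y ∂(ν : Measure (Td d))|) := by
            field_simp
      _ ≤ _ := mul_le_mul_of_nonneg_left h2 hL

lemma W1_symm {d : ℕ} (μ ν : PTd d) : W1 μ ν = W1 ν μ := by
  apply le_antisymm
  · exact W1_le fun φ hφ => by
      have := le_W1 ν μ hφ
      rw [abs_sub_comm] at this
      exact (le_abs_self _).trans this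
  · exact W1_le fun φ hφ => by
      have := le_W1 μ ν hφ
      rw [abs_sub_comm] at this
      exact (le_abs_self _).trans this

/-! ### Estimates on H, Hstar, F -/

lemma sqnorm_nonneg {d : ℕ} (v : Vd d) : 0 ≤ sqnorm v := Finset.sum_nonneg fun _ _ => sq_nonneg _

lemma norm_sq_le_sqnorm {d : ℕ} (v : Vd d) : ‖v‖ ^ 2 ≤ sqnorm v := by
  have h : ‖v‖ ≤ Real.sqrt (sqnorm v) := by
    rw [pi_norm_le_iff_of_nonneg (Real.sqrt_nonneg _)]
    intro i
    rw [Real.norm_eq_abs]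
    apply Real.abs_le_sqrt
    exact Finset.single_le_sum (f := fun i => (v i)^2) (fun i _ => sq_nonneg _) (Finset.mem_univ i)
  calc ‖v‖^2 ≤ (Real.sqrt (sqnorm v))^2 := by gcongr
    _ = _ := Real.sq_sqrt (sqnorm_nonneg v)

lemma sqnorm_le {d : ℕ} (v : Vd d) : sqnorm v ≤ d * ‖v‖ ^ 2 := by
  have : sqnorm v ≤ ∑ _i : Fin d, ‖v‖^2 := by
    refine Finset.sum_le_sum fun i _ => ?_
    rw [← sq_abs]
    have := norm_le_pi_norm v i
    rw [Real.norm_eq_abs] at this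
    gcongr
  simpa using this

lemma sqnorm_add_le {d : ℕ} (v w : Vd d) : sqnorm (v + w) ≤ 2 * sqnorm v + 2 * sqnorm w := by
  unfold sqnorm
  rw [Finset.mul_sum, Finset.mul_sum, ← Finset.sum_add_distrib]
  refine Finset.sum_le_sum fun i _ => ?_
  simp only [Pi.add_apply]
  nlinarith [sq_nonneg (v i - w i)]

lemma abs_dotp_le {d : ℕ} (v w : Vd d) : |dotp v w| ≤ d * (‖v‖ * ‖w‖) := by
  have : |dotp v w| ≤ ∑ _i : Fin d, ‖v‖ * ‖w‖ := by
    refine (Finset.abs_sum_le_sum_abs _ _).trans (Finset.sum_le_sum fun i _ => ?_)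
    rw [abs_mul]
    exact mul_le_mul (norm_le_pi_norm v i) (norm_le_pi_norm w i) (abs_nonneg _) (norm_nonneg _)
  simpa using this

lemma dotp_le_young {d : ℕ} {c : ℝ} (hc : 0 < c) (q p : Vd d) :
    dotp q p ≤ sqnorm q / (2 * c) + c / 2 * sqnorm p := by
  unfold dotp sqnorm
  rw [Finset.sum_div, Finset.mul_sum, ← Finset.sum_add_distrib]
  refine Finset.sum_le_sum fun i _ => ?_
  have h : 0 ≤ (q i - c * p i)^2 / (2 * c) := by positivity
  have e : (q i - c * p i)^2 / (2 * c) = q i ^ 2 / (2*c) + c / 2 * p i ^ 2 - q i * p i := by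
    field_simp
    ring
  linarith

lemma norm_le_one_add_sqnorm {d : ℕ} (v : Vd d) : ‖v‖ ≤ 1 + sqnorm v := by
  have := norm_sq_le_sqnorm v
  nlinarith [sq_nonneg (‖v‖ - 1), norm_nonneg v]

lemma fderiv_bound_of_per {d : ℕ} {g : Vd d → ℝ} (hg : ContDiff ℝ 2 g) (hp : IsPer g) {M : ℝ}
    (hM : ∀ x v w : Vd d, |D2 g x v w| ≤ M * ‖v‖ * ‖w‖) (x : Vd d) :
    ‖fderiv ℝ g x‖ ≤ d * M := by
  have h1 : ∀ i : Fin d, |fderiv ℝ g x (Pi.single i 1)| ≤ M := by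
    intro i
    set e : Vd d := Pi.single i 1 with he
    have hne : ‖e‖ = 1 := by rw [he, Pi.norm_single]; simp
    have hdg : Differentiable ℝ g := hg.differentiable (by norm_num)
    have hline : ∀ t : ℝ, HasDerivAt (fun t : ℝ => x + t • e) e t := by
      intro t
      simpa using ((hasDerivAt_id t).smul_const e).const_add x
    have hf : ∀ t : ℝ, HasDerivAt (fun t : ℝ => g (x + t • e)) (fderiv ℝ g (x + t • e) e) t :=
      fun t => (hdg _).hasFDerivAt.comp_hasDerivAt t (hline t)
    have hdg1 : Differentiable ℝ (fun y => fderiv ℝ g y e) := by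
      have : ContDiff ℝ 1 (fderiv ℝ g) := hg.fderiv_right (by norm_num)
      exact (this.clm_apply contDiff_const).differentiable (by norm_num)
    have hf1 : ∀ t : ℝ, HasDerivAt (fun t : ℝ => fderiv ℝ g (x + t • e) e)
        (D2 g (x + t • e) e e) t :=
      fun t => (hdg1 _).hasFDerivAt.comp_hasDerivAt t (hline t)
    have h01 : (fun t : ℝ => g (x + t • e)) 0 = (fun t : ℝ => g (x + t • e)) 1 := by
      have : (1:ℝ) • e = intVec (Pi.single i 1) := by
        funext j
        simp only [one_smul, he, intVec, Pi.single_apply]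
        split_ifs <;> simp
      simp only [this]
      rw [hp]; simp
    obtain ⟨c, hc, hc0⟩ := exists_hasDerivAt_eq_zero (f := fun t : ℝ => g (x + t • e)) one_pos
      (fun t _ => (hf t).continuousAt.continuousWithinAt) h01 (fun t _ => hf t)
    have h2 := Convex.norm_image_sub_le_of_norm_hasDerivWithin_le
      (f := fun t : ℝ => fderiv ℝ g (x + t • e) e) (C := M) (s := Set.univ)
      (x := c) (y := 0)
      (fun t _ => (hf1 t).hasDerivWithinAt) (fun t _ => by
        have := hM (x + t • e) e e
        rw [hne] at this
        simpa using this) convex_univ (Set.mem_univ _) (Set.mem_univ _)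
    have hM0 : 0 ≤ M := by
      have := (abs_nonneg _).trans (hM x e e)
      rw [hne] at this; simpa using this
    simp only [hc0, zero_smul, add_zero, sub_zero, zero_sub, norm_neg, Real.norm_eq_abs] at h2
    refine h2.trans ?_
    rw [abs_of_pos hc.1]
    nlinarith [hc.2]
  have hM0 : (d:ℝ) = 0 ∨ 0 ≤ M := by
    rcases Nat.eq_zero_or_pos d with h | h
    · left; simp [h]
    · right; exact (abs_nonneg _).trans (h1 ⟨0, h⟩)
  refine ContinuousLinearMap.opNorm_le_bound _ ?_ fun v => ?_
  · rcases hM0 with h | h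
    · rw [h]; simp
    · positivity
  · have hv : v = ∑ i, v i • (Pi.single i (1:ℝ) : Vd d) := by
      simpa using (pi_eq_sum_univ' v)
    have : fderiv ℝ g x v = ∑ i, v i * fderiv ℝ g x (Pi.single i 1) := by
      conv_lhs => rw [hv]
      rw [map_sum]
      simp
    rw [this]
    have h3 : ‖∑ i, v i * fderiv ℝ g x (Pi.single i 1)‖ ≤ ∑ _i : Fin d, ‖v‖ * M := by
      refine (norm_sum_le _ _).trans (Finset.sum_le_sum fun i _ => ?_)
      rw [norm_mul]
      exact mul_le_mul (norm_le_pi_norm v i) (h1 i) (abs_nonneg _) (norm_nonneg _)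
    refine h3.trans (le_of_eq ?_)
    simp
    ring

lemma lip_of_per {d : ℕ} {g : Vd d → ℝ} (hg : ContDiff ℝ 2 g) (hp : IsPer g) {M : ℝ}
    (hM : ∀ x v w : Vd d, |D2 g x v w| ≤ M * ‖v‖ * ‖w‖) (x y : Vd d) :
    |g x - g y| ≤ d * M * ‖x - y‖ :=
  Convex.norm_image_sub_le_of_norm_fderiv_le (𝕜 := ℝ) (s := Set.univ)
    (fun _ _ => hg.differentiable (by norm_num) _)
    (fun z _ => fderiv_bound_of_per hg hp hM z) convex_univ (Set.mem_univ y) (Set.mem_univ x)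

lemma taylor_lower {f f1 f2 : ℝ → ℝ} {a : ℝ} (h1 : ∀ t, HasDerivAt f (f1 t) t)
    (h2 : ∀ t, HasDerivAt f1 (f2 t) t) (ha : ∀ t, a ≤ f2 t) : f 0 + f1 0 + a / 2 ≤ f 1 := by
  have hm : Monotone (fun t => f1 t - a * t) := by
    refine monotone_of_hasDerivAt_nonneg (f' := fun t => f2 t - a) (fun t => ?_) (fun t => ?_)
    · exact (h2 t).sub (by simpa using (hasDerivAt_id t).const_mul a)
    · exact sub_nonneg.2 (ha t)
  have hm2 : MonotoneOn (fun t => f t - f1 0 * t - a * t^2/2) (Set.Ici 0) := by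
    have hd : ∀ t, HasDerivAt (fun t => f t - f1 0 * t - a * t^2/2) (f1 t - f1 0 - a * t) t := by
      intro t
      have e1 : HasDerivAt (fun t : ℝ => f1 0 * t) (f1 0) t := by
        simpa using (hasDerivAt_id t).const_mul (f1 0)
      have e2 : HasDerivAt (fun t : ℝ => a * t^2/2) (a * t) t := by
        have := ((hasDerivAt_pow 2 t).const_mul a).div_const 2
        refine this.congr_deriv ?_
        push_cast; ring
      exact ((h1 t).sub e1).sub e2
    refine monotoneOn_of_deriv_nonneg (convex_Ici 0)
      (fun t _ => (hd t).continuousAt.continuousWithinAt)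
      (fun t _ => (hd t).differentiableAt.differentiableWithinAt) (fun t ht => ?_)
    rw [(hd t).deriv]
    rw [interior_Ici] at ht
    have := hm (le_of_lt ht)
    simp at this
    linarith
  have := hm2 (Set.mem_Ici.2 le_rfl) (Set.mem_Ici.2 zero_le_one) zero_le_one
  simp at this
  linarith

lemma taylor_upper {f f1 f2 : ℝ → ℝ} {a : ℝ} (h1 : ∀ t, HasDerivAt f (f1 t) t)
    (h2 : ∀ t, HasDerivAt f1 (f2 t) t) (ha : ∀ t, f2 t ≤ a) : f 1 ≤ f 0 + f1 0 + a / 2 := by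
  have := taylor_lower (f := fun t => - f t) (f1 := fun t => - f1 t) (f2 := fun t => - f2 t)
    (a := -a) (fun t => (h1 t).neg) (fun t => (h2 t).neg) (fun t => neg_le_neg (ha t))
  linarith

section PS
variable {d : ℕ} (S : MFGSetting d)

lemma H_slice_p (x : Vd d) : ContDiff ℝ 2 (fun p => S.H x p) :=
  S.H_smooth.comp (contDiff_const.prodMk contDiff_id)

lemma H_slice_x (p : Vd d) : ContDiff ℝ 2 (fun x => S.H x p) :=
  S.H_smooth.comp (contDiff_id.prodMk contDiff_const)

lemma H_sec (x : Vd d) : (fun p => S.H (secT (prT x)) p) = fun p => S.H x p := by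
  funext p
  exact IsPer.sec (g := fun x => S.H x p) (fun x z => S.H_per x z p) x

lemma H_zero_bound : ∃ C : ℝ, 0 ≤ C ∧ ∀ x : Vd d, |S.H x 0| ≤ C ∧
    ∀ v, |fderiv ℝ (fun p => S.H x p) 0 v| ≤ C * ‖v‖ := by
  have hc : IsCompact (Set.Icc (0 : Vd d) 1) := isCompact_Icc
  have c1 : Continuous (fun x : Vd d => S.H x 0) := (H_slice_x S 0).continuous
  have c2 : Continuous (fun x : Vd d => fderiv ℝ (fun q : Vd d × Vd d => S.H q.1 q.2) (x, 0)) :=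
    (S.H_smooth.continuous_fderiv (by norm_num)).comp (continuous_id.prodMk continuous_const)
  obtain ⟨C1, h1⟩ := hc.exists_bound_of_continuousOn c1.continuousOn
  obtain ⟨C2, h2⟩ := hc.exists_bound_of_continuousOn c2.continuousOn
  refine ⟨max 0 (max C1 C2), le_max_left _ _, fun x => ⟨?_, fun v => ?_⟩⟩
  · have := h1 _ (secT_mem (prT x))
    rw [congrFun (H_sec S x) 0] at this
    exact this.trans ((le_max_left _ _).trans (le_max_right _ _))
  · have e : fderiv ℝ (fun p => S.H x p) 0 v
        = fderiv ℝ (fun q : Vd d × Vd d => S.H q.1 q.2) (secT (prT x), 0) (0, v) := by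
      rw [← H_sec S x]
      have hd : HasFDerivAt (fun q : Vd d × Vd d => S.H q.1 q.2) _ (secT (prT x), 0) :=
        (S.H_smooth.differentiable (by norm_num) _).hasFDerivAt
      have hl : HasFDerivAt (fun p : Vd d => (secT (prT x), p))
          ((0 : Vd d →L[ℝ] Vd d).prod (ContinuousLinearMap.id ℝ (Vd d))) 0 :=
        (hasFDerivAt_const _ _).prodMk (hasFDerivAt_id _)
      have := (hd.comp (0 : Vd d) hl).fderiv
      have e2 : ((fun q : Vd d × Vd d => S.H q.1 q.2) ∘ fun p : Vd d => (secT (prT x), p))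
        = fun p => S.H (secT (prT x)) p := rfl
      rw [e2] at this
      rw [this]
      simp
    rw [e]
    have h3 := ContinuousLinearMap.le_opNorm
      (fderiv ℝ (fun q : Vd d × Vd d => S.H q.1 q.2) (secT (prT x), 0)) (0, v)
    rw [Real.norm_eq_abs] at h3
    refine h3.trans ?_
    have h4 : ‖((0 : Vd d), v)‖ = ‖v‖ := by simp [Prod.norm_def]
    rw [h4]
    refine mul_le_mul_of_nonneg_right ?_ (norm_nonneg _)
    exact (h2 _ (secT_mem (prT x))).trans ((le_max_right _ _).trans (le_max_right _ _))

lemma H_bounds : ∃ c C : ℝ, 0 < c ∧ 0 ≤ C ∧ ∀ x p : Vd d,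
    c * sqnorm p - C ≤ S.H x p ∧ S.H x p ≤ C * (1 + sqnorm p) ∧ |S.H x 0| ≤ C := by
  obtain ⟨C, hC, hb⟩ := H_zero_bound S
  have hcb := S.Cbar_pos
  have hci : 0 < S.Cbar⁻¹ := inv_pos.2 hcb
  set k := S.Cbar⁻¹ with hk
  refine ⟨k / 4, C + C^2 / k + 2*C + S.Cbar, by positivity, by positivity, fun x p => ?_⟩
  have hl : ∀ t : ℝ, HasDerivAt (fun t : ℝ => t • p) p t := fun t => by
    simpa using ((hasDerivAt_id t).smul_const p)
  have hd0 := H_slice_p S x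
  have h1 : ∀ t : ℝ, HasDerivAt (fun t : ℝ => S.H x (t • p))
      (fderiv ℝ (fun p => S.H x p) (t • p) p) t := fun t =>
    (hd0.differentiable (by norm_num) _).hasFDerivAt.comp_hasDerivAt t (hl t)
  have hdg1 : Differentiable ℝ (fun y => fderiv ℝ (fun p => S.H x p) y p) := by
    have : ContDiff ℝ 1 (fderiv ℝ (fun p => S.H x p)) := hd0.fderiv_right (by norm_num)
    exact (this.clm_apply contDiff_const).differentiable (by norm_num)
  have h2 : ∀ t : ℝ, HasDerivAt (fun t : ℝ => fderiv ℝ (fun p => S.H x p) (t • p) p)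
      (D2 (fun p => S.H x p) (t • p) p p) t := fun t =>
    (hdg1 _).hasFDerivAt.comp_hasDerivAt t (hl t)
  have l1 := taylor_lower h1 h2 (fun t => S.Dpp_lower x (t • p) p)
  have l2 := taylor_upper h1 h2 (fun t => S.Dpp_upper x (t • p) p)
  simp only [zero_smul, one_smul] at l1 l2
  obtain ⟨b0, b1⟩ := hb x
  have b0' := abs_le.1 b0
  have b1' := abs_le.1 (b1 p)
  have hn := norm_sq_le_sqnorm p
  have hn2 := norm_le_one_add_sqnorm p
  have hs := sqnorm_nonneg p
  have y1 : C * ‖p‖ ≤ C^2/k + k/4 * ‖p‖^2 := by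
    have : 0 ≤ (C - k/2 * ‖p‖)^2 / k := by positivity
    have e : (C - k/2 * ‖p‖)^2 / k = C^2/k + k/4 * ‖p‖^2 - C * ‖p‖ := by field_simp; ring
    linarith
  have hq : 0 ≤ C^2/k := by positivity
  refine ⟨?_, ?_, ?_⟩
  · nlinarith
  · nlinarith [mul_le_mul_of_nonneg_left hn2 hC, mul_nonneg hC hs, mul_nonneg hq hs,
      mul_nonneg hcb.le hs]
  · linarith

lemma H_lip_x (x y p : Vd d) : |S.H x p - S.H y p| ≤ d * S.Cg * (2 + 2 * sqnorm p) * ‖x - y‖ := by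
  have hθ := S.θ_mem
  have h := lip_of_per (H_slice_x S p) (fun x z => S.H_per x z p)
    (fun x v w => S.Dxx_growth x p v w) x y
  refine h.trans ?_
  have h1 : (1 + ‖p‖) ^ (1 + S.θ) ≤ 2 + 2 * sqnorm p := by
    have : (1 + ‖p‖) ^ (1 + S.θ) ≤ (1 + ‖p‖) ^ (2:ℝ) :=
      Real.rpow_le_rpow_of_exponent_le (by linarith [norm_nonneg p]) (by linarith [hθ.2])
    refine this.trans ?_
    rw [Real.rpow_two]
    nlinarith [norm_sq_le_sqnorm p, sq_nonneg (‖p‖ - 1)]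
  have hC := S.Cg_pos.le
  calc (d:ℝ) * (S.Cg * (1 + ‖p‖) ^ (1 + S.θ)) * ‖x - y‖
      ≤ d * (S.Cg * (2 + 2 * sqnorm p)) * ‖x - y‖ := by gcongr
    _ = _ := by ring

lemma Hstar_bounds : ∃ c C : ℝ, 0 < c ∧ 0 ≤ C ∧
    (∀ x q : Vd d, c * sqnorm q - C ≤ S.Hstar x q) ∧
    (∀ x q : Vd d, S.Hstar x q ≤ C * (1 + sqnorm q)) ∧
    (∀ x h q k : Vd d, S.Hstar (x + h) (q + k) ≤
      S.Hstar x q + C * (‖h‖ + ‖k‖) * (1 + sqnorm q + sqnorm k)) := by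
  obtain ⟨c, C, hc, hC, hb⟩ := H_bounds S
  have hlb : ∀ x q p : Vd d, dotp q p - S.H x p ≤ S.Hstar x q := fun x q p =>
    (S.Hstar_eq x q).1 ⟨p, rfl⟩
  have hs := fun v : Vd d => sqnorm_nonneg v
  have hCg := S.Cg_pos
  -- near maximizers
  have hmax : ∀ x q : Vd d, ∀ ε > 0, ε ≤ 1 → ∃ p : Vd d, S.Hstar x q - ε < dotp q p - S.H x p ∧
      sqnorm p ≤ (1 / c^2 + (4 * C + 2) / c) * (1 + sqnorm q) := by
    intro x q ε hε hε1
    obtain ⟨_, ⟨p, rfl⟩, hp⟩ := (lt_isLUB_iff (S.Hstar_eq x q)).1 (sub_lt_self _ hε)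
    refine ⟨p, hp, ?_⟩
    have h0 := hlb x q 0
    have e0 : dotp q 0 = 0 := by simp [dotp]
    rw [e0] at h0
    have h1 := (hb x p).1
    have h2 := (abs_le.1 (hb x p).2.2).2
    have h3 := dotp_le_young hc q p
    have h4 : c / 2 * sqnorm p ≤ sqnorm q / (2 * c) + (2 * C + 1) := by linarith
    have h5 : sqnorm p ≤ sqnorm q / c^2 + (4 * C + 2) / c := by
      have := mul_le_mul_of_nonneg_left h4 (show 0 ≤ 2 / c by positivity)
      calc sqnorm p = 2 / c * (c / 2 * sqnorm p) := by field_simp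
        _ ≤ _ := this
        _ = _ := by field_simp; ring
    have h6 : 0 ≤ (4 * C + 2) / c * sqnorm q := mul_nonneg (by positivity) (hs q)
    have h7 : 0 ≤ 1 / c^2 := by positivity
    have : sqnorm q / c^2 = 1 / c^2 * sqnorm q := by ring
    nlinarith
  set B := 1 / c^2 + (4 * C + 2) / c with hB
  have hB0 : 0 ≤ B := by positivity
  refine ⟨1 / (4 * (C + 1)), max C (max (1 / (4 * c) + C) ((d + 4 * d * S.Cg) * (2 * (1 + B)))),
    by positivity, le_max_of_le_left hC, ?_, ?_, ?_⟩
  · intro x q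
    have h1 := hlb x q ((1 / (2 * (C+1))) • q)
    have h2 := (hb x ((1 / (2 * (C+1))) • q)).2.1
    have e1 : dotp q ((1 / (2 * (C+1))) • q) = 1 / (2 * (C+1)) * sqnorm q := by
      unfold dotp sqnorm
      rw [Finset.mul_sum]
      refine Finset.sum_congr rfl fun i _ => ?_
      simp; ring
    have e2 : sqnorm ((1 / (2 * (C+1))) • q) = 1 / (2 * (C+1))^2 * sqnorm q := by
      unfold sqnorm
      rw [Finset.mul_sum]
      refine Finset.sum_congr rfl fun i _ => ?_
      simp only [Pi.smul_apply, smul_eq_mul]; field_simp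
    rw [e1] at h1
    rw [e2] at h2
    have e3 : C * (1 / (2 * (C+1))^2) ≤ 1 / (4 * (C+1)) := by
      have : C * (1 / (2 * (C+1))^2) = 1 / (4 * (C+1)) - 1 / (4 * (C+1)^2) := by
        field_simp; ring
      rw [this]
      have : 0 < 1 / (4 * (C+1)^2) := by positivity
      linarith
    have e4 : 1 / (2 * (C+1)) = 1 / (4 * (C+1)) + 1 / (4 * (C+1)) := by field_simp; norm_num
    have e5 := mul_le_mul_of_nonneg_right e3 (hs q)
    have : C ≤ max C (max (1 / (4 * c) + C) ((d + 4 * d * S.Cg) * (2 * (1 + B)))) := le_max_left _ _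
    have e6 : 1 / (2 * (C+1)) * sqnorm q = 1 / (4 * (C+1)) * sqnorm q + 1 / (4 * (C+1)) * sqnorm q := by
      rw [e4]; ring
    nlinarith
  · intro x q
    refine (S.Hstar_eq x q).2 ?_
    rintro _ ⟨p, rfl⟩
    have h1 := (hb x p).1
    have h3 := dotp_le_young (show 0 < 2 * c by positivity) q p
    have h4 : dotp q p - S.H x p ≤ (1 / (4 * c) + C) * (1 + sqnorm q) := by
      have : sqnorm q / (2 * (2 * c)) = 1 / (4 * c) * sqnorm q := by ring
      have h7 : 0 ≤ 1 / (4*c) := by positivity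
      nlinarith [mul_nonneg hC (hs q)]
    refine h4.trans ?_
    refine mul_le_mul_of_nonneg_right ((le_max_left _ _).trans (le_max_right _ _)) ?_
    linarith [hs q]
  · intro x h q k
    refine le_of_forall_pos_le_add fun ε0 hε0 => ?_
    obtain ⟨p, hp, hpb⟩ := hmax (x + h) (q + k) (min ε0 1) (by positivity) (min_le_right _ _)
    have hεle := min_le_left ε0 1
    have h1 := hlb x q p
    have h2 := (abs_le.1 (H_lip_x S (x + h) x p)).1
    have e1 : x + h - x = h := by abel
    rw [e1] at h2
    have e2 : dotp (q + k) p = dotp q p + dotp k p := by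
      unfold dotp; rw [← Finset.sum_add_distrib]
      exact Finset.sum_congr rfl fun i _ => by simp; ring
    rw [e2] at hp
    have h3 := (abs_le.1 (abs_dotp_le k p)).2
    have h4 := norm_le_one_add_sqnorm p
    have h5 := sqnorm_add_le q k
    set P := 1 + sqnorm p with hP
    have hPb : P ≤ 2 * (1 + B) * (1 + sqnorm q + sqnorm k) := by
      have := mul_le_mul_of_nonneg_left h5 hB0
      nlinarith [hs q, hs k, mul_nonneg hB0 (hs q), mul_nonneg hB0 (hs k)]
    have hd0 : (0:ℝ) ≤ d := Nat.cast_nonneg d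
    have h6 : dotp k p ≤ d * ‖k‖ * P := by
      refine h3.trans ?_
      rw [mul_assoc]
      gcongr
    have h7 : S.Hstar (x + h) (q + k) ≤ S.Hstar x q + ε0 + d * ‖k‖ * P + d * S.Cg * (2 * P) * ‖h‖ := by
      have : (2 + 2 * sqnorm p) = 2 * P := by rw [hP]; ring
      rw [this] at h2
      linarith
    have hP0 : 0 ≤ P := by have := hs p; linarith
    have h8 : d * ‖k‖ * P + d * S.Cg * (2 * P) * ‖h‖ ≤ (d + 4 * d * S.Cg) * (‖h‖ + ‖k‖) * P := by
      have a1 : 0 ≤ d * ‖h‖ * P := by positivity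
      have a2 : 0 ≤ d * S.Cg * ‖h‖ * P := by positivity
      have a3 : 0 ≤ d * S.Cg * ‖k‖ * P := by positivity
      nlinarith
    have h9 : (d + 4 * d * S.Cg) * (‖h‖ + ‖k‖) * P ≤
        (d + 4 * d * S.Cg) * (‖h‖ + ‖k‖) * (2 * (1 + B) * (1 + sqnorm q + sqnorm k)) := by
      gcongr
    have h10 : (d + 4 * d * S.Cg) * (2 * (1 + B)) * ((‖h‖ + ‖k‖) * (1 + sqnorm q + sqnorm k)) ≤
        max C (max (1 / (4 * c) + C) ((d + 4 * d * S.Cg) * (2 * (1 + B)))) *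
          ((‖h‖ + ‖k‖) * (1 + sqnorm q + sqnorm k)) := by
      refine mul_le_mul_of_nonneg_right ((le_max_right _ _).trans (le_max_right _ _)) ?_
      have := hs q; have := hs k
      positivity
    linarith

lemma Hstar_convex (x : Vd d) : ConvexOn ℝ Set.univ (S.Hstar x) := by
  refine ⟨convex_univ, fun q _ q' _ a b ha hb hab => ?_⟩
  refine (S.Hstar_eq x _).2 ?_
  rintro _ ⟨p, rfl⟩
  have h1 := (S.Hstar_eq x q).1 ⟨p, rfl⟩
  have h2 := (S.Hstar_eq x q').1 ⟨p, rfl⟩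
  simp only at h1 h2
  have e : dotp (a • q + b • q') p = a * dotp q p + b * dotp q' p := by
    unfold dotp; rw [Finset.mul_sum, Finset.mul_sum, ← Finset.sum_add_distrib]
    exact Finset.sum_congr rfl fun i _ => by simp; ring
  simp only [e, smul_eq_mul]
  have e2 : S.H x p = a * S.H x p + b * S.H x p := by rw [← add_mul, hab, one_mul]
  rw [e2]
  nlinarith [mul_le_mul_of_nonneg_left h1 ha, mul_le_mul_of_nonneg_left h2 hb]

lemma Hstar_per (x q : Vd d) (z : Fin d → ℤ) : S.Hstar (x + intVec z) q = S.Hstar x q := by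
  have h1 := S.Hstar_eq (x + intVec z) q
  simp_rw [S.H_per] at h1
  exact h1.unique (S.Hstar_eq x q)

lemma Hstar_continuous : Continuous (fun r : Vd d × Vd d => S.Hstar r.1 r.2) := by
  obtain ⟨c, C, hc, hC, _, _, h3⟩ := Hstar_bounds S
  rw [continuous_iff_continuousAt]
  rintro ⟨x, q⟩
  have hsq : Continuous (sqnorm (d := d)) := by unfold sqnorm; fun_prop
  -- upper and lower barriers
  have hu : ∀ r : Vd d × Vd d, S.Hstar r.1 r.2 ≤ S.Hstar x q +
      C * (‖r.1 - x‖ + ‖r.2 - q‖) * (1 + sqnorm q + sqnorm (r.2 - q)) := fun r => by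
    have := h3 x (r.1 - x) q (r.2 - q)
    simpa using this
  have hl : ∀ r : Vd d × Vd d, S.Hstar x q -
      C * (‖x - r.1‖ + ‖q - r.2‖) * (1 + sqnorm r.2 + sqnorm (q - r.2)) ≤ S.Hstar r.1 r.2 := fun r => by
    have := h3 r.1 (x - r.1) r.2 (q - r.2)
    simp only [add_sub_cancel] at this
    linarith
  have cu : Tendsto (fun r : Vd d × Vd d => S.Hstar x q +
      C * (‖r.1 - x‖ + ‖r.2 - q‖) * (1 + sqnorm q + sqnorm (r.2 - q))) (nhds (x, q))
      (nhds (S.Hstar x q)) := by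
    have : Continuous (fun r : Vd d × Vd d => S.Hstar x q +
      C * (‖r.1 - x‖ + ‖r.2 - q‖) * (1 + sqnorm q + sqnorm (r.2 - q))) := by fun_prop
    have := this.tendsto (x, q)
    simpa using this
  have cl : Tendsto (fun r : Vd d × Vd d => S.Hstar x q -
      C * (‖x - r.1‖ + ‖q - r.2‖) * (1 + sqnorm r.2 + sqnorm (q - r.2))) (nhds (x, q))
      (nhds (S.Hstar x q)) := by
    have : Continuous (fun r : Vd d × Vd d => S.Hstar x q -
      C * (‖x - r.1‖ + ‖q - r.2‖) * (1 + sqnorm r.2 + sqnorm (q - r.2))) := by fun_prop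
    have := this.tendsto (x, q)
    simpa using this
  exact tendsto_of_tendsto_of_tendsto_of_le_of_le cl cu hl hu

/-! F -/

def LF : ℝ := d * max S.CF 0

lemma LF_nonneg : 0 ≤ LF S := mul_nonneg (Nat.cast_nonneg d) (le_max_right _ _)

lemma Fd_lip (ρ : Measure (Td d)) (hρ : IsProbabilityMeasure ρ) (x y : Vd d) :
    |S.Fd ρ x - S.Fd ρ y| ≤ LF S * ‖x - y‖ := by
  refine lip_of_per (S.Fd_smooth ρ hρ) (fun x z => S.Fd_per ρ x z) (fun x v w => ?_) x y
  refine (S.Fd_D2_bound ρ hρ x v w).trans ?_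
  gcongr
  exact le_max_left _ _

lemma lineComb_prob (t : ℝ) (ht : t ∈ Set.Icc (0:ℝ) 1) (μ ν : PTd d) :
    IsProbabilityMeasure (lineComb t μ ν) := by
  constructor
  simp only [lineComb, Measure.add_apply, Measure.smul_apply, measure_univ, smul_eq_mul, mul_one]
  rw [← ENNReal.ofReal_add (by linarith [ht.2]) ht.1]
  simp

lemma Fc_diff (μ ν : PTd d) {B : ℝ}
    (h : ∀ ρ : Measure (Td d), IsProbabilityMeasure ρ →
      |(∫ y, S.Fd ρ (secT y) ∂(ν : Measure (Td d))) - ∫ y, S.Fd ρ (secT y) ∂(μ : Measure (Td d))|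
        ≤ B) : |S.Fc ν - S.Fc μ| ≤ B := by
  rw [S.flat_deriv]
  have := norm_setIntegral_le_of_norm_le_const (μ := volume) (s := Set.Icc (0:ℝ) 1)
    (f := fun t => ((∫ y, S.Fd (lineComb t μ ν) (secT y) ∂(ν : Measure (Td d))) -
        ∫ y, S.Fd (lineComb t μ ν) (secT y) ∂(μ : Measure (Td d)))) (C := B)
    (by simp) (fun t ht => h _ (lineComb_prob t ht μ ν))
  simpa using this

lemma Fc_W1 (μ ν : PTd d) : |S.Fc ν - S.Fc μ| ≤ LF S * W1 ν μ := by
  refine Fc_diff S μ ν fun ρ hρ => ?_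
  refine lip_W1 ν μ (LF_nonneg S) fun a b => ?_
  exact sec_lip (fun x z => S.Fd_per ρ x z) (LF_nonneg S) (Fd_lip S ρ hρ) a b

end PS

/-! ### Test functions -/

def gen {d : ℕ} (φ : ℝ → Vd d → ℝ) (s : ℝ) (x q : Vd d) : ℝ :=
  tderiv φ s x + 1 * lapl (φ s) x - dotp q (gradv (φ s) x)

section TestFun
variable {d : ℕ} {φ : ℝ → Vd d → ℝ}

lemma tf_slice_t (h : IsTestFun φ) (t : ℝ) (x : Vd d) :
    HasDerivAt (fun s => φ s x) (fderiv ℝ (fun q : ℝ × Vd d => φ q.1 q.2) (t, x) (1, 0)) t := by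
  have hd : HasFDerivAt (fun q : ℝ × Vd d => φ q.1 q.2) _ (t, x) :=
    (h.1.differentiable (by norm_num) _).hasFDerivAt
  have hl : HasDerivAt (fun s : ℝ => (s, x)) ((1:ℝ), (0 : Vd d)) t :=
    (hasDerivAt_id t).prodMk (hasDerivAt_const t x)
  exact hd.comp_hasDerivAt t hl

lemma tf_slice_x {Φ : ℝ × Vd d → ℝ} {n : WithTop ℕ∞} (h : ContDiff ℝ n Φ) (hn : n ≠ 0)
    (t : ℝ) (x v : Vd d) :
    fderiv ℝ (fun y => Φ (t, y)) x v = fderiv ℝ Φ (t, x) (0, v) := by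
  have hd : HasFDerivAt Φ _ (t, x) := (h.differentiable hn _).hasFDerivAt
  have hl : HasFDerivAt (fun y : Vd d => (t, y))
      ((0 : Vd d →L[ℝ] ℝ).prod (ContinuousLinearMap.id ℝ (Vd d))) x :=
    (hasFDerivAt_const _ _).prodMk (hasFDerivAt_id _)
  have := (hd.comp x hl).fderiv
  have e2 : (Φ ∘ fun y : Vd d => (t, y)) = fun y => Φ (t, y) := rfl
  rw [e2] at this
  rw [this]
  simp

lemma tf_fderiv_contDiff (h : IsTestFun φ) (w : ℝ × Vd d) :
    ContDiff ℝ 1 (fun q => fderiv ℝ (fun q : ℝ × Vd d => φ q.1 q.2) q w) :=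
  (h.1.fderiv_right (m := 1) (by norm_num)).clm_apply contDiff_const

lemma tf_cont (h : IsTestFun φ) : Continuous (fun q : ℝ × Vd d => φ q.1 q.2) := h.1.continuous

lemma tderiv_cont (h : IsTestFun φ) : Continuous (fun q : ℝ × Vd d => tderiv φ q.1 q.2) := by
  have : (fun q : ℝ × Vd d => tderiv φ q.1 q.2)
      = fun q => fderiv ℝ (fun q : ℝ × Vd d => φ q.1 q.2) q (1, 0) := by
    funext q
    exact (tf_slice_t h q.1 q.2).deriv
  rw [this]
  exact (tf_fderiv_contDiff h _).continuous

lemma fderivx_eq (h : IsTestFun φ) (t : ℝ) (x v : Vd d) :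
    fderiv ℝ (φ t) x v = fderiv ℝ (fun q : ℝ × Vd d => φ q.1 q.2) (t, x) (0, v) :=
  tf_slice_x h.1 (by norm_num) t x v

lemma D2_eq (h : IsTestFun φ) (t : ℝ) (x v w : Vd d) :
    D2 (φ t) x v w = fderiv ℝ (fun q => fderiv ℝ (fun q : ℝ × Vd d => φ q.1 q.2) q (0, v))
      (t, x) (0, w) := by
  unfold D2
  simp_rw [fderivx_eq h]
  exact tf_slice_x (tf_fderiv_contDiff h (0, v)) (by norm_num) t x w

lemma gradv_cont (h : IsTestFun φ) : Continuous (fun q : ℝ × Vd d => gradv (φ q.1) q.2) := by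
  refine continuous_pi fun i => ?_
  simp only [gradv, fderivx_eq h]
  exact (tf_fderiv_contDiff h _).continuous

lemma D2_cont (h : IsTestFun φ) (v w : Vd d) :
    Continuous (fun q : ℝ × Vd d => D2 (φ q.1) q.2 v w) := by
  simp only [D2_eq h]
  exact ((tf_fderiv_contDiff h (0, v)).continuous_fderiv (by norm_num)).clm_apply continuous_const

lemma lapl_cont (h : IsTestFun φ) : Continuous (fun q : ℝ × Vd d => lapl (φ q.1) q.2) :=
  continuous_finsetSum _ fun _ _ => D2_cont h _ _

lemma tderiv_per (h : IsTestFun φ) (t : ℝ) : IsPer (tderiv φ t) := by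
  intro x z
  unfold tderiv
  simp_rw [h.2]

lemma fderiv_per (h : IsTestFun φ) (t : ℝ) (x : Vd d) (z : Fin d → ℤ) :
    fderiv ℝ (φ t) (x + intVec z) = fderiv ℝ (φ t) x := by
  rw [← fderiv_comp_add_right]
  congr 1
  funext y
  exact h.2 t y z

lemma gradv_per (h : IsTestFun φ) (t : ℝ) (x : Vd d) (z : Fin d → ℤ) :
    gradv (φ t) (x + intVec z) = gradv (φ t) x := by
  funext i
  simp only [gradv, fderiv_per h]

lemma lapl_per (h : IsTestFun φ) (t : ℝ) : IsPer (lapl (φ t)) := by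
  intro x z
  unfold lapl D2
  refine Finset.sum_congr rfl fun i _ => ?_
  rw [← fderiv_comp_add_right]
  congr 2
  funext y
  rw [fderiv_per h]

lemma gen_cont (h : IsTestFun φ) :
    Continuous (fun r : ℝ × Vd d × Vd d => gen φ r.1 r.2.1 r.2.2) := by
  have c1 := (tderiv_cont h).comp (continuous_fst.prodMk (continuous_fst.comp continuous_snd) :
    Continuous (fun r : ℝ × Vd d × Vd d => (r.1, r.2.1)))
  have c2 := (lapl_cont h).comp (continuous_fst.prodMk (continuous_fst.comp continuous_snd) :
    Continuous (fun r : ℝ × Vd d × Vd d => (r.1, r.2.1)))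
  have c3 := (gradv_cont h).comp (continuous_fst.prodMk (continuous_fst.comp continuous_snd) :
    Continuous (fun r : ℝ × Vd d × Vd d => (r.1, r.2.1)))
  unfold gen dotp
  refine (c1.add (continuous_const.mul c2)).sub (continuous_finsetSum _ fun i _ => ?_)
  exact ((continuous_apply i).comp (continuous_snd.comp continuous_snd)).mul
    ((continuous_apply i).comp c3)

lemma gen_per (h : IsTestFun φ) (t : ℝ) (q : Vd d) : IsPer (fun x => gen φ t x q) := by
  intro x z
  simp only [gen, tderiv_per h t x z, lapl_per h t x z, gradv_per h t x z]

lemma bdd_of_per {g : ℝ × Vd d → ℝ} (hg : Continuous g)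
    (hp : ∀ t, IsPer (fun x => g (t, x))) (a b : ℝ) :
    ∃ C, 0 ≤ C ∧ ∀ t ∈ Set.Icc a b, ∀ x, |g (t, x)| ≤ C := by
  obtain ⟨C, hC⟩ := (isCompact_Icc.prod isCompact_Icc : IsCompact
    (Set.Icc a b ×ˢ Set.Icc (0 : Vd d) 1)).exists_bound_of_continuousOn hg.continuousOn
  refine ⟨max C 0, le_max_right _ _, fun t ht x => ?_⟩
  have := hC (t, secT (prT x)) (Set.mk_mem_prod ht (secT_mem (prT x)))
  have e := (hp t).sec x
  rw [e] at this
  exact this.trans (le_max_left _ _)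

lemma tf_bdd (h : IsTestFun φ) (a b : ℝ) :
    ∃ C, 0 ≤ C ∧ ∀ t ∈ Set.Icc a b, ∀ x, |φ t x| ≤ C :=
  bdd_of_per (tf_cont h) (fun t x z => h.2 t x z) a b

lemma gradv_bdd (h : IsTestFun φ) (a b : ℝ) :
    ∃ C, 0 ≤ C ∧ ∀ t ∈ Set.Icc a b, ∀ x, ‖gradv (φ t) x‖ ≤ C := by
  obtain ⟨C, h0, hC⟩ := bdd_of_per (g := fun q : ℝ × Vd d => ‖gradv (φ q.1) q.2‖)
    (gradv_cont h).norm
    (fun t x z => by simp only [gradv_per h]) a b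
  exact ⟨C, h0, fun t ht x => by simpa using hC t ht x⟩

lemma gen_bdd (h : IsTestFun φ) (a b : ℝ) :
    ∃ C, 0 ≤ C ∧ ∀ t ∈ Set.Icc a b, ∀ x q, |gen φ t x q| ≤ C * (1 + sqnorm q) := by
  obtain ⟨C1, h1, hC1⟩ := bdd_of_per (tderiv_cont h) (tderiv_per h) a b
  obtain ⟨C2, h2, hC2⟩ := bdd_of_per (lapl_cont h) (lapl_per h) a b
  obtain ⟨C3, h3, hC3⟩ := gradv_bdd h a b
  refine ⟨C1 + C2 + d * C3, by positivity, fun t ht x q => ?_⟩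
  have e1 := hC1 t ht x
  have e2 := hC2 t ht x
  have e3 := hC3 t ht x
  have e4 := abs_dotp_le q (gradv (φ t) x)
  have hs := sqnorm_nonneg q
  have e5 : (d:ℝ) * (‖q‖ * ‖gradv (φ t) x‖) ≤ d * ((1 + sqnorm q) * C3) := by
    have := norm_le_one_add_sqnorm q
    gcongr
  have e6 : |gen φ t x q| ≤ |tderiv φ t x| + |lapl (φ t) x| + |dotp q (gradv (φ t) x)| := by
    unfold gen
    rw [one_mul]
    refine (abs_sub _ _).trans ?_
    gcongr
    exact abs_add_le _ _
  simp only at e1 e2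
  nlinarith [mul_nonneg h1 hs, mul_nonneg h2 hs]

end TestFun

/-! ### Kernels from curves -/

open ProbabilityTheory in
lemma measurable_curve {d : ℕ} {m : ℝ → PTd d} {I : Set ℝ} (hm : W1ContOn m I) {p : ℝ → ℝ}
    (hp : Continuous p) (hI : ∀ s, p s ∈ I) :
    Measurable (fun s => (m (p s) : Measure (Td d))) := by
  have hlip : ∀ f : Td d → ℝ, ∀ L : NNReal, LipschitzWith L f →
      Continuous (fun s => ∫ y, f y ∂(m (p s) : Measure (Td d))) := by
    intro f L hf
    rw [Metric.continuous_iff]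
    intro t ε hε
    obtain ⟨η, hη, h⟩ := hm (p t) (hI t) (ε / (L + 1)) (by positivity)
    obtain ⟨η', hη', h'⟩ := Metric.continuous_iff.1 hp t η hη
    refine ⟨η', hη', fun s hs => ?_⟩
    have h1 := h (p s) (hI s) (by simpa [Real.dist_eq] using h' s hs)
    have h2 := lip_W1 (m (p s)) (m (p t)) (L := (L:ℝ)) L.2 (φ := f)
      (fun a b => by simpa [Real.dist_eq] using hf.dist_le_mul a b)
    rw [Real.dist_eq]
    have hL : (0:ℝ) < L + 1 := by positivity
    have h0 : 0 ≤ W1 (m (p s)) (m (p t)) := (abs_nonneg _).trans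
      (le_W1 _ _ (φ := fun _ => 0) ((LipschitzWith.const 0).weaken zero_le_one))
    rw [lt_div_iff₀ hL] at h1
    nlinarith
  refine Measurable.measure_of_isPiSystem_of_isProbabilityMeasure
    (borel_eq_generateFrom_isClosed (α := Td d) ▸ (BorelSpace.measurable_eq (α := Td d)))
    isPiSystem_isClosed ?_
  intro F hF
  have hpos : ∀ n : ℕ, (0:ℝ) < 1 / (n + 1) := fun n => by positivity
  refine measurable_of_tendsto_metrizable (f := fun (n : ℕ) s =>
    ∫⁻ y, (thickenedIndicator (hpos n) F y : ENNReal) ∂(m (p s) : Measure (Td d))) ?_ ?_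
  · intro n
    have : ∀ s, ∫⁻ y, (thickenedIndicator (hpos n) F y : ENNReal) ∂(m (p s) : Measure (Td d))
        = ENNReal.ofReal (∫ y, (thickenedIndicator (hpos n) F y : ℝ) ∂(m (p s) : Measure (Td d))) := by
      intro s
      rw [ofReal_integral_eq_lintegral_ofReal]
      · simp
      · refine integrable_of_bdd (M := 1) ?_ ?_
        · exact (NNReal.continuous_coe.comp (thickenedIndicator (hpos n) F).continuous).measurable
        · intro y
          have := thickenedIndicator_le_one (hpos n) F y
          rw [abs_of_nonneg (NNReal.coe_nonneg _)]
          exact_mod_cast this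
      · exact Eventually.of_forall fun y => NNReal.coe_nonneg _
    simp_rw [this]
    refine ENNReal.measurable_ofReal.comp (Continuous.measurable ?_)
    refine hlip _ ((Real.toNNReal (1 / (n+1)))⁻¹) ?_
    have := lipschitzWith_thickenedIndicator (hpos n) F
    refine LipschitzWith.of_dist_le_mul fun a b => ?_
    have h2 := this.dist_le_mul a b
    rw [NNReal.dist_eq] at h2
    rw [Real.dist_eq]
    exact h2
  · rw [tendsto_pi_nhds]
    intro s
    exact tendsto_lintegral_thickenedIndicator_of_isClosed _ hF hpos
      tendsto_one_div_add_atTop_nhds_zero_nat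

/-! ### Relaxed curves -/

open ProbabilityTheory in
lemma kint {d : ℕ} {Ω β : Type*} [MeasurableSpace Ω] [MeasurableSpace β] (ν : Measure β) [IsFiniteMeasure ν]
    (K : Kernel β Ω) [IsMarkovKernel K] {A : β × Ω → Vd d} (hA : Measurable A)
    (hE : ∫⁻ s, ∫⁻ ω, ENNReal.ofReal (sqnorm (A (s, ω))) ∂(K s) ∂ν < ⊤)
    {f : β × Ω → ℝ} (hf : Measurable f) {C : ℝ}
    (hb : ∀ᵐ s ∂ν, ∀ ω, |f (s, ω)| ≤ C * (1 + sqnorm (A (s, ω)))) :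
    (∀ᵐ s ∂ν, Integrable (fun ω => f (s, ω)) (K s)) ∧
      Integrable (fun s => ∫ ω, f (s, ω) ∂(K s)) ν := by
  have hms : Measurable (fun p => sqnorm (A p)) := by
    unfold sqnorm
    fun_prop
  have hint : Integrable f (ν ⊗ₘ K) := by
    have h1 : Integrable (fun p => sqnorm (A p)) (ν ⊗ₘ K) := by
      refine ⟨hms.aestronglyMeasurable, ?_⟩
      rw [hasFiniteIntegral_iff_ofReal (Eventually.of_forall fun p => sqnorm_nonneg _),
        Measure.lintegral_compProd hms.ennreal_ofReal]
      exact hE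
    refine Integrable.mono' (((integrable_const (1:ℝ)).add h1).const_mul C)
      hf.aestronglyMeasurable ?_
    have hset : MeasurableSet {p : β × Ω | |f p| ≤ C * (1 + sqnorm (A p))} :=
      measurableSet_le hf.abs (by fun_prop)
    have := (Measure.ae_compProd_iff (κ := K) (μ := ν) hset).2
      (hb.mono fun s hs => Eventually.of_forall fun ω => hs ω)
    simpa using this
  refine ⟨((Measure.integrable_compProd_iff hf.aestronglyMeasurable).1 hint).1, ?_⟩
  refine Integrable.mono' ((Measure.integrable_compProd_iff hf.aestronglyMeasurable).1 hint).2
    (hf.stronglyMeasurable.integral_kernel_prod_right').aestronglyMeasurable ?_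
  exact Eventually.of_forall fun s => norm_integral_le_integral_norm _

lemma sqnorm_meas {d : ℕ} : Measurable (sqnorm : Vd d → ℝ) := by
  unfold sqnorm
  fun_prop

lemma sqnorm_cont {d : ℕ} : Continuous (sqnorm : Vd d → ℝ) := by
  unfold sqnorm
  fun_prop

lemma sqnorm_convex {d : ℕ} : ConvexOn ℝ univ (sqnorm : Vd d → ℝ) := by
  refine ⟨convex_univ, fun x _ y _ a b ha hb hab => ?_⟩
  simp only [sqnorm, smul_eq_mul, Finset.mul_sum, Pi.add_apply, Pi.smul_apply]
  rw [← Finset.sum_add_distrib]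
  refine Finset.sum_le_sum fun i _ => ?_
  have : b = 1 - a := by linarith
  subst this
  nlinarith [mul_nonneg (mul_nonneg ha hb) (sq_nonneg (x i - y i))]

open ProbabilityTheory in
lemma jensen_ker {d : ℕ} {μ : Measure (Td d)} [IsProbabilityMeasure μ] (κ : Kernel (Td d) (Vd d))
    [IsMarkovKernel κ] (hq : Integrable (fun p : Td d × Vd d => sqnorm p.2) (μ ⊗ₘ κ))
    {g : Td d × Vd d → ℝ} (hg : Measurable g) (hgc : ∀ y, Continuous fun q => g (y, q))
    (hconv : ∀ y, ConvexOn ℝ univ fun q => g (y, q)) {C : ℝ} (hC : 0 ≤ C)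
    (hb : ∀ y q, |g (y, q)| ≤ C * (1 + sqnorm q)) :
    (∀ᵐ y ∂μ, g (y, ∫ q, q ∂(κ y)) ≤ ∫ q, g (y, q) ∂(κ y)) ∧
    Integrable (fun y => ∫ q, g (y, q) ∂(κ y)) μ ∧
    (∫ y, (∫ q, g (y, q) ∂(κ y)) ∂μ = ∫ p, g p ∂(μ ⊗ₘ κ)) := by
  have hgi : Integrable g (μ ⊗ₘ κ) := by
    refine Integrable.mono' (((integrable_const (1:ℝ)).add hq).const_mul C)
      hg.aestronglyMeasurable (Eventually.of_forall fun p => hb p.1 p.2)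
  refine ⟨?_, ?_, (Measure.integral_compProd hgi).symm⟩
  · have h1 := ((Measure.integrable_compProd_iff hq.1).1 hq).1
    have h2 := ((Measure.integrable_compProd_iff hgi.1).1 hgi).1
    filter_upwards [h1, h2] with y hy1 hy2
    have hid : Integrable (fun q : Vd d => q) (κ y) := by
      refine Integrable.mono' ((integrable_const (1:ℝ)).add hy1)
        measurable_id.aestronglyMeasurable (Eventually.of_forall fun q => ?_)
      exact norm_le_one_add_sqnorm q
    exact (hconv y).map_integral_le (hgc y).continuousOn isClosed_univ (by simp) hid hy2
  · refine Integrable.mono' ((Measure.integrable_compProd_iff hgi.1).1 hgi).2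
      (hg.stronglyMeasurable.integral_kernel_prod_right').aestronglyMeasurable ?_
    exact Eventually.of_forall fun s => norm_integral_le_integral_norm _

open ProbabilityTheory in
lemma jensen_ker' {d : ℕ} {μ : Measure (Td d)} [IsProbabilityMeasure μ] (κ : Kernel (Td d) (Vd d))
    [IsMarkovKernel κ] (hq : Integrable (fun p : Td d × Vd d => sqnorm p.2) (μ ⊗ₘ κ))
    {g : Td d × Vd d → ℝ} (hg : Measurable g) (hgc : ∀ y, Continuous fun q => g (y, q))
    (hconv : ∀ y, ConvexOn ℝ univ fun q => g (y, q)) {C : ℝ} (hC : 0 ≤ C)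
    (hb : ∀ y q, |g (y, q)| ≤ C * (1 + sqnorm q)) :
    Integrable (fun y => g (y, ∫ q, q ∂(κ y))) μ ∧
    (∫ y, g (y, ∫ q, q ∂(κ y)) ∂μ ≤ ∫ p, g p ∂(μ ⊗ₘ κ)) := by
  have ham : Measurable (fun y => ∫ q, q ∂(κ y)) :=
    (StronglyMeasurable.integral_kernel (κ := κ) (f := fun q : Vd d => q)
      measurable_id.stronglyMeasurable).measurable
  obtain ⟨s1, s2, s3⟩ := jensen_ker κ hq (g := fun p => sqnorm p.2) (sqnorm_meas.comp measurable_snd)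
    (fun y => sqnorm_cont) (fun y => sqnorm_convex) (C := 1) zero_le_one
    (fun y q => by rw [abs_of_nonneg (sqnorm_nonneg _)]; linarith)
  obtain ⟨g1, g2, g3⟩ := jensen_ker κ hq hg hgc hconv hC hb
  have hi : Integrable (fun y => g (y, ∫ q, q ∂(κ y))) μ := by
    refine Integrable.mono' (((integrable_const (1:ℝ)).add s2).const_mul C)
      (hg.comp (measurable_id.prodMk ham)).aestronglyMeasurable ?_
    filter_upwards [s1] with y hy
    refine (hb y _).trans ?_
    simp only [Pi.add_apply]
    gcongr
  refine ⟨hi, ?_⟩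
  rw [← g3]
  exact integral_mono_ae hi g2 g1

lemma Fc_contOn {d : ℕ} (S : MFGSetting d) {m : ℝ → PTd d} {I : Set ℝ} (hm : W1ContOn m I) :
    ContinuousOn (fun s => S.Fc (m s)) I := by
  rw [Metric.continuousOn_iff]
  intro t ht ε hε
  have hL := LF_nonneg S
  obtain ⟨η, hη, h⟩ := hm t ht (ε / (LF S + 1)) (by positivity)
  refine ⟨η, hη, fun s hs hst => ?_⟩
  have h1 := h s hs (by simpa [Real.dist_eq] using hst)
  have h2 := Fc_W1 S (m t) (m s)
  rw [Real.dist_eq]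
  have h0 : 0 ≤ W1 (m s) (m t) := (abs_nonneg _).trans
    (le_W1 _ _ (φ := fun _ => 0) ((LipschitzWith.const 0).weaken zero_le_one))
  rw [lt_div_iff₀ (by positivity)] at h1
  nlinarith

lemma Hstar_abs {d : ℕ} (S : MFGSetting d) : ∃ C, 0 ≤ C ∧ ∀ x q, |S.Hstar x q| ≤ C * (1 + sqnorm q) := by
  obtain ⟨c, C, hc, hC, h1, h2, -⟩ := Hstar_bounds S
  refine ⟨C, hC, fun x q => abs_le.2 ⟨?_, h2 x q⟩⟩
  have := h1 x q
  nlinarith [mul_nonneg hc.le (sqnorm_nonneg q), mul_nonneg hC (sqnorm_nonneg q)]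

lemma Hstar_sec_meas {d : ℕ} (S : MFGSetting d) :
    Measurable (fun p : Td d × Vd d => S.Hstar (secT p.1) p.2) :=
  (Hstar_continuous S).measurable.comp
    ((measurable_secT.comp measurable_fst).prodMk measurable_snd)

lemma gen_affine {d : ℕ} (φ : ℝ → Vd d → ℝ) (s : ℝ) (x : Vd d) :
    ConvexOn ℝ univ (fun q => gen φ s x q) ∧ ConvexOn ℝ univ (fun q => -gen φ s x q) := by
  have key : ∀ (q r : Vd d) (a b : ℝ), a + b = 1 →
      gen φ s x (a • q + b • r) = a * gen φ s x q + b * gen φ s x r := by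
    intro q r a b hab
    have : dotp (a • q + b • r) (gradv (φ s) x) =
        a * dotp q (gradv (φ s) x) + b * dotp r (gradv (φ s) x) := by
      simp only [dotp, Finset.mul_sum, ← Finset.sum_add_distrib, Pi.add_apply, Pi.smul_apply,
        smul_eq_mul]
      exact Finset.sum_congr rfl fun i _ => by ring
    unfold gen
    rw [this]
    have : b = 1 - a := by linarith
    subst this
    ring
  refine ⟨⟨convex_univ, fun q _ r _ a b _ _ hab => ?_⟩, ⟨convex_univ, fun q _ r _ a b _ _ hab => ?_⟩⟩
  · simp only [key q r a b hab, smul_eq_mul]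
    exact le_refl _
  · simp only [key q r a b hab, smul_eq_mul]
    apply le_of_eq
    ring

open ProbabilityTheory in
structure RelPiece {d : ℕ} {Ω : Type*} [MeasurableSpace Ω] (T : ℝ) (K : Kernel ℝ Ω)
    (Y : ℝ × Ω → Td d) (A : ℝ × Ω → Vd d) (mY : ℝ → PTd d) : Prop where
  measY : Measurable Y
  measA : Measurable A
  law : ∀ t, (mY t : Measure (Td d)) = (K t).map (fun ω => Y (t, ω))
  cont : W1ContOn mY (Set.Icc 0 T)
  fp : ∀ φ, IsTestFun φ → ∀ s₁ s₂ : ℝ, 0 ≤ s₁ → s₁ ≤ s₂ → s₂ ≤ T →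
    (∫ ω, φ s₂ (secT (Y (s₂, ω))) ∂(K s₂)) - (∫ ω, φ s₁ (secT (Y (s₁, ω))) ∂(K s₁)) =
      ∫ s in s₁..s₂, ∫ ω, gen φ s (secT (Y (s, ω))) (A (s, ω)) ∂(K s)
  energy : ∫⁻ s in Set.Ioc 0 T, ∫⁻ ω, ENNReal.ofReal (sqnorm (A (s, ω))) ∂(K s) < ⊤

open ProbabilityTheory in
lemma RelPiece.adm {d : ℕ} (S : MFGSetting d) {Ω : Type*} [MeasurableSpace Ω] {T : ℝ} (hT : 0 ≤ T)
    {K : Kernel ℝ Ω} [IsMarkovKernel K]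
    {Y : ℝ × Ω → Td d} {A : ℝ × Ω → Vd d} {mY : ℝ → PTd d} (h : RelPiece T K Y A mY) :
    ∃ α, AdmOn S 1 (mY 0) T mY α ∧ ∀ᵐ s ∂(volume.restrict (Set.Ioc 0 T)),
      runCost S mY α s ≤ (∫ ω, S.Hstar (secT (Y (s, ω))) (A (s, ω)) ∂(K s)) + S.Fc (mY s) := by
  have hsn : Measurable (fun p : Td d × Vd d => sqnorm p.2) := sqnorm_meas.comp measurable_snd
  have hYs : ∀ s, Measurable (fun ω => Y (s, ω)) := fun s => h.measY.comp measurable_prodMk_left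
  have hYA : Measurable (fun p : ℝ × Ω => (Y p, A p)) := h.measY.prodMk h.measA
  set κ : Kernel ℝ (Td d × Vd d) := (Kernel.id ×ₖ K).map (fun p => (Y p, A p)) with hκ
  have hYAs : ∀ s, Measurable (fun ω => (Y (s, ω), A (s, ω))) := fun s =>
    hYA.comp measurable_prodMk_left
  have hκs : ∀ s, κ s = (K s).map (fun ω => (Y (s, ω), A (s, ω))) := by
    intro s
    rw [hκ, Kernel.map_apply _ hYA, Kernel.prod_apply, Kernel.id_apply, Measure.dirac_prod,
      Measure.map_map hYA measurable_prodMk_left]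
    rfl
  have : IsMarkovKernel κ := Kernel.IsMarkovKernel.map _ hYA
  have hfst : ∀ s, κ.fst s = (mY s : Measure (Td d)) := by
    intro s
    rw [Kernel.fst_apply, hκs, Measure.map_map measurable_fst (hYAs s), h.law]
    rfl
  set c : ℝ → Kernel (Td d) (Vd d) := fun s => κ.condKernel.sectR s with hc
  have hdis : ∀ s, κ s = (mY s : Measure (Td d)) ⊗ₘ c s := by
    intro s
    rw [← hfst s, ← Kernel.compProd_apply_eq_compProd_sectR, Kernel.disintegrate]
  set α : ℝ → Td d → Vd d := fun s y => ∫ q, q ∂(c s y) with hα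
  have hαm : Measurable (fun q : ℝ × Td d => α q.1 q.2) := by
    have := (StronglyMeasurable.integral_kernel (κ := κ.condKernel) (f := fun q : Vd d => q)
      measurable_id.stronglyMeasurable).measurable
    exact this
  -- a.e. square integrability
  set ν := (volume : Measure ℝ).restrict (Set.Ioc 0 T) with hν
  have hsq : ∀ᵐ s ∂ν, Integrable (fun p : Td d × Vd d => sqnorm p.2)
      ((mY s : Measure (Td d)) ⊗ₘ c s) := by
    have h1 := (kint ν K h.measA h.energy (f := fun p => sqnorm (A p))
      (sqnorm_meas.comp h.measA) (C := 1) (Eventually.of_forall fun s ω => by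
        rw [abs_of_nonneg (sqnorm_nonneg _)]; linarith)).1
    filter_upwards [h1] with s hs
    rw [← hdis s, hκs, integrable_map_measure
      hsn.aestronglyMeasurable (hYAs s).aemeasurable]
    exact hs
  have htrans : ∀ s (g : Td d × Vd d → ℝ), Measurable g →
      ∫ p, g p ∂((mY s : Measure (Td d)) ⊗ₘ c s) = ∫ ω, g (Y (s, ω), A (s, ω)) ∂(K s) := by
    intro s g hg
    rw [← hdis s, hκs, integral_map (hYAs s).aemeasurable hg.aestronglyMeasurable]
  have hsqY : ∀ᵐ s ∂ν, ∫⁻ y, ENNReal.ofReal (sqnorm (α s y)) ∂(mY s : Measure (Td d)) ≤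
      ∫⁻ ω, ENNReal.ofReal (sqnorm (A (s, ω))) ∂(K s) := by
    filter_upwards [hsq] with s hs
    obtain ⟨i1, i2⟩ := jensen_ker' (c s) hs (g := fun p => sqnorm p.2)
      hsn
      (fun y => sqnorm_cont) (fun y => sqnorm_convex) (C := 1) zero_le_one
      (fun y q => by rw [abs_of_nonneg (sqnorm_nonneg _)]; linarith)
    have i3 : Integrable (fun ω => sqnorm (A (s, ω))) (K s) := by
      rw [← hdis s, hκs, integrable_map_measure
        hsn.aestronglyMeasurable (hYAs s).aemeasurable] at hs
      exact hs
    rw [htrans s _ hsn] at i2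
    rw [← ofReal_integral_eq_lintegral_ofReal i1 (Eventually.of_forall fun y => sqnorm_nonneg _),
      ← ofReal_integral_eq_lintegral_ofReal i3 (Eventually.of_forall fun y => sqnorm_nonneg _)]
    exact ENNReal.ofReal_le_ofReal i2
  have hEα : ∫⁻ s in Set.Ioc 0 T, ∫⁻ y, ENNReal.ofReal (sqnorm (α s y)) ∂(mY s : Measure (Td d)) < ⊤ :=
    (lintegral_mono_ae hsqY).trans_lt h.energy
  obtain ⟨CH, hCH0, hCH⟩ := Hstar_abs S
  refine ⟨α, ⟨rfl, h.cont, ?_, hαm, hEα, ?_⟩, ?_⟩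
  · intro s₁ s₂ h1 h2 h3 φ hφ
    have hp : ∀ t, ∫ y, φ t (secT y) ∂(mY t : Measure (Td d)) = ∫ ω, φ t (secT (Y (t, ω))) ∂(K t) := by
      intro t
      have hφm : Measurable (fun y : Td d => φ t (secT y)) :=
        (tf_cont hφ).measurable.comp (measurable_const.prodMk measurable_secT)
      rw [h.law, integral_map (hYs t).aemeasurable
        hφm.aestronglyMeasurable]
    rw [hp, hp, h.fp φ hφ s₁ s₂ h1 h2 h3]
    rw [intervalIntegral.integral_of_le h2, intervalIntegral.integral_of_le h2]
    refine integral_congr_ae ?_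
    obtain ⟨C, hC0, hC⟩ := gen_bdd hφ 0 T
    have hsub : Set.Ioc s₁ s₂ ⊆ Set.Ioc 0 T := Set.Ioc_subset_Ioc h1 h3
    filter_upwards [ae_restrict_of_ae_restrict_of_subset hsub hsq,
      ae_restrict_mem measurableSet_Ioc] with s hs hsm
    have hsI : s ∈ Set.Icc 0 T := Set.Ioc_subset_Icc_self (hsub hsm)
    have hgm : Measurable (fun p : Td d × Vd d => gen φ s (secT p.1) p.2) :=
      (gen_cont hφ).measurable.comp (measurable_const.prodMk
        ((measurable_secT.comp measurable_fst).prodMk measurable_snd))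
    have hgc : ∀ y : Td d, Continuous (fun q => gen φ s (secT y) q) := fun y =>
      (gen_cont hφ).comp (continuous_const.prodMk (continuous_const.prodMk continuous_id))
    have a1 := (jensen_ker' (c s) hs hgm hgc (fun y => (gen_affine φ s (secT y)).1) hC0
      (fun y q => hC s hsI _ q)).2
    have a2 := (jensen_ker' (c s) hs (g := fun p => - gen φ s (secT p.1) p.2) hgm.neg
      (fun y => (hgc y).neg) (fun y => (gen_affine φ s (secT y)).2) hC0
      (fun y q => by rw [abs_neg]; exact hC s hsI _ q)).2
    rw [htrans s _ hgm] at a1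
    rw [integral_neg, integral_neg, htrans s _ hgm] at a2
    exact le_antisymm (neg_le_neg_iff.1 a2) a1
  · rw [intervalIntegrable_iff_integrableOn_Ioc_of_le hT]
    refine Integrable.add ?_ ?_
    · have := (kint ν κ.fst hαm (by simpa only [hfst] using hEα)
        (f := fun p => S.Hstar (secT p.2) (α p.1 p.2))
        ((Hstar_sec_meas S).comp (measurable_snd.prodMk hαm)) (C := CH)
        (Eventually.of_forall fun s y => hCH _ _)).2
      simpa only [hfst] using this
    · exact ((Fc_contOn S h.cont).integrableOn_Icc).mono_set Set.Ioc_subset_Icc_self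
  · filter_upwards [hsq] with s hs
    have := (jensen_ker' (c s) hs (Hstar_sec_meas S)
      (fun y => (Hstar_continuous S).comp (f := fun q => (secT y, q)) (continuous_const.prodMk continuous_id))
      (fun y => Hstar_convex S (secT y)) hCH0 (fun y q => hCH _ q)).2
    rw [htrans s _ (Hstar_sec_meas S)] at this
    unfold runCost
    linarith

/-! ### Concatenation and shifts -/

open ProbabilityTheory in
lemma adm_int {d : ℕ} {m : ℝ → PTd d} {T : ℝ} (hT : 0 ≤ T) (hm : W1ContOn m (Set.Icc 0 T))
    {α : ℝ → Td d → Vd d} (hα : Measurable (fun q : ℝ × Td d => α q.1 q.2))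
    (hE : (∫⁻ s in Set.Ioc (0:ℝ) T,
      ∫⁻ y, ENNReal.ofReal (sqnorm (α s y)) ∂(m s : Measure (Td d))) < ⊤)
    {f : ℝ × Td d → ℝ} (hf : Measurable f) {C : ℝ}
    (hb : ∀ s ∈ Set.Ioc 0 T, ∀ y, |f (s, y)| ≤ C * (1 + sqnorm (α s y))) :
    (∀ᵐ s ∂(volume.restrict (Set.Ioc 0 T)), Integrable (fun y => f (s, y)) (m s : Measure (Td d))) ∧
      IntegrableOn (fun s => ∫ y, f (s, y) ∂(m s : Measure (Td d))) (Set.Ioc 0 T) := by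
  have hpc : Continuous (fun s : ℝ => max 0 (min s T)) := by fun_prop
  have hpI : ∀ s : ℝ, max 0 (min s T) ∈ Set.Icc 0 T := fun s =>
    ⟨le_max_left _ _, max_le hT (min_le_right _ _)⟩
  have hmm := measurable_curve hm hpc hpI
  set K : Kernel ℝ (Td d) := ⟨fun s => (m (max 0 (min s T)) : Measure (Td d)), hmm⟩ with hK
  have : IsMarkovKernel K := ⟨fun s => by
    change IsProbabilityMeasure (m (max 0 (min s T)) : Measure (Td d)); infer_instance⟩
  have hKs : ∀ s ∈ Set.Ioc 0 T, K s = (m s : Measure (Td d)) := by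
    intro s hs
    change (m (max 0 (min s T)) : Measure (Td d)) = _
    rw [min_eq_left hs.2, max_eq_right hs.1.le]
  have hE' : ∫⁻ s in Set.Ioc (0:ℝ) T, ∫⁻ y, ENNReal.ofReal (sqnorm (α s y)) ∂(K s) < ⊤ := by
    refine lt_of_eq_of_lt ?_ hE
    refine setLIntegral_congr_fun measurableSet_Ioc fun s hs => ?_
    simp only [hKs s hs]
  obtain ⟨h1, h2⟩ := kint (volume.restrict (Set.Ioc 0 T)) K hα hE' hf (C := C)
    ((ae_restrict_mem measurableSet_Ioc).mono fun s hs => hb s hs)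
  refine ⟨?_, ?_⟩
  · filter_upwards [h1, ae_restrict_mem measurableSet_Ioc] with s hs hsm
    rwa [hKs s hsm] at hs
  · refine IntegrableOn.congr_fun h2 (fun s hs => ?_) measurableSet_Ioc
    simp only [hKs s hs]

lemma disc_energy {d : ℕ} {m : ℝ → PTd d} {α : ℝ → Td d → Vd d} {δ : ℝ} (hδ : 0 < δ) (T : ℝ)
    (hE : (∫⁻ s in Set.Ioi (0:ℝ), ENNReal.ofReal (Real.exp (-δ * s)) *
      ∫⁻ y, ENNReal.ofReal (sqnorm (α s y)) ∂(m s : Measure (Td d))) < ⊤) :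
    (∫⁻ s in Set.Ioc (0:ℝ) T,
      ∫⁻ y, ENNReal.ofReal (sqnorm (α s y)) ∂(m s : Measure (Td d))) < ⊤ := by
  have h1 : ENNReal.ofReal (Real.exp (-δ * T)) * (∫⁻ s in Set.Ioc (0:ℝ) T,
      ∫⁻ y, ENNReal.ofReal (sqnorm (α s y)) ∂(m s : Measure (Td d))) < ⊤ := by
    refine lt_of_le_of_lt ?_ hE
    rw [← lintegral_const_mul' _ _ ENNReal.ofReal_ne_top]
    refine (setLIntegral_mono' measurableSet_Ioc fun s hs => ?_).trans
      (lintegral_mono_set Set.Ioc_subset_Ioi_self)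
    refine mul_le_mul' (ENNReal.ofReal_le_ofReal (Real.exp_le_exp.2 ?_)) le_rfl
    nlinarith [hs.2]
  by_contra h
  rw [not_lt, top_le_iff] at h
  rw [h, ENNReal.mul_top (by simp [Real.exp_pos])] at h1
  exact lt_irrefl _ h1

lemma W1ContOn.mono {d : ℕ} {m : ℝ → PTd d} {I J : Set ℝ} (h : W1ContOn m J) (hI : I ⊆ J) :
    W1ContOn m I := fun t ht ε hε => by
  obtain ⟨η, hη, h'⟩ := h t (hI ht) ε hε
  exact ⟨η, hη, fun s hs => h' s (hI hs)⟩

lemma shift_mp (T : ℝ) : MeasurePreserving (fun s : ℝ => s + T) (volume.restrict (Set.Ioi 0))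
    (volume.restrict (Set.Ioi T)) := by
  have := (measurePreserving_add_right (volume : Measure ℝ) T).restrict_preimage_emb
    (measurableEmbedding_addRight T) (Set.Ioi T)
  simpa using this

lemma gen_int {d : ℕ} {m : ℝ → PTd d} {T : ℝ} (hT : 0 ≤ T) (hm : W1ContOn m (Set.Icc 0 T))
    {α : ℝ → Td d → Vd d} (hα : Measurable (fun q : ℝ × Td d => α q.1 q.2))
    (hE : (∫⁻ s in Set.Ioc (0:ℝ) T,
      ∫⁻ y, ENNReal.ofReal (sqnorm (α s y)) ∂(m s : Measure (Td d))) < ⊤)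
    {φ : ℝ → Vd d → ℝ} (hφ : IsTestFun φ) :
    (∀ᵐ s ∂(volume.restrict (Set.Ioc 0 T)),
      Integrable (fun y => gen φ s (secT y) (α s y)) (m s : Measure (Td d))) ∧
    IntegrableOn (fun s => ∫ y, gen φ s (secT y) (α s y) ∂(m s : Measure (Td d))) (Set.Ioc 0 T) := by
  obtain ⟨C, hC0, hC⟩ := gen_bdd hφ 0 T
  exact adm_int hT hm hα hE (f := fun p => gen φ p.1 (secT p.2) (α p.1 p.2))
    ((gen_cont hφ).measurable.comp (measurable_fst.prodMk
      ((measurable_secT.comp measurable_snd).prodMk hα)))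
    (fun s hs y => hC s (Set.Ioc_subset_Icc_self hs) _ _)

lemma run_int {d : ℕ} (S : MFGSetting d) {m : ℝ → PTd d} {T : ℝ} (hT : 0 ≤ T)
    (hm : W1ContOn m (Set.Icc 0 T))
    {α : ℝ → Td d → Vd d} (hα : Measurable (fun q : ℝ × Td d => α q.1 q.2))
    (hE : (∫⁻ s in Set.Ioc (0:ℝ) T,
      ∫⁻ y, ENNReal.ofReal (sqnorm (α s y)) ∂(m s : Measure (Td d))) < ⊤) :
    IntegrableOn (runCost S m α) (Set.Ioc 0 T) := by
  obtain ⟨CH, hCH0, hCH⟩ := Hstar_abs S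
  refine Integrable.add ?_ ?_
  · exact (adm_int hT hm hα hE (f := fun p => S.Hstar (secT p.2) (α p.1 p.2))
        ((Hstar_sec_meas S).comp (measurable_snd.prodMk hα)) (C := CH)
        (fun s _ y => hCH _ _)).2
  · exact ((Fc_contOn S hm).integrableOn_Icc).mono_set Set.Ioc_subset_Icc_self

lemma tf_shift {d : ℕ} {φ : ℝ → Vd d → ℝ} (hφ : IsTestFun φ) (T : ℝ) :
    IsTestFun (fun s => φ (s + T)) := by
  refine ⟨?_, fun t x z => hφ.2 _ x z⟩
  exact hφ.1.comp ((contDiff_fst.add contDiff_const).prodMk contDiff_snd)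

lemma gen_shift {d : ℕ} (φ : ℝ → Vd d → ℝ) (T s : ℝ) (x q : Vd d) :
    gen (fun s => φ (s + T)) s x q = gen φ (s + T) x q := by
  unfold gen tderiv
  rw [deriv_comp_add_const (f := fun s => φ s x)]

lemma FPeq_gen {d : ℕ} {m : ℝ → PTd d} {α : ℝ → Td d → Vd d} {s₁ s₂ : ℝ} :
    FPeq 1 m α s₁ s₂ ↔ ∀ φ : ℝ → Vd d → ℝ, IsTestFun φ →
    (∫ y, φ s₂ (secT y) ∂(m s₂ : Measure (Td d))) -
      (∫ y, φ s₁ (secT y) ∂(m s₁ : Measure (Td d))) =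
    ∫ s in s₁..s₂, ∫ y, gen φ s (secT y) (α s y) ∂(m s : Measure (Td d)) := Iff.rfl

/-- FP for a shifted curve. -/
lemma FPeq_shift {d : ℕ} {m : ℝ → PTd d} {α : ℝ → Td d → Vd d} {s₁ s₂ : ℝ} (T : ℝ)
    (h : FPeq 1 m α s₁ s₂) :
    FPeq 1 (fun s => m (s + T)) (fun s => α (s + T)) (s₁ - T) (s₂ - T) := by
  rw [FPeq_gen] at *
  intro φ hφ
  have h1 := h (fun s => φ (s + -T)) (tf_shift hφ (-T))
  simp only [gen_shift] at h1
  simp only [sub_add_cancel, ← sub_eq_add_neg] at *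
  rw [h1]
  have := intervalIntegral.integral_comp_sub_right (a := s₁) (b := s₂)
    (fun s => ∫ y, gen φ s (secT y) (α (s + T) y) ∂(m (s + T) : Measure (Td d))) T
  simp only [sub_add_cancel] at this
  exact this

lemma FPeq_congr {d : ℕ} {m m' : ℝ → PTd d} {α α' : ℝ → Td d → Vd d} {s₁ s₂ : ℝ} (h12 : s₁ ≤ s₂)
    (h : FPeq 1 m α s₁ s₂) (hm : ∀ s ∈ Set.Icc s₁ s₂, m s = m' s)
    (hα : ∀ s ∈ Set.Ioc s₁ s₂, α s = α' s) : FPeq 1 m' α' s₁ s₂ := by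
  rw [FPeq_gen] at *
  intro φ hφ
  rw [← hm _ (Set.left_mem_Icc.2 h12), ← hm _ (Set.right_mem_Icc.2 h12), h φ hφ,
    intervalIntegral.integral_of_le h12, intervalIntegral.integral_of_le h12]
  refine setIntegral_congr_fun measurableSet_Ioc fun s hs => ?_
  simp only [hα s hs, hm s (Set.Ioc_subset_Icc_self hs)]

lemma AdmDisc.admOn {d : ℕ} {S : MFGSetting d} {δ : ℝ} (hδ : 0 < δ) {μ : PTd d} {m : ℝ → PTd d}
    {α : ℝ → Td d → Vd d} (h : AdmDisc S 1 δ μ m α) {T : ℝ} (hT : 0 ≤ T) : AdmOn S 1 μ T m α := by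
  obtain ⟨h1, h2, h3, h4, h5, h6⟩ := h
  have h2' := h2.mono (fun s hs => hs.1 : Set.Icc 0 T ⊆ Set.Ici (0:ℝ))
  have h5' := disc_energy hδ T h5
  refine ⟨h1, h2', fun s₁ s₂ a b _ => h3 s₁ s₂ a b, h4, h5', ?_⟩
  rw [intervalIntegrable_iff_integrableOn_Ioc_of_le hT]
  exact run_int S hT h2' h4 h5'

lemma AdmDisc.shift {d : ℕ} {S : MFGSetting d} {δ : ℝ} {μ : PTd d} {m : ℝ → PTd d}
    {α : ℝ → Td d → Vd d} (h : AdmDisc S 1 δ μ m α) {T : ℝ} (hT : 0 ≤ T) :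
    AdmDisc S 1 δ (m T) (fun s => m (s + T)) (fun s => α (s + T)) ∧
    costDisc S δ m α = (∫ s in Set.Ioc 0 T, Real.exp (-δ * s) * runCost S m α s) +
      Real.exp (-δ * T) * costDisc S δ (fun s => m (s + T)) (fun s => α (s + T)) := by
  obtain ⟨h1, h2, h3, h4, h5, h6⟩ := h
  have hmp := shift_mp T
  have hemb := measurableEmbedding_addRight T
  have hsub : Set.Ioi T ⊆ Set.Ioi 0 := Set.Ioi_subset_Ioi hT
  have hrc : ∀ s, runCost S (fun s => m (s + T)) (fun s => α (s + T)) s = runCost S m α (s + T) :=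
    fun s => rfl
  have hexp : ∀ s : ℝ, Real.exp (-δ * s) = Real.exp (δ * T) * Real.exp (-δ * (s + T)) := by
    intro s; rw [← Real.exp_add]; congr 1; ring
  refine ⟨⟨by simp, ?_, ?_, ?_, ?_, ?_⟩, ?_⟩
  · intro t ht ε hε
    obtain ⟨η, hη, h'⟩ := h2 (t + T) (add_nonneg ht hT) ε hε
    exact ⟨η, hη, fun s hs hst => h' (s + T) (add_nonneg hs hT) (by simpa using hst)⟩
  · intro s₁ s₂ a b
    have := FPeq_shift T (h3 (s₁ + T) (s₂ + T) (by linarith) (by linarith))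
    simpa using this
  · exact h4.comp ((measurable_fst.add_const T).prodMk measurable_snd)
  · have e := hmp.lintegral_comp_emb hemb (fun s => ENNReal.ofReal (Real.exp (-δ * s)) *
      ∫⁻ y, ENNReal.ofReal (sqnorm (α s y)) ∂(m s : Measure (Td d)))
    have e2 : ∀ s, ENNReal.ofReal (Real.exp (-δ * s)) *
        ∫⁻ y, ENNReal.ofReal (sqnorm (α (s + T) y)) ∂(m (s + T) : Measure (Td d)) =
        ENNReal.ofReal (Real.exp (δ * T)) * (ENNReal.ofReal (Real.exp (-δ * (s + T))) *
        ∫⁻ y, ENNReal.ofReal (sqnorm (α (s + T) y)) ∂(m (s + T) : Measure (Td d))) := by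
      intro s
      rw [hexp, ENNReal.ofReal_mul (Real.exp_nonneg _), mul_assoc]
    simp only [e2]
    rw [lintegral_const_mul' _ _ ENNReal.ofReal_ne_top, e]
    exact ENNReal.mul_lt_top ENNReal.ofReal_lt_top ((lintegral_mono_set hsub).trans_lt h5)
  · have e2 : ∀ s, Real.exp (-δ * s) * runCost S m α (s + T) = Real.exp (δ * T) *
        (Real.exp (-δ * (s + T)) * runCost S m α (s + T)) := by
      intro s
      rw [← mul_assoc, ← hexp]
    simp only [hrc, e2]
    exact (((hmp.integrable_comp_emb hemb).2 (h6.mono_measure (Measure.restrict_mono_set _ hsub)))).const_mul _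
  · have hu : Set.Ioi (0:ℝ) = Set.Ioc 0 T ∪ Set.Ioi T := (Set.Ioc_union_Ioi_eq_Ioi hT).symm
    have h6a : IntegrableOn (fun s => Real.exp (-δ * s) * runCost S m α s) (Set.Ioc 0 T) :=
      h6.mono_measure (Measure.restrict_mono_set _ Set.Ioc_subset_Ioi_self)
    have h6b : IntegrableOn (fun s => Real.exp (-δ * s) * runCost S m α s) (Set.Ioi T) :=
      h6.mono_measure (Measure.restrict_mono_set _ hsub)
    unfold costDisc
    rw [hu, setIntegral_union (Set.Ioc_disjoint_Ioi le_rfl) measurableSet_Ioi h6a h6b, ← hu]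
    congr 1
    rw [← hmp.integral_comp hemb, ← integral_const_mul]
    refine integral_congr_ae (Eventually.of_forall fun s => ?_)
    simp only [hrc]
    rw [← mul_assoc, ← Real.exp_add]
    congr 2
    ring

lemma concat {d : ℕ} {S : MFGSetting d} {δ : ℝ} (hδ : 0 < δ) {μ ν : PTd d} {T : ℝ} (hT : 0 ≤ T)
    {m m' : ℝ → PTd d} {α α' : ℝ → Td d → Vd d} (h : AdmOn S 1 μ T m α) (hν : m T = ν)
    (h' : AdmDisc S 1 δ ν m' α') :
    ∃ m'' α'', AdmDisc S 1 δ μ m'' α'' ∧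
    costDisc S δ m'' α'' = (∫ s in Set.Ioc 0 T, Real.exp (-δ * s) * runCost S m α s) +
      Real.exp (-δ * T) * costDisc S δ m' α' := by
  obtain ⟨h1, h2, h3, h4, h5, h6⟩ := h
  obtain ⟨k1, k2, k3, k4, k5, k6⟩ := h'
  set M : ℝ → PTd d := fun s => if s ≤ T then m s else m' (s - T) with hM
  set B : ℝ → Td d → Vd d := fun s => if s ≤ T then α s else α' (s - T) with hB
  have hMl : ∀ s, s ≤ T → M s = m s := fun s hs => by simp [hM, hs]
  have hMr : ∀ s, T ≤ s → M s = m' (s - T) := by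
    intro s hs
    rcases hs.eq_or_lt with rfl | hs
    · simp [hM, k1, hν]
    · simp [hM, not_le.2 hs]
  have hBl : ∀ s, s ≤ T → B s = α s := fun s hs => by simp [hB, hs]
  have hBr : ∀ s, T < s → B s = α' (s - T) := fun s hs => by simp [hB, not_le.2 hs]
  have hBm : Measurable (fun q : ℝ × Td d => B q.1 q.2) := by
    have : (fun q : ℝ × Td d => B q.1 q.2) =
        fun q => if q.1 ≤ T then α q.1 q.2 else α' (q.1 - T) q.2 := by
      funext q
      simp only [hB]
      split_ifs <;> rfl
    rw [this]
    refine Measurable.ite (measurableSet_le measurable_fst measurable_const) h4 ?_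
    exact k4.comp ((measurable_fst.sub_const T).prodMk measurable_snd)
  have hMc : W1ContOn M (Set.Ici 0) := by
    intro t ht ε hε
    rcases lt_trichotomy t T with htT | rfl | htT
    · obtain ⟨η, hη, h'⟩ := h2 t ⟨ht, htT.le⟩ ε hε
      refine ⟨min η (T - t), lt_min hη (by linarith), fun s hs hst => ?_⟩
      have hsT : s ≤ T := by
        have := (abs_lt.1 (hst.trans_le (min_le_right _ _))).2
        linarith
      rw [hMl s hsT, hMl t htT.le]
      exact h' s ⟨hs, hsT⟩ (hst.trans_le (min_le_left _ _))
    · obtain ⟨η, hη, h'⟩ := h2 t ⟨ht, le_rfl⟩ ε hε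
      obtain ⟨η', hη', h''⟩ := k2 0 (by simp) ε hε
      refine ⟨min η η', lt_min hη hη', fun s hs hst => ?_⟩
      rcases le_total s t with hs' | hs'
      · rw [hMl s hs', hMl t le_rfl]
        exact h' s ⟨hs, hs'⟩ (hst.trans_le (min_le_left _ _))
      · rw [hMr s hs', hMr t le_rfl, sub_self]
        exact h'' _ (by simpa using hs') (by simpa using hst.trans_le (min_le_right _ _))
    · obtain ⟨η, hη, h'⟩ := k2 (t - T) (by simpa using htT.le) ε hε
      refine ⟨min η (t - T), lt_min hη (by linarith), fun s hs hst => ?_⟩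
      have hsT : T ≤ s := by
        have := (abs_lt.1 (hst.trans_le (min_le_right _ _))).1
        linarith
      rw [hMr s hsT, hMr t htT.le]
      exact h' _ (by simpa using hsT) (by simpa using hst.trans_le (min_le_left _ _))
  have hmp := shift_mp T
  have hemb := measurableEmbedding_addRight T
  have hu : Set.Ioi (0:ℝ) = Set.Ioc 0 T ∪ Set.Ioi T := (Set.Ioc_union_Ioi_eq_Ioi hT).symm
  have hME : (∫⁻ s in Set.Ioi (0:ℝ), ENNReal.ofReal (Real.exp (-δ * s)) *
      ∫⁻ y, ENNReal.ofReal (sqnorm (B s y)) ∂(M s : Measure (Td d))) < ⊤ := by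
    rw [hu, lintegral_union measurableSet_Ioi (Set.Ioc_disjoint_Ioi le_rfl)]
    refine ENNReal.add_lt_top.2 ⟨?_, ?_⟩
    · refine lt_of_le_of_lt (setLIntegral_mono' measurableSet_Ioc fun s hs => ?_) h5
      rw [hMl s hs.2, hBl s hs.2]
      refine mul_le_of_le_one_left' ?_
      rw [ENNReal.ofReal_le_one, Real.exp_le_one_iff]
      nlinarith [hs.1]
    · rw [← hmp.lintegral_comp_emb hemb]
      refine lt_of_le_of_lt (setLIntegral_mono' measurableSet_Ioi fun s hs => ?_) k5
      rw [Set.mem_Ioi] at hs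
      rw [hMr _ (by linarith), hBr _ (by linarith), add_sub_cancel_right]
      refine mul_le_mul' (ENNReal.ofReal_le_ofReal (Real.exp_le_exp.2 ?_)) le_rfl
      nlinarith
  have hrl : ∀ s, s ≤ T → runCost S M B s = runCost S m α s := by
    intro s hs
    simp only [runCost, hMl s hs, hBl s hs]
  have hrr : ∀ s, 0 < s → runCost S M B (s + T) = runCost S m' α' s := by
    intro s hs
    simp only [runCost]
    rw [hMr _ (by linarith), hBr _ (by linarith), add_sub_cancel_right]
  have hI1 : IntegrableOn (fun s => Real.exp (-δ * s) * runCost S M B s) (Set.Ioc 0 T) := by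
    have : IntegrableOn (fun s => Real.exp (-δ * s) * runCost S m α s) (Set.Ioc 0 T) := by
      rw [intervalIntegrable_iff_integrableOn_Ioc_of_le hT] at h6
      refine Integrable.bdd_mul (c := 1) h6 (by fun_prop) ?_
      filter_upwards [ae_restrict_mem measurableSet_Ioc] with s hs
      rw [Real.norm_eq_abs, abs_of_nonneg (Real.exp_nonneg _), Real.exp_le_one_iff]
      nlinarith [hs.1]
    refine this.congr_fun (fun s hs => ?_) measurableSet_Ioc
    simp only [hrl s hs.2]
  have hexp : ∀ s : ℝ, Real.exp (-δ * (s + T)) = Real.exp (-δ * T) * Real.exp (-δ * s) := by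
    intro s; rw [← Real.exp_add]; congr 1; ring
  have hI2 : IntegrableOn (fun s => Real.exp (-δ * s) * runCost S M B s) (Set.Ioi T) := by
    refine (hmp.integrable_comp_emb hemb).1 ?_
    refine IntegrableOn.congr_fun (k6.const_mul (Real.exp (-δ * T))) (fun s hs => ?_)
      measurableSet_Ioi
    simp only [Function.comp]
    rw [hrr s hs, hexp, mul_assoc]
  have hFPl : ∀ s₁ s₂, 0 ≤ s₁ → s₁ ≤ s₂ → s₂ ≤ T → FPeq 1 M B s₁ s₂ := fun s₁ s₂ a b c =>
    FPeq_congr b (h3 s₁ s₂ a b c) (fun s hs => (hMl s (hs.2.trans c)).symm)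
      (fun s hs => (hBl s (hs.2.trans c)).symm)
  have hFPr : ∀ s₁ s₂, T ≤ s₁ → s₁ ≤ s₂ → FPeq 1 M B s₁ s₂ := by
    intro s₁ s₂ a b
    have := FPeq_shift (-T) (k3 (s₁ - T) (s₂ - T) (by linarith) (by linarith))
    simp only [sub_neg_eq_add, sub_add_cancel] at this
    refine FPeq_congr b this (fun s hs => ?_) (fun s hs => ?_)
    · rw [hMr s (a.trans hs.1), sub_eq_add_neg]
    · rw [hBr s (a.trans_lt hs.1), sub_eq_add_neg]
  refine ⟨M, B, ⟨?_, hMc, ?_, hBm, hME, ?_⟩, ?_⟩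
  · rw [hMl 0 hT, h1]
  · intro s₁ s₂ a b
    rcases le_total s₂ T with c | c
    · exact hFPl _ _ a b c
    rcases le_total T s₁ with e | e
    · exact hFPr _ _ e b
    have f1 := FPeq_gen.1 (hFPl s₁ T a e le_rfl)
    have f2 := FPeq_gen.1 (hFPr T s₂ le_rfl c)
    rw [FPeq_gen]
    intro φ hφ
    have hint := (gen_int (a.trans b) (hMc.mono (fun s hs => hs.1 : Set.Icc 0 s₂ ⊆ Set.Ici (0:ℝ)))
      hBm (disc_energy hδ s₂ hME) hφ).2
    rw [← intervalIntegral.integral_add_adjacent_intervals (b := T), ← f1 φ hφ, ← f2 φ hφ]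
    · ring
    · rw [intervalIntegrable_iff_integrableOn_Ioc_of_le e]
      exact hint.mono_set (Set.Ioc_subset_Ioc a c)
    · rw [intervalIntegrable_iff_integrableOn_Ioc_of_le c]
      exact hint.mono_set (Set.Ioc_subset_Ioc hT le_rfl)
  · rw [hu]
    exact hI1.union hI2
  · unfold costDisc
    rw [hu, setIntegral_union (Set.Ioc_disjoint_Ioi le_rfl) measurableSet_Ioi hI1 hI2, ← hu]
    congr 1
    · refine setIntegral_congr_fun measurableSet_Ioc fun s hs => ?_
      simp only [hrl s hs.2]
    · rw [← hmp.integral_comp hemb, ← integral_const_mul]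
      refine setIntegral_congr_fun measurableSet_Ioi fun s hs => ?_
      simp only [hrr s hs, hexp, mul_assoc]

/-! ### The Gaussian measure -/

def gE {d : ℕ} (ξ : Vd d) : ℝ := Real.exp (-(1/2) * sqnorm ξ)

def Zg (d : ℕ) : ℝ := ∫ ξ : Vd d, gE ξ

def gam (d : ℕ) : Measure (Vd d) := volume.withDensity (fun ξ => ENNReal.ofReal (gE ξ / Zg d))

lemma exp_sq_int {d : ℕ} {a : ℝ} (ha : 0 < a) :
    Integrable (fun ξ : Vd d => Real.exp (-a * sqnorm ξ)) := by
  have : (fun ξ : Vd d => Real.exp (-a * sqnorm ξ)) = fun ξ => ∏ i, Real.exp (-a * (ξ i)^2) := by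
    funext ξ
    rw [← Real.exp_sum, sqnorm, Finset.mul_sum]
  rw [this, volume_pi]
  exact Integrable.fintype_prod (f := fun (_ : Fin d) x => Real.exp (-a * x^2))
    (fun i => integrable_exp_neg_mul_sq ha)

lemma gE_pos {d : ℕ} (ξ : Vd d) : 0 < gE ξ := Real.exp_pos _

lemma gE_cont {d : ℕ} : Continuous (gE : Vd d → ℝ) := by
  have := sqnorm_cont (d := d)
  unfold gE
  fun_prop

lemma gE_int {d : ℕ} : Integrable (gE : Vd d → ℝ) := exp_sq_int (by norm_num)

lemma Zg_pos (d : ℕ) : 0 < Zg d := by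
  unfold Zg
  rw [integral_pos_iff_support_of_nonneg (fun ξ => (gE_pos ξ).le) gE_int]
  have : Function.support (gE : Vd d → ℝ) = univ := by
    ext ξ; simp [(gE_pos ξ).ne']
  rw [this]
  exact isOpen_univ.measure_pos _ univ_nonempty

lemma gam_dens_meas {d : ℕ} : Measurable (fun ξ : Vd d => ENNReal.ofReal (gE ξ / Zg d)) :=
  (gE_cont.measurable.div_const _).ennreal_ofReal

instance gam_prob (d : ℕ) : IsProbabilityMeasure (gam d) := by
  refine ⟨?_⟩
  rw [gam, withDensity_apply _ MeasurableSet.univ, Measure.restrict_univ,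
    ← ofReal_integral_eq_lintegral_ofReal (gE_int.div_const _)
      (Eventually.of_forall fun ξ => div_nonneg (gE_pos ξ).le (Zg_pos d).le),
    integral_div]
  change ENNReal.ofReal (Zg d / Zg d) = 1
  rw [div_self (Zg_pos d).ne', ENNReal.ofReal_one]

lemma gam_int_iff {d : ℕ} {f : Vd d → ℝ} :
    Integrable f (gam d) ↔ Integrable (fun ξ => gE ξ * f ξ) := by
  unfold gam
  rw [integrable_withDensity_iff_integrable_smul' gam_dens_meas (by simp)]
  have : (fun ξ : Vd d => (ENNReal.ofReal (gE ξ / Zg d)).toReal • f ξ)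
      = fun ξ => (Zg d)⁻¹ * (gE ξ * f ξ) := by
    funext ξ
    rw [ENNReal.toReal_ofReal (div_nonneg (gE_pos ξ).le (Zg_pos d).le), smul_eq_mul]
    ring
  rw [this]
  exact integrable_const_mul_iff (isUnit_iff_ne_zero.2 (inv_ne_zero (Zg_pos d).ne')) _

lemma gam_integral {d : ℕ} (f : Vd d → ℝ) :
    ∫ ξ, f ξ ∂(gam d) = (Zg d)⁻¹ * ∫ ξ, gE ξ * f ξ := by
  unfold gam
  rw [integral_withDensity_eq_integral_toReal_smul gam_dens_meas (by simp), ← integral_const_mul]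
  congr 1
  funext ξ
  rw [ENNReal.toReal_ofReal (div_nonneg (gE_pos ξ).le (Zg_pos d).le), smul_eq_mul]
  ring

lemma gam_moment (d : ℕ) : Integrable (fun ξ => (1 + sqnorm ξ)^2) (gam d) := by
  rw [gam_int_iff]
  have h := (exp_sq_int (d := d) (a := 1/4) (by norm_num)).const_mul 64
  have hc := sqnorm_cont (d := d)
  have hc' := gE_cont (d := d)
  refine h.mono' (by fun_prop) (Eventually.of_forall fun ξ => ?_)
  have h0 := sqnorm_nonneg ξ
  rw [Real.norm_eq_abs, abs_of_nonneg (mul_nonneg (gE_pos ξ).le (sq_nonneg _))]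
  set t := sqnorm ξ
  have e1 : gE ξ = Real.exp (-(1/4) * t) * Real.exp (-(1/4) * t) := by
    rw [← Real.exp_add]
    unfold gE
    congr 1
    ring
  have e2 : (1 + t)^2 ≤ 64 * Real.exp (1/4 * t) := by
    have : t/8 + 1 ≤ Real.exp (t/8) := Real.add_one_le_exp _
    have e3 : Real.exp (1/4 * t) = Real.exp (t/8) ^ 2 := by
      rw [← Real.exp_nat_mul]; congr 1; push_cast; ring
    rw [e3]
    nlinarith
  have e4 : Real.exp (-(1/4) * t) * Real.exp (1/4 * t) = 1 := by
    rw [← Real.exp_add]; simp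
  have e5 := Real.exp_pos (-(1/4) * t)
  calc gE ξ * (1 + t)^2 ≤ gE ξ * (64 * Real.exp (1/4 * t)) := by
        gcongr
        exact (gE_pos ξ).le
    _ = 64 * Real.exp (-(1/4) * t) * (Real.exp (-(1/4) * t) * Real.exp (1/4 * t)) := by
        rw [e1]; ring
    _ = _ := by rw [e4, mul_one]

lemma gam_int_of_le {d : ℕ} {f : Vd d → ℝ} (hf : Measurable f) {C : ℝ}
    (h : ∀ ξ, |f ξ| ≤ C * (1 + sqnorm ξ)^2) : Integrable f (gam d) :=
  ((gam_moment d).const_mul C).mono' hf.aestronglyMeasurable (Eventually.of_forall h)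

lemma norm_le_mom {d : ℕ} (ξ : Vd d) : ‖ξ‖ ≤ (1 + sqnorm ξ)^2 := by
  have := norm_le_one_add_sqnorm ξ
  nlinarith [sqnorm_nonneg ξ]

lemma gam_norm_int (d : ℕ) : Integrable (fun ξ => ‖ξ‖) (gam d) :=
  gam_int_of_le measurable_norm (C := 1) fun ξ => by
    rw [abs_of_nonneg (norm_nonneg _), one_mul]; exact norm_le_mom ξ

lemma gE_hasFDeriv {d : ℕ} (ξ : Vd d) (i : Fin d) :
    DifferentiableAt ℝ gE ξ ∧ fderiv ℝ gE ξ (Pi.single i 1) = - (gE ξ * ξ i) := by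
  have hd : DifferentiableAt ℝ (gE : Vd d → ℝ) ξ := by
    unfold gE sqnorm
    fun_prop
  refine ⟨hd, ?_⟩
  have hl : HasDerivAt (fun t : ℝ => ξ + t • (Pi.single i 1 : Vd d)) (Pi.single i 1) 0 := by
    simpa using (((hasDerivAt_id (0:ℝ)).smul_const (Pi.single i 1 : Vd d)).const_add ξ)
  have h1 : HasDerivAt (fun t : ℝ => gE (ξ + t • (Pi.single i 1 : Vd d)))
      (fderiv ℝ gE ξ (Pi.single i 1)) 0 := by
    have h2 : HasFDerivAt gE (fderiv ℝ gE ξ) (ξ + (0:ℝ) • (Pi.single i 1 : Vd d)) := by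
      simpa using hd.hasFDerivAt
    exact h2.comp_hasDerivAt (0:ℝ) hl
  have h3 : ∀ t : ℝ, gE (ξ + t • (Pi.single i 1 : Vd d)) = Real.exp (-(1/2) * (sqnorm ξ + 2 * t * ξ i + t^2)) := by
    intro t
    unfold gE sqnorm
    congr 2
    have : ∀ j, ((ξ + t • (Pi.single i 1 : Vd d)) j)^2 = ξ j ^2 + (if j = i then 2 * t * ξ i + t^2 else 0) := by
      intro j
      by_cases hj : j = i
      · subst hj; simp; ring
      · simp [hj]
    rw [Finset.sum_congr rfl fun j _ => this j, Finset.sum_add_distrib, Finset.sum_ite_eq' Finset.univ i, if_pos (Finset.mem_univ i)]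
    ring
  simp only [h3] at h1
  have h4 : HasDerivAt (fun t : ℝ => Real.exp (-(1/2) * (sqnorm ξ + 2 * t * ξ i + t^2)))
      (- (gE ξ * ξ i)) 0 := by
    have : HasDerivAt (fun t : ℝ => -(1/2) * (sqnorm ξ + 2 * t * ξ i + t^2)) (- ξ i) 0 := by
      have a1 : HasDerivAt (fun t : ℝ => 2 * t * ξ i) (2 * 1 * ξ i) 0 :=
        ((hasDerivAt_id (0:ℝ)).const_mul 2).mul_const _
      have a2 : HasDerivAt (fun t : ℝ => t^2) (2 * 0) 0 := by
        simpa using hasDerivAt_pow 2 (0:ℝ)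
      have a3 := ((a1.const_add (sqnorm ξ)).add a2).const_mul (-(1/2))
      refine a3.congr_deriv ?_
      ring
    have h5 := this.exp
    convert h5 using 1
    simp [gE]
  exact h1.unique h4

lemma stein {d : ℕ} {f : Vd d → ℝ} (hf : ContDiff ℝ 1 f) (i : Fin d) {C : ℝ} (h1 : ∀ ξ, |f ξ| ≤ C)
    (h2 : ∀ ξ, |fderiv ℝ f ξ (Pi.single i 1)| ≤ C) :
    ∫ ξ, ξ i * f ξ ∂(gam d) = ∫ ξ, fderiv ℝ f ξ (Pi.single i 1) ∂(gam d) := by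
  have hc : Continuous (fun ξ => fderiv ℝ f ξ (Pi.single i 1)) :=
    (hf.continuous_fderiv (by norm_num)).clm_apply continuous_const
  have hC : 0 ≤ C := (abs_nonneg _).trans (h1 0)
  have i1 : Integrable (fun ξ => fderiv ℝ f ξ (Pi.single i 1)) (gam d) :=
    integrable_of_bdd hc.measurable h2
  have i2 : Integrable (fun ξ => ξ i * f ξ) (gam d) := by
    refine gam_int_of_le (by have := hf.continuous.measurable; fun_prop) (C := C) fun ξ => ?_
    rw [abs_mul, mul_comm]
    have : |ξ i| ≤ (1 + sqnorm ξ)^2 := (norm_le_pi_norm ξ i).trans (norm_le_mom ξ)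
    have := h1 ξ
    gcongr
  have i3 : Integrable f (gam d) := integrable_of_bdd hf.continuous.measurable h1
  rw [gam_int_iff] at i1 i2 i3
  rw [gam_integral, gam_integral]
  congr 1
  have key := integral_mul_fderiv_eq_neg_fderiv_mul_of_integrable (μ := (volume : Measure (Vd d)))
    (f := f) (g := gE) (v := Pi.single i 1) (by simpa only [mul_comm] using i1)
    (by
      simp only [(gE_hasFDeriv _ i).2]
      refine i2.neg.congr (Eventually.of_forall fun ξ => ?_)
      simp only [Pi.neg_apply]; ring)
    (by simpa only [mul_comm] using i3) (fun x _ => hf.differentiable (by norm_num) x)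
    (fun x _ => (gE_hasFDeriv x i).1)
  simp only [(gE_hasFDeriv _ i).2] at key
  have e1 : ∀ ξ : Vd d, f ξ * -(gE ξ * ξ i) = -(gE ξ * (ξ i * f ξ)) := fun ξ => by ring
  simp only [e1, integral_neg] at key
  rw [neg_inj] at key
  rw [key]
  simp only [mul_comm]

/-! ### Ito formula for Brownian flows with constant drift -/

lemma tf_dir {d : ℕ} {φ : ℝ → Vd d → ℝ} (h : IsTestFun φ) (t : ℝ) (x v : Vd d) :
    fderiv ℝ (fun q : ℝ × Vd d => φ q.1 q.2) (t, x) (1, v)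
      = tderiv φ t x + dotp v (gradv (φ t) x) := by
  have e : ((1:ℝ), v) = (1, 0) + ∑ i, v i • ((0:ℝ), (Pi.single i 1 : Vd d)) := by
    refine Prod.ext ?_ ?_
    · simp [Prod.fst_sum]
    · simp only [Prod.snd_add, Prod.snd_sum, Prod.smul_snd, zero_add]
      funext j
      simp [Finset.sum_apply, Pi.single_apply]
  rw [e, map_add, map_sum]
  simp only [map_smul, ← fderivx_eq h]
  unfold tderiv dotp gradv
  rw [(tf_slice_t h t x).deriv]
  simp only [smul_eq_mul]

lemma gam_contOn {d : ℕ} {g : ℝ → Vd d → ℝ} (hg : Continuous (fun q : ℝ × Vd d => g q.1 q.2))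
    {a b C : ℝ} (hC : ∀ s ∈ Icc a b, ∀ ξ, |g s ξ| ≤ C) :
    ContinuousOn (fun s => ∫ ξ, g s ξ ∂(gam d)) (Icc a b) := by
  refine continuousOn_of_dominated (bound := fun _ => C) ?_ ?_ (integrable_const _) ?_
  · intro s _
    exact (hg.comp (Continuous.prodMk_right s)).aestronglyMeasurable
  · intro s hs
    exact Eventually.of_forall fun ξ => hC s hs ξ
  · exact Eventually.of_forall fun ξ => (hg.comp (Continuous.prodMk_left ξ)).continuousOn

def bmY {d : ℕ} (x b : Vd d) (s : ℝ) (ξ : Vd d) : Vd d := x + s • b + √(2 * s) • ξ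

lemma bmY_cont {d : ℕ} (x b : Vd d) : Continuous (fun q : ℝ × Vd d => bmY x b q.1 q.2) := by
  unfold bmY
  fun_prop

lemma bmY_deriv {d : ℕ} (x b : Vd d) (ξ : Vd d) {s : ℝ} (hs : 0 < s) :
    HasDerivAt (fun s => bmY x b s ξ) (b + (√(2 * s))⁻¹ • ξ) s := by
  unfold bmY
  have h1 : HasDerivAt (fun s : ℝ => √(2 * s)) ((√(2 * s))⁻¹) s := by
    have := ((hasDerivAt_id s).const_mul 2).sqrt (by simpa using hs.ne')
    refine this.congr_deriv ?_
    simp only [id]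
    field_simp
  have h2 : HasDerivAt (fun s : ℝ => x + s • b) b s := by
    simpa using ((hasDerivAt_id s).smul_const b).const_add x
  exact h2.add (h1.smul_const ξ)

lemma ito_stein {d : ℕ} {φ : ℝ → Vd d → ℝ} (h : IsTestFun φ) (x b : Vd d) {s : ℝ} (hs : 0 < s) :
    ∫ ξ, fderiv ℝ (fun q : ℝ × Vd d => φ q.1 q.2) (s, bmY x b s ξ) (1, b + (√(2 * s))⁻¹ • ξ) ∂(gam d)
      = ∫ ξ, gen φ s (bmY x b s ξ) (-b) ∂(gam d) := by
  set r := √(2 * s) with hr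
  have r0 : 0 < r := Real.sqrt_pos.2 (by linarith)
  have hYc : Continuous (bmY x b s) := (bmY_cont x b).comp (Continuous.prodMk_right s)
  obtain ⟨C1, h1, hC1⟩ := bdd_of_per (tderiv_cont h) (tderiv_per h) s s
  obtain ⟨C3, h3, hC3⟩ := gradv_bdd h s s
  have hss : s ∈ Icc s s := ⟨le_rfl, le_rfl⟩
  have gc : ∀ i, Continuous (fun ξ => gradv (φ s) (bmY x b s ξ) i) := fun i =>
    (continuous_apply i).comp ((gradv_cont h).comp (Continuous.prodMk_right s |>.comp hYc))
  have gb : ∀ i ξ, |gradv (φ s) (bmY x b s ξ) i| ≤ C3 := fun i ξ =>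
    (norm_le_pi_norm (gradv (φ s) (bmY x b s ξ)) i).trans (hC3 s hss _)
  have tc : Continuous (fun ξ => tderiv φ s (bmY x b s ξ)) :=
    (tderiv_cont h).comp (Continuous.prodMk_right s |>.comp hYc)
  have D2i : ∀ i, ∃ C, 0 ≤ C ∧ ∀ t ∈ Icc s s, ∀ y, |D2 (φ t) y (Pi.single i 1) (Pi.single i 1)| ≤ C := by
    intro i
    refine bdd_of_per (D2_cont h _ _) ?_ s s
    intro t y z
    simp only [D2]
    rw [← fderiv_comp_add_right]
    congr 2
    funext y
    rw [fderiv_per h]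
  have dc : ∀ i, Continuous (fun ξ => D2 (φ s) (bmY x b s ξ) (Pi.single i 1) (Pi.single i 1)) := fun i =>
    (D2_cont h _ _).comp (Continuous.prodMk_right s |>.comp hYc)
  have dI : ∀ i, Integrable (fun ξ => D2 (φ s) (bmY x b s ξ) (Pi.single i 1) (Pi.single i 1)) (gam d) := by
    intro i
    obtain ⟨C, _, hC⟩ := D2i i
    exact integrable_of_bdd (dc i).measurable fun ξ => hC s hss _
  have iA : Integrable (fun ξ => tderiv φ s (bmY x b s ξ)) (gam d) :=
    integrable_of_bdd tc.measurable fun ξ => hC1 s hss _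
  have iB : ∀ i, Integrable (fun ξ => b i * gradv (φ s) (bmY x b s ξ) i) (gam d) := fun i =>
    (integrable_of_bdd (gc i).measurable (gb i)).const_mul _
  have iC : ∀ i, Integrable (fun ξ => r⁻¹ * (ξ i * gradv (φ s) (bmY x b s ξ) i)) (gam d) := by
    intro i
    refine Integrable.const_mul ?_ _
    refine gam_int_of_le (by have := (gc i).measurable; fun_prop) (C := C3) fun ξ => ?_
    rw [abs_mul, mul_comm]
    have : |ξ i| ≤ (1 + sqnorm ξ)^2 := (norm_le_pi_norm ξ i).trans (norm_le_mom ξ)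
    have := gb i ξ
    gcongr
  have st : ∀ i, ∫ ξ, r⁻¹ * (ξ i * gradv (φ s) (bmY x b s ξ) i) ∂(gam d)
      = ∫ ξ, D2 (φ s) (bmY x b s ξ) (Pi.single i 1) (Pi.single i 1) ∂(gam d) := by
    intro i
    obtain ⟨C, hC0, hC⟩ := D2i i
    have hgd : ContDiff ℝ 1 (fun y => fderiv ℝ (φ s) y (Pi.single i 1)) := by
      have : (fun y => fderiv ℝ (φ s) y (Pi.single i 1)) = fun y =>
          (fun q => fderiv ℝ (fun q : ℝ × Vd d => φ q.1 q.2) q (0, Pi.single i 1)) (s, y) := by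
        funext y
        exact fderivx_eq h s y _
      rw [this]
      exact (tf_fderiv_contDiff h _).comp (contDiff_const.prodMk contDiff_id)
    have hYd : ∀ ξ, HasFDerivAt (bmY x b s) (r • ContinuousLinearMap.id ℝ (Vd d)) ξ := by
      intro ξ
      unfold bmY
      exact ((hasFDerivAt_id ξ).const_smul r).const_add _
    have hYcd : ContDiff ℝ 1 (bmY x b s) := by
      unfold bmY
      fun_prop
    have hf : ContDiff ℝ 1 (fun ξ => gradv (φ s) (bmY x b s ξ) i) := hgd.comp hYcd
    have hfd : ∀ ξ, fderiv ℝ (fun ξ => gradv (φ s) (bmY x b s ξ) i) ξ (Pi.single i 1)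
        = r * D2 (φ s) (bmY x b s ξ) (Pi.single i 1) (Pi.single i 1) := by
      intro ξ
      have := ((hgd.differentiable (by norm_num) (bmY x b s ξ)).hasFDerivAt.comp ξ (hYd ξ)).fderiv
      have e2 : fderiv ℝ (fun ξ => gradv (φ s) (bmY x b s ξ) i) ξ = _ := this
      rw [e2]
      simp [D2]
    have hs' := stein hf i (C := max C3 (r * C)) (fun ξ => (gb i ξ).trans (le_max_left _ _))
      (fun ξ => by
        rw [hfd, abs_mul, abs_of_pos r0]
        exact (mul_le_mul_of_nonneg_left (hC s hss _) r0.le).trans (le_max_right _ _))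
    rw [integral_const_mul, hs']
    simp only [hfd]
    rw [integral_const_mul, ← mul_assoc, inv_mul_cancel₀ r0.ne', one_mul]
  have e1 : ∀ ξ, fderiv ℝ (fun q : ℝ × Vd d => φ q.1 q.2) (s, bmY x b s ξ) (1, b + r⁻¹ • ξ)
      = tderiv φ s (bmY x b s ξ) + ∑ i, b i * gradv (φ s) (bmY x b s ξ) i
        + ∑ i, r⁻¹ * (ξ i * gradv (φ s) (bmY x b s ξ) i) := by
    intro ξ
    rw [tf_dir h, dotp, add_assoc, ← Finset.sum_add_distrib]
    congr 1
    refine Finset.sum_congr rfl fun i _ => ?_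
    simp only [Pi.add_apply, Pi.smul_apply, smul_eq_mul]
    ring
  have e2 : ∀ ξ, gen φ s (bmY x b s ξ) (-b)
      = tderiv φ s (bmY x b s ξ) + ∑ i, b i * gradv (φ s) (bmY x b s ξ) i
        + ∑ i, D2 (φ s) (bmY x b s ξ) (Pi.single i 1) (Pi.single i 1) := by
    intro ξ
    simp only [gen, dotp, lapl, Pi.neg_apply, neg_mul, Finset.sum_neg_distrib]
    ring
  simp only [e1, e2]
  have iAB := iA.add (integrable_finsetSum Finset.univ fun i _ => iB i)
  have iAB' : Integrable (fun ξ => tderiv φ s (bmY x b s ξ) + ∑ i, b i * gradv (φ s) (bmY x b s ξ) i) (gam d) := iAB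
  rw [integral_add iAB' (integrable_finsetSum _ fun i _ => iC i),
    integral_add iAB' (integrable_finsetSum _ fun i _ => dI i),
    integral_finsetSum _ fun i _ => iC i, integral_finsetSum _ fun i _ => dI i]
  simp only [st]

lemma ito {d : ℕ} {φ : ℝ → Vd d → ℝ} (h : IsTestFun φ) (x b : Vd d) {s₁ s₂ : ℝ} (h0 : 0 ≤ s₁)
    (h12 : s₁ ≤ s₂) :
    (∫ ξ, φ s₂ (bmY x b s₂ ξ) ∂(gam d)) - (∫ ξ, φ s₁ (bmY x b s₁ ξ) ∂(gam d))
      = ∫ s in s₁..s₂, ∫ ξ, gen φ s (bmY x b s ξ) (-b) ∂(gam d) := by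
  have hc := bmY_cont x b
  symm
  refine intervalIntegral.integral_eq_sub_of_hasDerivAt_of_le (f := fun s => ∫ ξ, φ s (bmY x b s ξ) ∂(gam d)) h12 ?_ ?_ ?_
  · obtain ⟨C, _, hC⟩ := tf_bdd h s₁ s₂
    exact gam_contOn (g := fun s ξ => φ s (bmY x b s ξ))
      ((tf_cont h).comp (continuous_fst.prodMk hc)) fun s hs ξ => hC s hs _
  · intro s hs
    have hs0 : 0 < s := h0.trans_lt hs.1
    rw [← ito_stein h x b hs0]
    obtain ⟨C1, h1, hC1⟩ := bdd_of_per (tderiv_cont h) (tderiv_per h) (s/2) (2*s)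
    obtain ⟨C3, h3, hC3⟩ := gradv_bdd h (s/2) (2*s)
    obtain ⟨C, _, hC⟩ := tf_bdd h s s
    have hd : ∀ u > 0, ∀ ξ, HasDerivAt (fun u => φ u (bmY x b u ξ))
        (fderiv ℝ (fun q : ℝ × Vd d => φ q.1 q.2) (u, bmY x b u ξ) (1, b + (√(2 * u))⁻¹ • ξ)) u := by
      intro u hu ξ
      have a1 : HasFDerivAt (fun q : ℝ × Vd d => φ q.1 q.2) _ (u, bmY x b u ξ) :=
        (h.1.differentiable (by norm_num) _).hasFDerivAt
      exact a1.comp_hasDerivAt u ((hasDerivAt_id u).prodMk (bmY_deriv x b ξ hu))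
    have hball : ∀ u ∈ Metric.ball s (s/2), s/2 < u ∧ u < 2 * s := by
      intro u hu
      rw [Metric.mem_ball, Real.dist_eq, abs_lt] at hu
      constructor <;> linarith
    refine (hasDerivAt_integral_of_dominated_loc_of_deriv_le (s := Metric.ball s (s/2)) (μ := gam d)
      (F := fun u ξ => φ u (bmY x b u ξ))
      (F' := fun u ξ => fderiv ℝ (fun q : ℝ × Vd d => φ q.1 q.2) (u, bmY x b u ξ) (1, b + (√(2 * u))⁻¹ • ξ))
      (bound := fun ξ => C1 + d * ((‖b‖ + (√s)⁻¹ * ‖ξ‖) * C3))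
      (Metric.ball_mem_nhds _ (by linarith)) ?_ ?_ ?_ ?_ ?_ ?_).2
    · refine Eventually.of_forall fun u => ?_
      exact ((tf_cont h).comp (continuous_const.prodMk (hc.comp (Continuous.prodMk_right u)))).aestronglyMeasurable
    · exact integrable_of_bdd ((tf_cont h).comp (continuous_const.prodMk (hc.comp (Continuous.prodMk_right s)))).measurable
        fun ξ => hC s ⟨le_rfl, le_rfl⟩ _
    · have c1 : Continuous (fun ξ : Vd d => fderiv ℝ (fun q : ℝ × Vd d => φ q.1 q.2) (s, bmY x b s ξ)) :=
        (h.1.continuous_fderiv (by norm_num)).comp (continuous_const.prodMk (hc.comp (Continuous.prodMk_right s)))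
      exact (c1.clm_apply (by fun_prop)).aestronglyMeasurable
    · refine Eventually.of_forall fun ξ u hu => ?_
      obtain ⟨u1, u2⟩ := hball u hu
      rw [tf_dir h, Real.norm_eq_abs]
      refine (abs_add_le _ _).trans (add_le_add (hC1 u ⟨u1.le, u2.le⟩ _) ?_)
      refine (abs_dotp_le _ _).trans ?_
      have a1 := hC3 u ⟨u1.le, u2.le⟩ (bmY x b u ξ)
      have a2 : ‖b + (√(2 * u))⁻¹ • ξ‖ ≤ ‖b‖ + (√s)⁻¹ * ‖ξ‖ := by
        refine (norm_add_le _ _).trans ?_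
        rw [norm_smul, norm_inv, Real.norm_eq_abs, abs_of_nonneg (Real.sqrt_nonneg _)]
        have : √s ≤ √(2*u) := Real.sqrt_le_sqrt (by linarith)
        have : 0 < √s := Real.sqrt_pos.2 hs0
        gcongr
      gcongr
    · have := gam_norm_int d
      exact (integrable_const _).add ((((integrable_const _).add (this.const_mul _)).mul_const _).const_mul _)
    · exact Eventually.of_forall fun ξ u hu => hd u (by linarith [(hball u hu).1]) ξ
  · obtain ⟨C, hC0, hC⟩ := gen_bdd h s₁ s₂
    refine ContinuousOn.intervalIntegrable ?_
    rw [uIcc_of_le h12]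
    exact gam_contOn (g := fun s ξ => gen φ s (bmY x b s ξ) (-b))
      ((gen_cont h).comp (continuous_fst.prodMk (hc.prodMk continuous_const))) fun s hs ξ => hC s hs _ _

/-! ### Brownian flows as relaxed pieces -/

lemma W1_law_le {d : ℕ} {Ω : Type*} [MeasurableSpace Ω] {P : Measure Ω} [IsProbabilityMeasure P]
    {μ ν : PTd d} {Y₁ Y₂ : Ω → Td d} (h1 : Measurable Y₁) (h2 : Measurable Y₂)
    (hμ : (μ : Measure (Td d)) = P.map Y₁) (hν : (ν : Measure (Td d)) = P.map Y₂) {g : Ω → ℝ}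
    (hg : Integrable g P) (hd : ∀ ω, dist (Y₁ ω) (Y₂ ω) ≤ g ω) : W1 μ ν ≤ ∫ ω, g ω ∂P := by
  refine W1_le fun φ hφ => ?_
  have hm : Measurable φ := hφ.continuous.measurable
  obtain ⟨M, hM⟩ := lip_bdd hφ
  have i1 : Integrable (fun ω => φ (Y₁ ω)) P := integrable_of_bdd (hm.comp h1) fun ω => hM _
  have i2 : Integrable (fun ω => φ (Y₂ ω)) P := integrable_of_bdd (hm.comp h2) fun ω => hM _
  rw [hμ, hν, integral_map h1.aemeasurable hm.aestronglyMeasurable,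
    integral_map h2.aemeasurable hm.aestronglyMeasurable, ← integral_sub i1 i2]
  refine integral_mono (i1.sub i2) hg fun ω => ?_
  have := hφ.dist_le_mul (Y₁ ω) (Y₂ ω)
  rw [Real.dist_eq] at this
  simp only [NNReal.coe_one, one_mul] at this
  exact (le_abs_self _).trans (this.trans (hd ω))

lemma W1ContOn_of_modulus {d : ℕ} {m : ℝ → PTd d} {I : Set ℝ} (F : ℝ → ℝ → ℝ)
    (hF : ∀ t ∈ I, ContinuousWithinAt (fun s => F s t) I t) (h0 : ∀ t, F t t = 0)
    (h : ∀ s ∈ I, ∀ t ∈ I, W1 (m s) (m t) ≤ F s t) : W1ContOn m I := by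
  intro t ht ε hε
  obtain ⟨η, hη, H⟩ := (Metric.continuousWithinAt_iff.1 (hF t ht)) ε hε
  refine ⟨η, hη, fun s hs hst => (h s hs t ht).trans_lt ?_⟩
  have := H hs (by rw [Real.dist_eq]; exact hst)
  rw [Real.dist_eq, h0, sub_zero] at this
  exact (le_abs_self _).trans_lt this

section Flow
variable {d : ℕ} {Ω : Type*} [MeasurableSpace Ω]

def flowY (X b : Ω → Vd d) (p : ℝ × (Ω × Vd d)) : Td d := prT (bmY (X p.2.1) (b p.2.1) p.1 p.2.2)

lemma bmY_meas {X b : Ω → Vd d} (hX : Measurable X) (hb : Measurable b) :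
    Measurable (fun p : ℝ × (Ω × Vd d) => bmY (X p.2.1) (b p.2.1) p.1 p.2.2) := by
  unfold bmY
  fun_prop

lemma flowY_meas {X b : Ω → Vd d} (hX : Measurable X) (hb : Measurable b) :
    Measurable (flowY X b) := measurable_prT.comp (bmY_meas hX hb)

def flowM (ρ : Measure Ω) [IsProbabilityMeasure ρ] {X b : Ω → Vd d} (hX : Measurable X)
    (hb : Measurable b) (t : ℝ) : PTd d :=
  ⟨(ρ.prod (gam d)).map (fun ω => flowY X b (t, ω)),
    Measure.isProbabilityMeasure_map ((flowY_meas hX hb).comp measurable_prodMk_left).aemeasurable⟩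

lemma bmY_sub_le (x b : Vd d) (s t : ℝ) (ξ : Vd d) :
    ‖bmY x b s ξ - bmY x b t ξ‖ ≤ |s - t| * ‖b‖ + |√(2 * s) - √(2 * t)| * ‖ξ‖ := by
  have : bmY x b s ξ - bmY x b t ξ = (s - t) • b + (√(2 * s) - √(2 * t)) • ξ := by
    unfold bmY
    module
  rw [this]
  refine (norm_add_le _ _).trans ?_
  rw [norm_smul, norm_smul, Real.norm_eq_abs, Real.norm_eq_abs]

lemma flowM_W1 (ρ : Measure Ω) [IsProbabilityMeasure ρ] {X b : Ω → Vd d} (hX : Measurable X)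
    (hb : Measurable b) {B : ℝ} (hB : ∀ ω, ‖b ω‖ ≤ B) (s t : ℝ) :
    W1 (flowM ρ hX hb s) (flowM ρ hX hb t)
      ≤ |s - t| * B + |√(2 * s) - √(2 * t)| * ∫ ξ, ‖ξ‖ ∂(gam d) := by
  have hms : ∀ t, Measurable (fun ω : Ω × Vd d => flowY X b (t, ω)) := fun t =>
    (flowY_meas hX hb).comp measurable_prodMk_left
  have hi : Integrable (fun ω : Ω × Vd d => ‖ω.2‖) (ρ.prod (gam d)) := by
    simpa using (integrable_const (1:ℝ) (μ := ρ)).mul_prod (gam_norm_int d)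
  have hi2 : Integrable (fun ω : Ω × Vd d => |s - t| * B + |√(2 * s) - √(2 * t)| * ‖ω.2‖)
      (ρ.prod (gam d)) := (integrable_const _).add (hi.const_mul _)
  have := W1_law_le (P := ρ.prod (gam d)) (μ := flowM ρ hX hb s) (ν := flowM ρ hX hb t)
    (hms s) (hms t) rfl rfl hi2 (fun ω => by
      refine (dist_prT_le _ _).trans ((bmY_sub_le _ _ _ _ _).trans ?_)
      have := hB ω.1
      gcongr)
  refine this.trans (le_of_eq ?_)
  rw [integral_add (integrable_const _) (hi.const_mul _), integral_const_mul |√(2 * s) - √(2 * t)|]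
  have : ∫ ω : Ω × Vd d, ‖ω.2‖ ∂(ρ.prod (gam d)) = ∫ ξ, ‖ξ‖ ∂(gam d) := by
    have := integral_prod_mul (μ := ρ) (ν := gam d) (fun _ => (1:ℝ)) (fun ξ => ‖ξ‖)
    simpa using this
  rw [this]
  simp

open ProbabilityTheory in
lemma flow_piece (ρ : Measure Ω) [IsProbabilityMeasure ρ] {X b : Ω → Vd d} (hX : Measurable X)
    (hb : Measurable b) {B : ℝ} (hB : ∀ ω, ‖b ω‖ ≤ B) (T : ℝ) :
    RelPiece T (Kernel.const ℝ (ρ.prod (gam d))) (flowY X b) (fun p => - b p.2.1)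
      (flowM ρ hX hb) := by
  have hbs : ∀ ω, sqnorm (- b ω) ≤ d * B^2 := fun ω => by
    refine (sqnorm_le _).trans ?_
    rw [norm_neg]
    have := hB ω
    gcongr
  refine ⟨flowY_meas hX hb, by fun_prop, fun t => by rw [Kernel.const_apply]; rfl, ?_, ?_, ?_⟩
  · refine W1ContOn_of_modulus (fun s t => |s - t| * B + |√(2 * s) - √(2 * t)| * ∫ ξ, ‖ξ‖ ∂(gam d))
      ?_ (fun t => by simp) fun s _ t _ => flowM_W1 ρ hX hb hB s t
    intro t _
    refine Continuous.continuousWithinAt ?_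
    fun_prop
  · intro φ hφ s₁ s₂ h0 h12 _
    simp only [Kernel.const_apply]
    have e1 : ∀ s ω, φ s (secT (flowY X b (s, ω))) = φ s (bmY (X ω.1) (b ω.1) s ω.2) := fun s ω =>
      IsPer.sec (fun x z => hφ.2 s x z) _
    have e2 : ∀ s ω, gen φ s (secT (flowY X b (s, ω))) (- b ω.1)
        = gen φ s (bmY (X ω.1) (b ω.1) s ω.2) (- b ω.1) := fun s ω =>
      (gen_per hφ s (- b ω.1)).sec _
    simp only [e1, e2]
    have hbm := bmY_meas hX hb
    obtain ⟨C, hC0, hC⟩ := tf_bdd hφ s₁ s₂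
    obtain ⟨C', hC0', hC'⟩ := gen_bdd hφ s₁ s₂
    have hCb : ∀ s ∈ Icc s₁ s₂, ∀ x ω, |gen φ s x (- b ω)| ≤ C' * (1 + d * B^2) := fun s hs x ω =>
      (hC' s hs _ _).trans (by have := hbs ω; gcongr)
    have hφm : ∀ s, Measurable (fun ω : Ω × Vd d => φ s (bmY (X ω.1) (b ω.1) s ω.2)) := fun s =>
      (tf_cont hφ).measurable.comp (measurable_const.prodMk (hbm.comp measurable_prodMk_left))
    have hgm : Measurable (fun p : ℝ × (Ω × Vd d) =>
        gen φ p.1 (bmY (X p.2.1) (b p.2.1) p.1 p.2.2) (- b p.2.1)) := by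
      have h1 : Measurable (fun p : ℝ × (Ω × Vd d) =>
        (p.1, (bmY (X p.2.1) (b p.2.1) p.1 p.2.2, - b p.2.1))) := by
        refine measurable_fst.prodMk (hbm.prodMk ?_)
        fun_prop
      exact (gen_cont hφ).measurable.comp h1
    have i1 : ∀ s ∈ Icc s₁ s₂, Integrable (fun ω : Ω × Vd d => φ s (bmY (X ω.1) (b ω.1) s ω.2))
        (ρ.prod (gam d)) := fun s hs => integrable_of_bdd (hφm s) fun ω => hC s hs _
    have i2 : ∀ s ∈ Icc s₁ s₂, Integrable (fun ω : Ω × Vd d =>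
        gen φ s (bmY (X ω.1) (b ω.1) s ω.2) (- b ω.1)) (ρ.prod (gam d)) := fun s hs =>
      integrable_of_bdd (hgm.comp measurable_prodMk_left) fun ω => hCb s hs _ _
    have m1 := left_mem_Icc.2 h12
    have m2 := right_mem_Icc.2 h12
    rw [integral_prod _ (i1 _ m2), integral_prod _ (i1 _ m1),
      ← integral_sub (i1 _ m2).integral_prod_left (i1 _ m1).integral_prod_left]
    have e3 : ∀ ω, (∫ ξ, φ s₂ (bmY (X ω) (b ω) s₂ ξ) ∂(gam d))
        - (∫ ξ, φ s₁ (bmY (X ω) (b ω) s₁ ξ) ∂(gam d))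
        = ∫ s in Ioc s₁ s₂, ∫ ξ, gen φ s (bmY (X ω) (b ω) s ξ) (- b ω) ∂(gam d) := fun ω => by
      rw [ito hφ _ _ h0 h12, intervalIntegral.integral_of_le h12]
    simp only [e3]
    rw [intervalIntegral.integral_of_le h12]
    have hsm : StronglyMeasurable (fun q : Ω × ℝ =>
        ∫ ξ, gen φ q.2 (bmY (X q.1) (b q.1) q.2 ξ) (- b q.1) ∂(gam d)) := by
      have : Measurable (fun p : (Ω × ℝ) × Vd d =>
          gen φ p.1.2 (bmY (X p.1.1) (b p.1.1) p.1.2 p.2) (- b p.1.1)) := by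
        have h2 : Measurable (fun p : (Ω × ℝ) × Vd d => (p.1.2, (p.1.1, p.2))) := by fun_prop
        exact hgm.comp h2
      exact this.stronglyMeasurable.integral_prod_right'
    have hint : Integrable (fun q : Ω × ℝ =>
        ∫ ξ, gen φ q.2 (bmY (X q.1) (b q.1) q.2 ξ) (- b q.1) ∂(gam d))
        (ρ.prod (volume.restrict (Ioc s₁ s₂))) := by
      refine Integrable.of_bound hsm.aestronglyMeasurable (C' * (1 + d * B^2)) ?_
      have hae : ∀ᵐ q ∂(ρ.prod (volume.restrict (Ioc s₁ s₂))), q.2 ∈ Ioc s₁ s₂ :=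
        Measure.quasiMeasurePreserving_snd.ae (ae_restrict_mem measurableSet_Ioc)
      filter_upwards [hae] with q hq
      have := norm_integral_le_of_norm_le_const (μ := gam d)
        (f := fun ξ => gen φ q.2 (bmY (X q.1) (b q.1) q.2 ξ) (- b q.1)) (Eventually.of_forall fun ξ =>
        hCb q.2 (Ioc_subset_Icc_self hq) (bmY (X q.1) (b q.1) q.2 ξ) q.1)
      simpa using this
    rw [integral_integral_swap hint]
    refine setIntegral_congr_fun measurableSet_Ioc fun s hs => ?_
    exact (integral_prod _ (i2 s (Ioc_subset_Icc_self hs))).symm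
  · simp only [Kernel.const_apply]
    calc _ ≤ ∫⁻ s in Ioc 0 T, ∫⁻ ω : Ω × Vd d, ENNReal.ofReal (d * B^2) ∂(ρ.prod (gam d)) := by
          gcongr
          exact hbs _
      _ < ⊤ := by
          simp only [lintegral_const, measure_univ, mul_one, Measure.restrict_apply_univ]
          exact ENNReal.mul_lt_top ENNReal.ofReal_lt_top measure_Ioc_lt_top
end Flow

/-! ### Heat flow, bounds on the value function, the first piece -/

lemma prT_add {d : ℕ} (x y : Vd d) : prT (x + y) = prT x + prT y := by
  funext i
  simp [prT]

def heat {d : ℕ} (μ : PTd d) (t : ℝ) : PTd d :=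
  flowM (μ : Measure (Td d)) (X := secT) (b := fun _ => 0) measurable_secT measurable_const t

lemma flowM_zero {d : ℕ} {Ω : Type*} [MeasurableSpace Ω] (ρ : Measure Ω) [IsProbabilityMeasure ρ]
    {X b : Ω → Vd d} (hX : Measurable X) (hb : Measurable b) :
    (flowM ρ hX hb 0 : Measure (Td d)) = ρ.map (fun ω => prT (X ω)) := by
  change (ρ.prod (gam d)).map (fun ω => flowY X b (0, ω)) = _
  have e : (fun ω : Ω × Vd d => flowY X b (0, ω)) = (fun ω => prT (X ω)) ∘ Prod.fst := by
    funext ω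
    simp [flowY, bmY]
  have hm : Measurable (fun ω => prT (X ω)) := measurable_prT.comp hX
  rw [e, ← Measure.map_map hm measurable_fst, Measure.map_fst_prod,
    measure_univ, one_smul]

lemma heat_zero {d : ℕ} (μ : PTd d) : heat μ 0 = μ := by
  apply Subtype.ext
  refine (flowM_zero _ _ _).trans ?_
  simp only [prT_secT]
  exact Measure.map_id

lemma runCost_lower {d : ℕ} (S : MFGSetting d) : ∃ c C : ℝ, 0 < c ∧ 0 ≤ C ∧
    ∀ (m : ℝ → PTd d) (α : ℝ → Td d → Vd d), Measurable (fun q : ℝ × Td d => α q.1 q.2) → ∀ s,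
      c * (∫ y, sqnorm (α s y) ∂(m s : Measure (Td d))) - C ≤ runCost S m α s := by
  obtain ⟨c, C, hc, hC, h1, -, -⟩ := Hstar_bounds S
  obtain ⟨CA, hCA, h2⟩ := Hstar_abs S
  obtain ⟨M, hM⟩ := S.Fc_bounded
  refine ⟨c, C + M, hc, add_nonneg hC ((abs_nonneg _).trans (hM (default : PTd d))), fun m α hα s => ?_⟩
  have hαs : Measurable (α s) := hα.comp measurable_prodMk_left
  have hF := (abs_le.1 (hM (m s))).1
  unfold runCost
  by_cases hi : Integrable (fun y => sqnorm (α s y)) (m s : Measure (Td d))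
  · have hH : Integrable (fun y => S.Hstar (secT y) (α s y)) (m s : Measure (Td d)) :=
      (((integrable_const (1:ℝ)).add hi).const_mul CA).mono'
        (((Hstar_sec_meas S).comp (measurable_id.prodMk hαs)).aestronglyMeasurable)
        (Eventually.of_forall fun y => h2 _ _)
    have := integral_mono ((hi.const_mul c).sub (integrable_const C)) hH fun y => h1 _ _
    simp only [Pi.sub_apply] at this
    rw [integral_sub (hi.const_mul c) (integrable_const C), integral_const_mul] at this
    simp at this
    linarith
  · rw [integral_undef hi]
    have : -C ≤ ∫ y, S.Hstar (secT y) (α s y) ∂(m s : Measure (Td d)) := by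
      by_cases hH : Integrable (fun y => S.Hstar (secT y) (α s y)) (m s : Measure (Td d))
      · have := integral_mono (integrable_const (-C)) hH fun y => by
          have := h1 (secT y) (α s y)
          have := mul_nonneg hc.le (sqnorm_nonneg (α s y))
          show -C ≤ _
          linarith
        simpa using this
      · rw [integral_undef hH]; linarith
    linarith

lemma exp_run_int {T δ : ℝ} {f : ℝ → ℝ} (hf : IntegrableOn f (Ioc 0 T)) :
    IntegrableOn (fun s => Real.exp (-δ * s) * f s) (Ioc 0 T) :=
  IntegrableOn.continuousOn_mul_of_subset (K := Icc 0 T) (Continuous.continuousOn (by fun_prop)) hf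
    isCompact_Icc measurableSet_Ioc Ioc_subset_Icc_self

lemma exp_Ioi {δ : ℝ} (hδ : 0 < δ) :
    IntegrableOn (fun s => Real.exp (-δ * s)) (Ioi 0) ∧ ∫ s in Ioi (0:ℝ), Real.exp (-δ * s) = 1 / δ := by
  refine ⟨integrableOn_exp_mul_Ioi (by linarith) 0, ?_⟩
  rw [integral_exp_mul_Ioi (by linarith)]
  simp

lemma heat_adm {d : ℕ} (S : MFGSetting d) : ∃ C, 0 ≤ C ∧ ∀ (δ : ℝ) (_ : 0 < δ) (μ : PTd d),
    AdmDisc S 1 δ μ (heat μ) (fun _ _ => 0) ∧ costDisc S δ (heat μ) (fun _ _ => 0) ≤ C / δ := by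
  obtain ⟨CA, hCA, h2⟩ := Hstar_abs S
  obtain ⟨M, hM⟩ := S.Fc_bounded
  have hM0 : 0 ≤ M := (abs_nonneg _).trans (hM (default : PTd d))
  refine ⟨CA + M, by positivity, fun δ hδ μ => ?_⟩
  have hm : W1ContOn (heat μ) (Ici 0) := by
    refine W1ContOn_of_modulus (fun s t => |s - t| * 0 + |√(2 * s) - √(2 * t)| * ∫ ξ, ‖ξ‖ ∂(gam d))
      ?_ (fun t => by simp) fun s _ t _ => flowM_W1 _ _ _ (fun _ => by simp) s t
    intro t _
    refine Continuous.continuousWithinAt ?_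
    fun_prop
  have hα : Measurable (fun q : ℝ × Td d => (fun (_ : ℝ) (_ : Td d) => (0 : Vd d)) q.1 q.2) :=
    measurable_const
  have s0 : sqnorm (0 : Vd d) = 0 := by simp [sqnorm]
  have hb : ∀ s, |runCost S (heat μ) (fun _ _ => 0) s| ≤ CA + M := by
    intro s
    refine (abs_add_le _ _).trans (add_le_add ?_ (hM _))
    have := norm_integral_le_of_norm_le_const (μ := (heat μ s : Measure (Td d)))
      (f := fun y => S.Hstar (secT y) 0) (C := CA) (Eventually.of_forall fun y => by
        have := h2 (secT y) 0
        rwa [s0, add_zero, mul_one] at this)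
    simpa using this
  have hae : AEStronglyMeasurable (runCost S (heat μ) (fun _ _ => 0)) (volume.restrict (Ioi 0)) := by
    have : Ioi (0:ℝ) = ⋃ n : ℕ, Ioc 0 (n:ℝ) := by
      ext s
      simp only [mem_Ioi, mem_iUnion, mem_Ioc]
      exact ⟨fun h => (exists_nat_ge s).imp fun n hn => ⟨h, hn⟩, fun ⟨n, h, _⟩ => h⟩
    rw [this, aestronglyMeasurable_iUnion_iff]
    intro n
    refine (run_int S (Nat.cast_nonneg n) (hm.mono Icc_subset_Ici_self) hα ?_).aestronglyMeasurable
    simp [s0]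
  obtain ⟨e1, e2⟩ := exp_Ioi hδ
  have hint : Integrable (fun s => Real.exp (-δ * s) * runCost S (heat μ) (fun _ _ => 0) s)
      (volume.restrict (Ioi 0)) := by
    refine (e1.mul_const (CA + M)).mono' (AEStronglyMeasurable.mul
      (Continuous.aestronglyMeasurable (by fun_prop)) hae) (Eventually.of_forall fun s => ?_)
    rw [norm_mul, Real.norm_eq_abs, Real.abs_exp]
    exact mul_le_mul_of_nonneg_left (hb s) (Real.exp_pos _).le
  refine ⟨⟨heat_zero μ, hm, ?_, hα, by simp [s0], hint⟩, ?_⟩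
  · intro s₁ s₂ h0 h12
    rw [FPeq_gen]
    intro φ hφ
    have hp := flow_piece (μ : Measure (Td d)) (X := secT) (b := fun _ => (0 : Vd d)) measurable_secT
      measurable_const (B := 0) (by simp) s₂
    have := hp.fp φ hφ s₁ s₂ h0 h12 le_rfl
    have hl : ∀ s, ∀ g : Td d → ℝ, Measurable g → ∫ y, g y ∂(heat μ s : Measure (Td d))
        = ∫ ω, g (flowY secT (fun _ => 0) (s, ω)) ∂((μ : Measure (Td d)).prod (gam d)) := by
      intro s g hg
      change ∫ y, g y ∂(((μ : Measure (Td d)).prod (gam d)).map _) = _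
      exact integral_map (hp.measY.comp measurable_prodMk_left).aemeasurable hg.aestronglyMeasurable
    have m1 : ∀ s, Measurable (fun y : Td d => φ s (secT y)) := fun s =>
      (tf_cont hφ).measurable.comp (measurable_const.prodMk measurable_secT)
    have m2 : ∀ s, Measurable (fun y : Td d => gen φ s (secT y) 0) := fun s =>
      (gen_cont hφ).measurable.comp (measurable_const.prodMk (measurable_secT.prodMk measurable_const))
    rw [hl _ _ (m1 s₁), hl _ _ (m1 s₂)]
    simp only [hl _ _ (m2 _)]
    simpa only [ProbabilityTheory.Kernel.const_apply, neg_zero] using this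
  · unfold costDisc
    calc _ ≤ ∫ s in Ioi (0:ℝ), Real.exp (-δ * s) * (CA + M) :=
          integral_mono hint (e1.mul_const _) fun s =>
            mul_le_mul_of_nonneg_left ((le_abs_self _).trans (hb s)) (Real.exp_pos _).le
      _ = _ := by rw [integral_mul_const, e2]; ring

lemma Vfun_bounds {d : ℕ} (S : MFGSetting d) : ∃ C, 0 ≤ C ∧ ∀ (δ : ℝ) (_ : 0 < δ),
    (∀ μ, |δ * Vfun S 1 δ μ| ≤ C) ∧
    (∀ μ m α, AdmDisc S 1 δ μ m α → Vfun S 1 δ μ ≤ costDisc S δ m α) ∧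
    (∀ μ, ∀ ε > 0, ∃ m α, AdmDisc S 1 δ μ m α ∧ costDisc S δ m α < Vfun S 1 δ μ + ε) := by
  obtain ⟨c, C1, hc, hC1, h1⟩ := runCost_lower S
  obtain ⟨C2, hC2, h2⟩ := heat_adm S
  refine ⟨max C1 C2, le_max_of_le_left hC1, fun δ hδ => ?_⟩
  obtain ⟨e1, e2⟩ := exp_Ioi hδ
  have hlow : ∀ μ m α, AdmDisc S 1 δ μ m α → -(C1 / δ) ≤ costDisc S δ m α := by
    intro μ m α h
    have hint := h.2.2.2.2.2
    unfold costDisc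
    calc -(C1 / δ) = ∫ s in Ioi (0:ℝ), Real.exp (-δ * s) * (-C1) := by
          rw [integral_mul_const, e2]; ring
      _ ≤ _ := integral_mono (e1.mul_const _) hint fun s => by
          refine mul_le_mul_of_nonneg_left ?_ (Real.exp_pos _).le
          have := h1 m α h.2.2.2.1 s
          have : 0 ≤ c * (∫ y, sqnorm (α s y) ∂(m s : Measure (Td d))) :=
            mul_nonneg hc.le (integral_nonneg fun y => sqnorm_nonneg _)
          linarith
  have hbdd : ∀ μ, BddBelow { r | ∃ m α, AdmDisc S 1 δ μ m α ∧ r = costDisc S δ m α } := by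
    intro μ
    refine ⟨-(C1 / δ), ?_⟩
    rintro r ⟨m, α, h, rfl⟩
    exact hlow μ m α h
  have hne : ∀ μ, { r | ∃ m α, AdmDisc S 1 δ μ m α ∧ r = costDisc S δ m α }.Nonempty := fun μ =>
    ⟨_, _, _, (h2 δ hδ μ).1, rfl⟩
  have hle : ∀ μ m α, AdmDisc S 1 δ μ m α → Vfun S 1 δ μ ≤ costDisc S δ m α := fun μ m α h =>
    csInf_le (hbdd μ) ⟨m, α, h, rfl⟩
  refine ⟨fun μ => ?_, hle, fun μ ε hε => ?_⟩
  · have a1 : -(C1 / δ) ≤ Vfun S 1 δ μ := by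
      refine le_csInf (hne μ) ?_
      rintro r ⟨m, α, h, rfl⟩
      exact hlow μ m α h
    have a2 := (hle _ _ _ (h2 δ hδ μ).1).trans (h2 δ hδ μ).2
    rw [← neg_div, div_le_iff₀ hδ] at a1
    rw [le_div_iff₀ hδ] at a2
    rw [abs_le]
    constructor
    · have := le_max_left C1 C2
      linarith
    · have := le_max_right C1 C2
      linarith
  · obtain ⟨r, ⟨m, α, h, rfl⟩, hr⟩ := exists_lt_of_csInf_lt (hne μ)
      (show Vfun S 1 δ μ < Vfun S 1 δ μ + ε by linarith)
    exact ⟨m, α, h, hr⟩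

lemma piece1 {d : ℕ} (S : MFGSetting d) : ∃ C, 0 ≤ C ∧ ∀ (δ : ℝ) (_ : 0 < δ) (τ : ℝ) (_ : 0 < τ)
    (μ₁ μ₀ : PTd d) (pc : Measure (Td d × Td d)) (_ : pc.map Prod.fst = μ₁) (_ : pc.map Prod.snd = μ₀),
    ∃ m α, AdmOn S 1 μ₁ τ m α ∧ m τ = heat μ₀ τ ∧
      ∫ s in Ioc 0 τ, Real.exp (-δ * s) * runCost S m α s
        ≤ C * (τ + (∫ p, dist p.1 p.2 ^ 2 ∂pc) / τ) := by
  obtain ⟨CA, hCA, h2⟩ := Hstar_abs S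
  obtain ⟨M, hM⟩ := S.Fc_bounded
  have hM0 : 0 ≤ M := (abs_nonneg _).trans (hM (default : PTd d))
  refine ⟨CA + M + CA * d, by positivity, fun δ hδ τ hτ μ₁ μ₀ pc h1 h0 => ?_⟩
  have hpc : IsProbabilityMeasure pc := by
    refine ⟨?_⟩
    have : (pc.map Prod.fst) univ = 1 := by rw [h1]; exact measure_univ
    rwa [Measure.map_apply measurable_fst MeasurableSet.univ, preimage_univ] at this
  have hX : Measurable (fun p : Td d × Td d => secT p.1) := measurable_secT.comp measurable_fst
  have hv : Measurable (fun p : Td d × Td d => vecT p.1 p.2) := measurable_vecT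
  have hb : Measurable (fun p : Td d × Td d => τ⁻¹ • vecT p.1 p.2) := hv.const_smul (τ⁻¹)
  have hbn : ∀ p : Td d × Td d, ‖τ⁻¹ • vecT p.1 p.2‖ ≤ τ⁻¹ * dist p.1 p.2 := by
    intro p
    rw [norm_smul, Real.norm_eq_abs, abs_of_pos (inv_pos.2 hτ)]
    exact mul_le_mul_of_nonneg_left (norm_vecT_le _ _) (inv_pos.2 hτ).le
  have hB : ∀ p : Td d × Td d, ‖τ⁻¹ • vecT p.1 p.2‖ ≤ τ⁻¹ := fun p => (hbn p).trans (by
    have : dist p.1 p.2 ≤ 1 := dist_Td_le _ _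
    have := inv_pos.2 hτ
    nlinarith)
  have hp := flow_piece pc hX hb hB τ
  have hst : flowM pc hX hb 0 = μ₁ := by
    apply Subtype.ext
    refine (flowM_zero _ _ _).trans ?_
    simp only [prT_secT]
    exact h1
  obtain ⟨α, hα, hcost⟩ := hp.adm S hτ.le
  rw [hst] at hα
  refine ⟨_, α, hα, ?_, ?_⟩
  · apply Subtype.ext
    change (pc.prod (gam d)).map _ = ((μ₀ : Measure (Td d)).prod (gam d)).map _
    have hq : (μ₀ : Measure (Td d)).prod (gam d) = (pc.prod (gam d)).map (Prod.map Prod.snd id) := by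
      rw [← Measure.map_prod_map _ _ measurable_snd measurable_id, h0, Measure.map_id]
    rw [hq, Measure.map_map]
    · congr 1
      funext ω
      simp only [flowY, bmY, Function.comp, Prod.map, id]
      rw [smul_smul, mul_inv_cancel₀ hτ.ne', one_smul, prT_add, prT_add_vecT, smul_zero, add_zero,
        prT_add, prT_secT]
    · exact (flowY_meas measurable_secT measurable_const).comp measurable_prodMk_left
    · exact measurable_snd.prodMap measurable_id
  · have hdm : Measurable (fun p : Td d × Td d => dist p.1 p.2 ^ 2) := by fun_prop
    have hdi : Integrable (fun p : Td d × Td d => dist p.1 p.2 ^ 2) pc :=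
      integrable_of_bdd hdm (M := 1) fun p => by
        rw [abs_of_nonneg (sq_nonneg _)]
        have : dist p.1 p.2 ≤ 1 := dist_Td_le _ _
        exact pow_le_one₀ dist_nonneg this
    set D := ∫ p, dist p.1 p.2 ^ 2 ∂pc with hD
    have hD0 : 0 ≤ D := integral_nonneg fun p => sq_nonneg _
    set R := CA + M + CA * d * (τ⁻¹^2 * D) with hR
    have hR0 : 0 ≤ R := by positivity
    have hrun : ∀ᵐ s ∂(volume.restrict (Ioc 0 τ)),
        Real.exp (-δ * s) * runCost S (flowM pc hX hb) α s ≤ R := by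
      filter_upwards [hcost, ae_restrict_mem measurableSet_Ioc] with s hs hsm
      have hsR : runCost S (flowM pc hX hb) α s ≤ R := by
        refine hs.trans ?_
        have hF := (abs_le.1 (hM (flowM pc hX hb s))).2
        rw [ProbabilityTheory.Kernel.const_apply]
        have hdom : Integrable (fun ω : (Td d × Td d) × Vd d =>
            CA * (1 + d * (τ⁻¹ * dist ω.1.1 ω.1.2) ^2)) (pc.prod (gam d)) := by
          refine integrable_of_bdd (by fun_prop) (M := CA * (1 + d * (τ⁻¹)^2)) fun ω => ?_
          rw [abs_of_nonneg (by positivity)]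
          have : dist ω.1.1 ω.1.2 ≤ 1 := dist_Td_le _ _
          have h3 : τ⁻¹ * dist ω.1.1 ω.1.2 ≤ τ⁻¹ := by
            have := inv_pos.2 hτ
            nlinarith
          have h4 : 0 ≤ τ⁻¹ * dist ω.1.1 ω.1.2 := by positivity
          gcongr
        have hpt : ∀ ω : (Td d × Td d) × Vd d,
            |S.Hstar (secT (flowY (fun p : Td d × Td d => secT p.1) (fun p => τ⁻¹ • vecT p.1 p.2) (s, ω)))
              (-(τ⁻¹ • vecT ω.1.1 ω.1.2))| ≤ CA * (1 + d * (τ⁻¹ * dist ω.1.1 ω.1.2) ^2) := by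
          intro ω
          refine (h2 _ _).trans ?_
          have h5 := sqnorm_le (-(τ⁻¹ • vecT ω.1.1 ω.1.2))
          rw [norm_neg] at h5
          have h6 := hbn ω.1
          have : (‖τ⁻¹ • vecT ω.1.1 ω.1.2‖)^2 ≤ (τ⁻¹ * dist ω.1.1 ω.1.2)^2 := by gcongr
          have : sqnorm (-(τ⁻¹ • vecT ω.1.1 ω.1.2)) ≤ d * (τ⁻¹ * dist ω.1.1 ω.1.2)^2 :=
            h5.trans (by gcongr)
          gcongr
        have hH : ∫ ω : (Td d × Td d) × Vd d,
            S.Hstar (secT (flowY (fun p : Td d × Td d => secT p.1) (fun p => τ⁻¹ • vecT p.1 p.2) (s, ω)))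
              (-(τ⁻¹ • vecT ω.1.1 ω.1.2)) ∂(pc.prod (gam d)) ≤ CA + CA * d * (τ⁻¹^2 * D) := by
          refine ((Real.le_norm_self _).trans (norm_integral_le_of_norm_le hdom
            (Eventually.of_forall hpt))).trans (le_of_eq ?_)
          have := integral_prod_mul (μ := pc) (ν := gam d)
            (fun p => CA * (1 + d * (τ⁻¹ * dist p.1 p.2) ^2)) (fun _ => (1:ℝ))
          simp only [mul_one, integral_const, smul_eq_mul, probReal_univ] at this
          rw [this]
          have e : ∀ p : Td d × Td d, CA * (1 + d * (τ⁻¹ * dist p.1 p.2) ^2)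
              = CA + CA * d * τ⁻¹^2 * dist p.1 p.2 ^2 := fun p => by ring
          simp only [e]
          rw [integral_add (integrable_const _) (hdi.const_mul _), integral_const_mul]
          simp only [integral_const, smul_eq_mul, probReal_univ]
          rw [← hD]
          ring
        rw [hR]
        linarith
      have he : Real.exp (-δ * s) ≤ 1 := Real.exp_le_one_iff.2 (by nlinarith [hsm.1])
      have he0 := Real.exp_pos (-δ * s)
      calc _ ≤ Real.exp (-δ * s) * R := mul_le_mul_of_nonneg_left hsR he0.le
        _ ≤ 1 * R := mul_le_mul_of_nonneg_right he hR0
        _ = R := one_mul _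
    have hi : IntegrableOn (runCost S (flowM pc hX hb) α) (Ioc 0 τ) :=
      (intervalIntegrable_iff_integrableOn_Ioc_of_le hτ.le).1 hα.2.2.2.2.2
    calc _ ≤ ∫ s in Ioc 0 τ, R := integral_mono_ae (exp_run_int hi) (integrable_const _) hrun
      _ = τ * R := by simp [hτ.le]
      _ = (CA + M) * τ + CA * d * (D / τ) := by rw [hR]; field_simp
      _ ≤ _ := by
        have : 0 ≤ D / τ := by positivity
        have : 0 ≤ (CA * d) * τ := by positivity
        have : 0 ≤ (CA + M) * (D / τ) := by positivity
        nlinarith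

/-! ### The second piece: transported noise -/

lemma tf_trans {d : ℕ} {φ : ℝ → Vd d → ℝ} (hφ : IsTestFun φ) (ζ : Vd d) :
    IsTestFun (fun s x => φ s (x + (1 - s) • ζ)) := by
  refine ⟨?_, fun t x z => ?_⟩
  · exact hφ.1.comp (contDiff_fst.prodMk (contDiff_snd.add
      ((contDiff_const.sub contDiff_fst).smul contDiff_const)))
  · have : x + intVec z + (1 - t) • ζ = x + (1 - t) • ζ + intVec z := by abel
    simp only [this]
    exact hφ.2 _ _ _

lemma dotp_neg_left {d : ℕ} (a b : Vd d) : dotp (-a) b = - dotp a b := by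
  simp [dotp]

lemma dotp_add_left {d : ℕ} (a b c : Vd d) : dotp (a + b) c = dotp a c + dotp b c := by
  simp [dotp, add_mul, Finset.sum_add_distrib]

lemma gen_trans {d : ℕ} {φ : ℝ → Vd d → ℝ} (hφ : IsTestFun φ) (ζ : Vd d) (s : ℝ) (x q : Vd d) :
    gen (fun s x => φ s (x + (1 - s) • ζ)) s x q = gen φ s (x + (1 - s) • ζ) (q + ζ) := by
  have h1 : tderiv (fun s x => φ s (x + (1 - s) • ζ)) s x
      = tderiv φ s (x + (1 - s) • ζ) - dotp ζ (gradv (φ s) (x + (1 - s) • ζ)) := by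
    have hd : HasFDerivAt (fun q : ℝ × Vd d => φ q.1 q.2) _ (s, x + (1 - s) • ζ) :=
      (hφ.1.differentiable (by norm_num) _).hasFDerivAt
    have hl : HasDerivAt (fun s : ℝ => (s, x + (1 - s) • ζ)) ((1:ℝ), -ζ) s := by
      have : HasDerivAt (fun s : ℝ => x + (1 - s) • ζ) ((-1:ℝ) • ζ) s :=
        ((((hasDerivAt_id s).const_sub 1)).smul_const ζ).const_add x
      rw [neg_one_smul] at this
      exact (hasDerivAt_id s).prodMk this
    have := (hd.comp_hasDerivAt s hl).deriv
    rw [tf_dir hφ, dotp_neg_left] at this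
    exact this
  have h2 : ∀ v y, fderiv ℝ (fun x => φ s (x + (1 - s) • ζ)) y v
      = fderiv ℝ (φ s) (y + (1 - s) • ζ) v := fun v y => by rw [fderiv_comp_add_right]
  have h3 : gradv (fun x => φ s (x + (1 - s) • ζ)) x = gradv (φ s) (x + (1 - s) • ζ) := by
    funext i
    exact h2 _ _
  have h4 : lapl (fun x => φ s (x + (1 - s) • ζ)) x = lapl (φ s) (x + (1 - s) • ζ) := by
    unfold lapl D2
    refine Finset.sum_congr rfl fun i _ => ?_
    simp only [h2]
    rw [fderiv_comp_add_right (f := fun y => fderiv ℝ (φ s) y (Pi.single i 1))]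
  unfold gen
  rw [h1, h3, h4, dotp_add_left]
  ring

lemma sqnorm_smul {d : ℕ} (r : ℝ) (v : Vd d) : sqnorm (r • v) = r^2 * sqnorm v := by
  simp [sqnorm, mul_pow, Finset.mul_sum]

lemma sq_noise {d : ℕ} {r : ℝ} (hr2 : r^2 ≤ 2) (q ξ : Vd d) :
    sqnorm (q + r • ξ) ≤ 4 * (1 + sqnorm q) * (1 + sqnorm ξ)^2 := by
  have h := sqnorm_add_le q (r • ξ)
  rw [sqnorm_smul] at h
  have h1 := sqnorm_nonneg q
  have h2 := sqnorm_nonneg ξ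
  have h3 : r^2 * sqnorm ξ ≤ 2 * sqnorm ξ := mul_le_mul_of_nonneg_right hr2 h2
  nlinarith [mul_nonneg h1 h2, mul_nonneg h1 (mul_nonneg h2 h2), mul_nonneg h2 h2]

section Noise
open ProbabilityTheory
variable {d : ℕ}

def nzY (r : ℝ) (p : ℝ × (Td d × Vd d)) : Td d := prT (secT p.2.1 + (1 - p.1) • (r • p.2.2))

def nzA (α : ℝ → Td d → Vd d) (r : ℝ) (p : ℝ × (Td d × Vd d)) : Vd d := α p.1 p.2.1 + r • p.2.2

def nzK (κ : Kernel ℝ (Td d)) : Kernel ℝ (Td d × Vd d) := κ ×ₖ Kernel.const ℝ (gam d)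

instance nzK_markov (κ : Kernel ℝ (Td d)) [IsMarkovKernel κ] : IsMarkovKernel (nzK κ) := by
  unfold nzK; infer_instance

lemma nzK_apply (κ : Kernel ℝ (Td d)) [IsMarkovKernel κ] (s : ℝ) :
    nzK κ s = (κ s).prod (gam d) := by
  unfold nzK
  rw [Kernel.prod_apply, Kernel.const_apply]

lemma nzP_meas (r : ℝ) : Measurable (fun p : ℝ × (Td d × Vd d) =>
    secT p.2.1 + (1 - p.1) • (r • p.2.2)) := by
  have h : Measurable (fun p : ℝ × (Td d × Vd d) => secT p.2.1) :=
    measurable_secT.comp (measurable_fst.comp measurable_snd)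
  fun_prop

lemma nzY_meas (r : ℝ) : Measurable (nzY (d := d) r) := measurable_prT.comp (nzP_meas r)

lemma nzA_meas {α : ℝ → Td d → Vd d} (hα : Measurable (fun q : ℝ × Td d => α q.1 q.2)) (r : ℝ) :
    Measurable (nzA α r) := by
  have h : Measurable (fun p : ℝ × (Td d × Vd d) => α p.1 p.2.1) :=
    hα.comp (measurable_fst.prodMk (measurable_fst.comp measurable_snd))
  unfold nzA
  fun_prop

def nzM (κ : Kernel ℝ (Td d)) [IsMarkovKernel κ] (r t : ℝ) : PTd d :=
  ⟨(nzK κ t).map (fun ω => nzY r (t, ω)),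
    Measure.isProbabilityMeasure_map ((nzY_meas r).comp measurable_prodMk_left).aemeasurable⟩

lemma nz_W1 (κ : Kernel ℝ (Td d)) [IsMarkovKernel κ] {m : ℝ → PTd d}
    (hκ : ∀ s ∈ Icc (0:ℝ) 1, κ s = (m s : Measure (Td d))) {r : ℝ} (hr : 0 ≤ r) {s t : ℝ}
    (hs : s ∈ Icc (0:ℝ) 1) (ht : t ∈ Icc (0:ℝ) 1) :
    W1 (nzM κ r s) (nzM κ r t) ≤ W1 (m s) (m t) + |s - t| * (r * ∫ ξ, ‖ξ‖ ∂(gam d)) := by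
  refine W1_le fun φ hφ => ?_
  have hm : Measurable φ := hφ.continuous.measurable
  obtain ⟨M, hM⟩ := lip_bdd hφ
  have hYt : ∀ t, Measurable (fun ω : Td d × Vd d => nzY r (t, ω)) := fun t =>
    (nzY_meas r).comp measurable_prodMk_left
  have eM : ∀ t ∈ Icc (0:ℝ) 1, ∫ y, φ y ∂(nzM κ r t : Measure (Td d))
      = ∫ ω, φ (nzY r (t, ω)) ∂((m t : Measure (Td d)).prod (gam d)) := fun t ht => by
    rw [← hκ t ht, ← nzK_apply]
    exact integral_map (hYt t).aemeasurable hm.aestronglyMeasurable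
  have hi : ∀ a t, Integrable (fun ω => φ (nzY r (a, ω))) ((m t : Measure (Td d)).prod (gam d)) :=
    fun a t => integrable_of_bdd (hm.comp (hYt a)) fun ω => hM _
  rw [eM s hs, eM t ht]
  have h1 : ∫ ω, φ (nzY r (s, ω)) ∂((m s : Measure (Td d)).prod (gam d))
      - ∫ ω, φ (nzY r (s, ω)) ∂((m t : Measure (Td d)).prod (gam d)) ≤ W1 (m s) (m t) := by
    rw [integral_prod_symm _ (hi s s), integral_prod_symm _ (hi s t),
      ← integral_sub (hi s s).integral_prod_right (hi s t).integral_prod_right]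
    have : ∀ ξ, (∫ y, φ (nzY r (s, (y, ξ))) ∂(m s : Measure (Td d)))
        - ∫ y, φ (nzY r (s, (y, ξ))) ∂(m t : Measure (Td d)) ≤ W1 (m s) (m t) := fun ξ => by
      have hl : LipschitzWith 1 (fun y => φ (nzY r (s, (y, ξ)))) := by
        refine LipschitzWith.of_dist_le_mul fun a b => ?_
        refine (hφ.dist_le_mul _ _).trans (le_of_eq ?_)
        simp only [nzY, prT_add, prT_secT, dist_add_right]
      exact (le_abs_self _).trans (le_W1 _ _ hl)
    have h2 := integral_mono (μ := gam d)
      ((hi s s).integral_prod_right.sub (hi s t).integral_prod_right)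
      (integrable_const (W1 (m s) (m t))) this
    simpa using h2
  have h2 : ∫ ω, φ (nzY r (s, ω)) ∂((m t : Measure (Td d)).prod (gam d))
      - ∫ ω, φ (nzY r (t, ω)) ∂((m t : Measure (Td d)).prod (gam d))
      ≤ |s - t| * (r * ∫ ξ, ‖ξ‖ ∂(gam d)) := by
    rw [← integral_sub (hi s t) (hi t t)]
    have hn : Integrable (fun ω : Td d × Vd d => |s - t| * (r * ‖ω.2‖))
        ((m t : Measure (Td d)).prod (gam d)) := by
      have := (integrable_const (1:ℝ) (μ := (m t : Measure (Td d)))).mul_prod (gam_norm_int d)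
      simp only [one_mul] at this
      exact (this.const_mul r).const_mul _
    refine (integral_mono ((hi s t).sub (hi t t)) hn fun ω => ?_).trans (le_of_eq ?_)
    · have := hφ.dist_le_mul (nzY r (s, ω)) (nzY r (t, ω))
      rw [Real.dist_eq] at this
      simp only [NNReal.coe_one, one_mul] at this
      refine (le_abs_self _).trans (this.trans ((dist_prT_le _ _).trans (le_of_eq ?_)))
      have e : secT ω.1 + (1 - s) • r • ω.2 - (secT ω.1 + (1 - t) • r • ω.2)
          = (t - s) • r • ω.2 := by module
      simp only [e, norm_smul, Real.norm_eq_abs]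
      rw [abs_sub_comm, abs_of_nonneg hr]
    · rw [integral_const_mul, integral_const_mul]
      have := integral_prod_mul (μ := (m t : Measure (Td d))) (ν := gam d) (fun _ => (1:ℝ)) (fun ξ => ‖ξ‖)
      simp only [one_mul, integral_const, smul_eq_mul, probReal_univ] at this
      rw [this]
  linarith

lemma nz_cont (κ : Kernel ℝ (Td d)) [IsMarkovKernel κ] {m : ℝ → PTd d}
    (hκ : ∀ s ∈ Icc (0:ℝ) 1, κ s = (m s : Measure (Td d))) {r : ℝ} (hr : 0 ≤ r)
    (hm : W1ContOn m (Icc 0 1)) : W1ContOn (nzM κ r) (Icc 0 1) := by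
  intro t ht ε hε
  obtain ⟨η, hη, H⟩ := hm t ht (ε/2) (by positivity)
  set Q := r * ∫ ξ, ‖ξ‖ ∂(gam d) with hQ
  have hQ0 : 0 ≤ Q := mul_nonneg hr (integral_nonneg fun _ => norm_nonneg _)
  refine ⟨min η (ε / (2 * (Q + 1))), by positivity, fun s hs hst => ?_⟩
  have h1 := H s hs (hst.trans_le (min_le_left _ _))
  have h2 := hst.trans_le (min_le_right _ _)
  have h3 := nz_W1 κ hκ hr hs ht
  rw [← hQ] at h3
  rw [lt_div_iff₀ (by positivity)] at h2
  nlinarith [abs_nonneg (s - t)]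

variable {m : ℝ → PTd d} {α : ℝ → Td d → Vd d}

lemma nz_e0 (hα : Measurable (fun q : ℝ × Td d => α q.1 q.2))
    (κ : Kernel ℝ (Td d)) [IsMarkovKernel κ]
    (hE : ∫⁻ s in Ioc (0:ℝ) 1, ∫⁻ y, ENNReal.ofReal (sqnorm (α s y)) ∂(κ s) < ⊤) :
    ∫⁻ s in Ioc (0:ℝ) 1, ∫⁻ y, ENNReal.ofReal (4 * (1 + sqnorm (α s y))) ∂(κ s) < ⊤ := by
  have hms : Measurable (fun p : ℝ × Td d => ENNReal.ofReal (sqnorm (α p.1 p.2))) :=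
    (sqnorm_meas.comp hα).ennreal_ofReal
  have e : ∀ s, ∫⁻ y, ENNReal.ofReal (4 * (1 + sqnorm (α s y))) ∂(κ s)
      = ENNReal.ofReal 4 * (1 + ∫⁻ y, ENNReal.ofReal (sqnorm (α s y)) ∂(κ s)) := fun s => by
    simp_rw [ENNReal.ofReal_mul (show (0:ℝ) ≤ 4 by norm_num),
      ENNReal.ofReal_add zero_le_one (sqnorm_nonneg _)]
    rw [lintegral_const_mul' _ _ ENNReal.ofReal_ne_top, lintegral_add_left measurable_const]
    simp
  simp_rw [e]
  rw [lintegral_const_mul' _ _ ENNReal.ofReal_ne_top, lintegral_add_left measurable_const]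
  refine ENNReal.mul_lt_top ENNReal.ofReal_lt_top (ENNReal.add_lt_top.2 ⟨by simp, hE⟩)

lemma gam_mom_lt : ∫⁻ ξ, ENNReal.ofReal ((1 + sqnorm ξ)^2) ∂(gam d) < ⊤ := by
  have := (gam_moment d).lintegral_lt_top
  exact this

lemma nz_energy (hα : Measurable (fun q : ℝ × Td d => α q.1 q.2)) {r : ℝ} (hr2 : r^2 ≤ 2)
    (κ : Kernel ℝ (Td d)) [IsMarkovKernel κ]
    (hE : ∫⁻ s in Ioc (0:ℝ) 1, ∫⁻ y, ENNReal.ofReal (sqnorm (α s y)) ∂(κ s) < ⊤) :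
    ∫⁻ s in Ioc (0:ℝ) 1, ∫⁻ ω, ENNReal.ofReal (sqnorm (nzA α r (s, ω))) ∂(nzK κ s) < ⊤ := by
  have h1 : ∀ s, ∫⁻ ω, ENNReal.ofReal (sqnorm (nzA α r (s, ω))) ∂(nzK κ s)
      ≤ (∫⁻ y, ENNReal.ofReal (4 * (1 + sqnorm (α s y))) ∂(κ s))
        * ∫⁻ ξ, ENNReal.ofReal ((1 + sqnorm ξ)^2) ∂(gam d) := fun s => by
    have hαs : Measurable (α s) := hα.comp measurable_prodMk_left
    rw [nzK_apply, ← lintegral_prod_mul]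
    · refine lintegral_mono fun ω => ?_
      rw [← ENNReal.ofReal_mul (by have := sqnorm_nonneg (α s ω.1); positivity)]
      exact ENNReal.ofReal_le_ofReal (sq_noise hr2 _ _)
    · have : Measurable (fun y => sqnorm (α s y)) := sqnorm_meas.comp hαs
      exact ((this.const_add 1).const_mul 4).ennreal_ofReal.aemeasurable
    · have : Measurable (fun y : Vd d => sqnorm y) := sqnorm_meas
      fun_prop
  refine (lintegral_mono h1).trans_lt ?_
  rw [lintegral_mul_const' _ _ gam_mom_lt.ne]
  exact ENNReal.mul_lt_top (nz_e0 hα κ hE) gam_mom_lt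

set_option maxHeartbeats 1000000 in
lemma nz_fp (hα : Measurable (fun q : ℝ × Td d => α q.1 q.2)) {r : ℝ} (hr2 : r^2 ≤ 2)
    (κ : Kernel ℝ (Td d)) [IsMarkovKernel κ]
    (hκ : ∀ s ∈ Icc (0:ℝ) 1, κ s = (m s : Measure (Td d)))
    (hE : ∫⁻ s in Ioc (0:ℝ) 1, ∫⁻ y, ENNReal.ofReal (sqnorm (α s y)) ∂(κ s) < ⊤)
    {s₁ s₂ : ℝ} (h0 : 0 ≤ s₁) (h12 : s₁ ≤ s₂) (h2 : s₂ ≤ 1) (hfp : FPeq 1 m α s₁ s₂)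
    {φ : ℝ → Vd d → ℝ} (hφ : IsTestFun φ) :
    (∫ ω, φ s₂ (secT (nzY r (s₂, ω))) ∂(nzK κ s₂)) - (∫ ω, φ s₁ (secT (nzY r (s₁, ω))) ∂(nzK κ s₁)) =
      ∫ s in s₁..s₂, ∫ ω, gen φ s (secT (nzY r (s, ω))) (nzA α r (s, ω)) ∂(nzK κ s) := by
  have e1 : ∀ s ω, φ s (secT (nzY r (s, ω))) = φ s (secT ω.1 + (1 - s) • (r • ω.2)) := fun s ω =>
    IsPer.sec (fun x z => hφ.2 s x z) _
  have e2 : ∀ s ω, gen φ s (secT (nzY r (s, ω))) (nzA α r (s, ω))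
      = gen φ s (secT ω.1 + (1 - s) • (r • ω.2)) (α s ω.1 + r • ω.2) := fun s ω =>
    (gen_per hφ s (nzA α r (s, ω))).sec _
  simp only [e1, e2]
  obtain ⟨C, hC0, hC⟩ := tf_bdd hφ s₁ s₂
  obtain ⟨C', hC0', hC'⟩ := gen_bdd hφ s₁ s₂
  have hIc : ∀ s ∈ Icc s₁ s₂, s ∈ Icc (0:ℝ) 1 := fun s hs => ⟨h0.trans hs.1, hs.2.trans h2⟩
  have hsub : Ioc s₁ s₂ ⊆ Ioc (0:ℝ) 1 := fun s hs => ⟨h0.trans_lt hs.1, hs.2.trans h2⟩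
  have hφm : ∀ s, Measurable (fun ω : Td d × Vd d => φ s (secT ω.1 + (1 - s) • (r • ω.2))) := fun s =>
    (tf_cont hφ).measurable.comp (measurable_const.prodMk ((nzP_meas r).comp measurable_prodMk_left))
  have hgm : Measurable (fun p : ℝ × (Td d × Vd d) =>
      gen φ p.1 (secT p.2.1 + (1 - p.1) • (r • p.2.2)) (α p.1 p.2.1 + r • p.2.2)) :=
    (gen_cont hφ).measurable.comp (measurable_fst.prodMk ((nzP_meas r).prodMk (nzA_meas hα r)))
  have hEn : ∫⁻ s in Ioc s₁ s₂, ∫⁻ ω, ENNReal.ofReal (sqnorm (nzA α r (s, ω))) ∂(nzK κ s) < ⊤ :=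
    (lintegral_mono_set hsub).trans_lt (nz_energy hα hr2 κ hE)
  have i1 : ∀ s ∈ Icc s₁ s₂, Integrable (fun ω : Td d × Vd d => φ s (secT ω.1 + (1 - s) • (r • ω.2)))
      ((m s : Measure (Td d)).prod (gam d)) := fun s hs => integrable_of_bdd (hφm s) fun ω => hC s hs _
  have i2 := (kint (volume.restrict (Ioc s₁ s₂)) (nzK κ) (nzA_meas hα r) hEn hgm (C := C')
    ((ae_restrict_mem measurableSet_Ioc).mono fun s hs ω => hC' s (Ioc_subset_Icc_self hs) _ _)).1
  have m1 := left_mem_Icc.2 h12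
  have m2 := right_mem_Icc.2 h12
  rw [nzK_apply, nzK_apply, hκ _ (hIc _ m1), hκ _ (hIc _ m2), integral_prod_symm _ (i1 _ m2),
    integral_prod_symm _ (i1 _ m1),
    ← integral_sub (i1 _ m2).integral_prod_right (i1 _ m1).integral_prod_right]
  have e3 : ∀ ξ : Vd d, (∫ y, φ s₂ (secT y + (1 - s₂) • (r • ξ)) ∂(m s₂ : Measure (Td d)))
      - (∫ y, φ s₁ (secT y + (1 - s₁) • (r • ξ)) ∂(m s₁ : Measure (Td d)))
      = ∫ s in Ioc s₁ s₂, ∫ y, gen φ s (secT y + (1 - s) • (r • ξ)) (α s y + r • ξ) ∂(κ s) := fun ξ => by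
    have := (FPeq_gen.1 hfp) _ (tf_trans hφ (r • ξ))
    simp only [gen_trans hφ] at this
    rw [this, intervalIntegral.integral_of_le h12]
    refine setIntegral_congr_fun measurableSet_Ioc fun s hs => ?_
    simp only [hκ s (hIc s (Ioc_subset_Icc_self hs))]
  simp only [e3]
  rw [intervalIntegral.integral_of_le h12]
  have hA' : Measurable (fun p : (Vd d × ℝ) × Td d => α p.1.2 p.2 + r • p.1.1) := by
    have h1 : Measurable (fun p : (Vd d × ℝ) × Td d => α p.1.2 p.2) :=
      hα.comp ((measurable_snd.comp measurable_fst).prodMk measurable_snd)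
    fun_prop
  have hf' : Measurable (fun p : (Vd d × ℝ) × Td d =>
      gen φ p.1.2 (secT p.2 + (1 - p.1.2) • (r • p.1.1)) (α p.1.2 p.2 + r • p.1.1)) := by
    have h1 : Measurable (fun p : (Vd d × ℝ) × Td d => (p.1.2, (p.2, p.1.1))) := by fun_prop
    exact hgm.comp h1
  have hEs : ∫⁻ s in Ioc s₁ s₂, ∫⁻ y, ENNReal.ofReal (4 * (1 + sqnorm (α s y))) ∂(κ s) < ⊤ :=
    (lintegral_mono_set hsub).trans_lt (nz_e0 hα κ hE)
  let κ2 : Kernel (Vd d × ℝ) (Td d) := κ.comap Prod.snd measurable_snd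
  have hκ2 : ∀ q, κ2 q = κ q.2 := fun q => Kernel.comap_apply _ _ _
  have : IsMarkovKernel κ2 := Kernel.IsMarkovKernel.comap _ _
  have hE' : ∫⁻ q : Vd d × ℝ, ∫⁻ y, ENNReal.ofReal (sqnorm (α q.2 y + r • q.1))
      ∂(κ2 q) ∂((gam d).prod (volume.restrict (Ioc s₁ s₂))) < ⊤ := by
    have hb : ∀ q : Vd d × ℝ, ∫⁻ y, ENNReal.ofReal (sqnorm (α q.2 y + r • q.1))
        ∂(κ2 q) ≤ ENNReal.ofReal ((1 + sqnorm q.1)^2)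
          * ∫⁻ y, ENNReal.ofReal (4 * (1 + sqnorm (α q.2 y))) ∂(κ q.2) := fun q => by
      rw [hκ2, ← lintegral_const_mul' _ _ ENNReal.ofReal_ne_top]
      refine lintegral_mono fun y => ?_
      rw [← ENNReal.ofReal_mul (by positivity), mul_comm]
      exact ENNReal.ofReal_le_ofReal (sq_noise hr2 _ _)
    refine (lintegral_mono hb).trans_lt ?_
    rw [lintegral_prod_mul (f := fun ξ : Vd d => ENNReal.ofReal ((1 + sqnorm ξ)^2))
      (g := fun s => ∫⁻ y, ENNReal.ofReal (4 * (1 + sqnorm (α s y))) ∂(κ s))]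
    · exact ENNReal.mul_lt_top gam_mom_lt hEs
    · have : Measurable (fun y : Vd d => sqnorm y) := sqnorm_meas
      fun_prop
    · have : Measurable (fun p : ℝ × Td d => ENNReal.ofReal (4 * (1 + sqnorm (α p.1 p.2)))) := by
        have : Measurable (fun p : ℝ × Td d => sqnorm (α p.1 p.2)) := sqnorm_meas.comp hα
        fun_prop
      exact (this.lintegral_kernel_prod_right' (κ := κ)).aemeasurable
  have hae : ∀ᵐ q ∂((gam d).prod (volume.restrict (Ioc s₁ s₂))), q.2 ∈ Ioc s₁ s₂ :=
    Measure.quasiMeasurePreserving_snd.ae (ae_restrict_mem measurableSet_Ioc)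
  have hint := (kint ((gam d).prod (volume.restrict (Ioc s₁ s₂))) κ2
    hA' hE' hf' (C := C') (hae.mono fun q hq y => hC' q.2 (Ioc_subset_Icc_self hq) _ _)).2
  rw [integral_integral_swap (f := fun ξ s =>
    ∫ y, gen φ s (secT y + (1 - s) • (r • ξ)) (α s y + r • ξ) ∂(κ s)) hint]
  refine integral_congr_ae ?_
  filter_upwards [i2] with s hs
  rw [nzK_apply] at hs ⊢
  exact (integral_prod_symm _ hs).symm

lemma nz_piece (hα : Measurable (fun q : ℝ × Td d => α q.1 q.2)) {r : ℝ} (hr : 0 ≤ r) (hr2 : r^2 ≤ 2)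
    (κ : Kernel ℝ (Td d)) [IsMarkovKernel κ]
    (hκ : ∀ s ∈ Icc (0:ℝ) 1, κ s = (m s : Measure (Td d))) (hm : W1ContOn m (Icc 0 1))
    (hE : ∫⁻ s in Ioc (0:ℝ) 1, ∫⁻ y, ENNReal.ofReal (sqnorm (α s y)) ∂(κ s) < ⊤)
    (hfp : ∀ s₁ s₂ : ℝ, 0 ≤ s₁ → s₁ ≤ s₂ → s₂ ≤ 1 → FPeq 1 m α s₁ s₂) :
    RelPiece 1 (nzK κ) (nzY r) (nzA α r) (nzM κ r) :=
  ⟨nzY_meas r, nzA_meas hα r, fun _ => rfl, nz_cont κ hκ hr hm,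
    fun φ hφ s₁ s₂ h0 h12 h2 => nz_fp hα hr2 κ hκ hE h0 h12 h2 (hfp s₁ s₂ h0 h12 h2) hφ,
    nz_energy hα hr2 κ hE⟩
end Noise

open ProbabilityTheory in
set_option maxHeartbeats 1000000 in
lemma piece2 {d : ℕ} (S : MFGSetting d) : ∃ C, 0 ≤ C ∧ ∀ (δ : ℝ) (_ : 0 < δ) (τ : ℝ) (_ : 0 < τ) (_ : τ ≤ 1)
    (μ₀ : PTd d) (m : ℝ → PTd d) (α : ℝ → Td d → Vd d), AdmOn S 1 μ₀ 1 m α →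
    ∃ m' α', AdmOn S 1 (heat μ₀ τ) 1 m' α' ∧ m' 1 = m 1 ∧
      ∫ s in Ioc (0:ℝ) 1, Real.exp (-δ * s) * runCost S m' α' s
        ≤ (∫ s in Ioc (0:ℝ) 1, Real.exp (-δ * s) * runCost S m α s)
          + C * √τ * (1 + ∫ s in Ioc (0:ℝ) 1, ∫ y, sqnorm (α s y) ∂(m s : Measure (Td d))) := by
  obtain ⟨CA, hCA, hHa⟩ := Hstar_abs S
  obtain ⟨-, CH, -, hCH, -, -, hH⟩ := Hstar_bounds S
  set M2 := ∫ ξ, (1 + sqnorm ξ)^2 ∂(gam d) with hM2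
  set M1 := ∫ ξ, ‖ξ‖ ∂(gam d) with hM1
  have hM20 : 0 ≤ M2 := integral_nonneg fun _ => sq_nonneg _
  have hM10 : 0 ≤ M1 := integral_nonneg fun _ => norm_nonneg _
  have hLF := LF_nonneg S
  refine ⟨2 * (4 * CH * M2 + LF S * M1), by positivity, fun δ hδ τ hτ hτ1 μ₀ m α hadm => ?_⟩
  obtain ⟨hm0, hm, hfp, hα, hE, hrun⟩ := hadm
  set r := √(2 * τ) with hr
  have hr0 : 0 ≤ r := Real.sqrt_nonneg _
  have hr2 : r^2 ≤ 2 := by rw [hr, Real.sq_sqrt (by positivity)]; linarith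
  have hrτ : r ≤ 2 * √τ := by
    rw [hr, Real.sqrt_mul (by norm_num)]
    have : √2 ≤ 2 := Real.sqrt_le_iff.2 (by norm_num)
    exact mul_le_mul_of_nonneg_right this (Real.sqrt_nonneg _)
  have hpc : Continuous (fun s : ℝ => max 0 (min s 1)) := by fun_prop
  have hpI : ∀ s : ℝ, max 0 (min s 1) ∈ Set.Icc (0:ℝ) 1 := fun s =>
    ⟨le_max_left _ _, max_le zero_le_one (min_le_right _ _)⟩
  have hmm := measurable_curve hm hpc hpI
  let κ : Kernel ℝ (Td d) := ⟨fun s => (m (max 0 (min s 1)) : Measure (Td d)), hmm⟩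
  have : IsMarkovKernel κ := ⟨fun s => by
    change IsProbabilityMeasure (m (max 0 (min s 1)) : Measure (Td d)); infer_instance⟩
  have hκ : ∀ s ∈ Set.Icc (0:ℝ) 1, κ s = (m s : Measure (Td d)) := by
    intro s hs
    change (m (max 0 (min s 1)) : Measure (Td d)) = _
    rw [min_eq_left hs.2, max_eq_right hs.1]
  have hE' : ∫⁻ s in Set.Ioc (0:ℝ) 1, ∫⁻ y, ENNReal.ofReal (sqnorm (α s y)) ∂(κ s) < ⊤ := by
    refine lt_of_eq_of_lt ?_ hE
    refine setLIntegral_congr_fun measurableSet_Ioc fun s hs => ?_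
    simp only [hκ s (Ioc_subset_Icc_self hs)]
  clear_value κ
  have hp := nz_piece hα hr0 hr2 κ hκ hm hE' hfp
  obtain ⟨α', hα', hcost⟩ := hp.adm S zero_le_one
  have hst : nzM κ r 0 = heat μ₀ τ := by
    apply Subtype.ext
    change (nzK κ 0).map _ = ((μ₀ : Measure (Td d)).prod (gam d)).map _
    rw [nzK_apply, hκ 0 (by simp), hm0]
    congr 1
    funext ω
    simp [nzY, flowY, bmY, hr]
  have hen : nzM κ r 1 = m 1 := by
    apply Subtype.ext
    change (nzK κ 1).map _ = _
    rw [nzK_apply, hκ 1 (by simp)]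
    have e : (fun ω : Td d × Vd d => nzY r (1, ω)) = Prod.fst := by
      funext ω
      simp [nzY, prT_secT]
    rw [e, Measure.map_fst_prod, measure_univ, one_smul]
    rfl
  rw [hst] at hα'
  refine ⟨_, α', hα', hen, ?_⟩
  have hsqm : Measurable (fun p : ℝ × Td d => sqnorm (α p.1 p.2)) := sqnorm_meas.comp hα
  obtain ⟨iE, iE'⟩ := adm_int zero_le_one hm hα hE (f := fun p => sqnorm (α p.1 p.2)) hsqm (C := 1)
    (fun s _ y => by
      have := sqnorm_nonneg (α s y)
      rw [abs_of_nonneg this]; linarith)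
  simp only at iE iE'
  have iH := (adm_int zero_le_one hm hα hE (f := fun p => S.Hstar (secT p.2) (α p.1 p.2))
        ((Hstar_sec_meas S).comp (measurable_snd.prodMk hα)) (C := CA) (fun s _ y => hHa _ _)).1
  have iHK := (kint (volume.restrict (Ioc (0:ℝ) 1)) (nzK κ) (nzA_meas hα r) (nz_energy hα hr2 κ hE')
    (f := fun p => S.Hstar (secT (nzY r p)) (nzA α r p))
    ((Hstar_sec_meas S).comp ((nzY_meas r).prodMk (nzA_meas hα r))) (C := CA)
    (Eventually.of_forall fun s ω => hHa _ _)).1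
  set E : ℝ → ℝ := fun s => ∫ y, sqnorm (α s y) ∂(m s : Measure (Td d)) with hEdef
  have hE0 : ∀ s, 0 ≤ E s := fun s => integral_nonneg fun _ => sqnorm_nonneg _
  set G := 4 * CH * M2 + LF S * M1 with hG
  have hG0 : 0 ≤ G := by positivity
  have hpt : ∀ᵐ s ∂(volume.restrict (Ioc (0:ℝ) 1)), Real.exp (-δ * s) * runCost S (nzM κ r) α' s
      ≤ Real.exp (-δ * s) * runCost S m α s + G * r * (1 + E s) := by
    filter_upwards [hcost, iE, iH, iHK, ae_restrict_mem measurableSet_Ioc] with s hs hsE hsH hsK hsm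
    have hsI := Ioc_subset_Icc_self hsm
    rw [nzK_apply, hκ s hsI] at hsK
    have hF : S.Fc (nzM κ r s) ≤ S.Fc (m s) + LF S * (r * M1) := by
      have h1 := Fc_W1 S (m s) (nzM κ r s)
      have h2 : W1 (nzM κ r s) (m s) ≤ r * M1 := by
        have hn : Integrable (fun ω : Td d × Vd d => r * ‖ω.2‖)
            ((m s : Measure (Td d)).prod (gam d)) := by
          have := (integrable_const (1:ℝ) (μ := (m s : Measure (Td d)))).mul_prod (gam_norm_int d)
          simp only [one_mul] at this
          exact this.const_mul r
        have hY : Measurable (fun ω : Td d × Vd d => nzY r (s, ω)) :=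
          (nzY_meas r).comp measurable_prodMk_left
        have := W1_law_le (P := (m s : Measure (Td d)).prod (gam d)) (μ := nzM κ r s) (ν := m s)
          hY measurable_fst
          (by
            rw [← hκ s hsI, ← nzK_apply]; rfl)
          (by rw [Measure.map_fst_prod, measure_univ, one_smul]) hn (fun ω => by
            have h3 : dist (nzY r (s, ω)) (prT (secT ω.1)) ≤ _ := dist_prT_le _ _
            rw [prT_secT] at h3
            refine h3.trans ?_
            have e : secT (s, ω).2.1 + (1 - (s, ω).1) • r • (s, ω).2.2 - secT ω.1
              = (1 - s) • r • ω.2 := by simp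
            rw [e, norm_smul, norm_smul, Real.norm_eq_abs, Real.norm_eq_abs, abs_of_nonneg hr0,
              abs_of_nonneg (by linarith [hsm.2])]
            have h4 : 0 ≤ r * ‖ω.2‖ := by positivity
            nlinarith [hsm.1])
        refine this.trans (le_of_eq ?_)
        rw [integral_const_mul]
        have := integral_prod_mul (μ := (m s : Measure (Td d))) (ν := gam d) (fun _ => (1:ℝ)) (fun ξ => ‖ξ‖)
        simp only [one_mul, integral_const, smul_eq_mul, probReal_univ] at this
        rw [this]
      have h3 := mul_le_mul_of_nonneg_left h2 hLF
      linarith [(abs_le.1 h1).2]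
    have hHH : ∫ ω, S.Hstar (secT (nzY r (s, ω))) (nzA α r (s, ω)) ∂(nzK κ s)
        ≤ (∫ y, S.Hstar (secT y) (α s y) ∂(m s : Measure (Td d))) + 4 * CH * r * ((1 + E s) * M2) := by
      rw [nzK_apply, hκ s hsI]
      have j1 : Integrable (fun ω : Td d × Vd d => S.Hstar (secT ω.1) (α s ω.1))
          ((m s : Measure (Td d)).prod (gam d)) := by
        have := hsH.mul_prod (integrable_const (1:ℝ) (μ := gam d))
        simpa only [mul_one] using this
      have j2 : Integrable (fun ω : Td d × Vd d => (1 + sqnorm (α s ω.1)) * (1 + sqnorm ω.2)^2)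
          ((m s : Measure (Td d)).prod (gam d)) :=
        ((integrable_const (1:ℝ)).add hsE).mul_prod (gam_moment d)
      refine (integral_mono hsK (j1.add (j2.const_mul (4 * CH * r))) fun ω => ?_).trans (le_of_eq ?_)
      · have h1 : S.Hstar (secT (nzY r (s, ω))) (nzA α r (s, ω))
            = S.Hstar (secT ω.1 + (1 - s) • r • ω.2) (α s ω.1 + r • ω.2) :=
          IsPer.sec (g := fun x => S.Hstar x (nzA α r (s, ω))) (fun x z => Hstar_per S x _ z) _
        simp only [h1, Pi.add_apply]
        refine (hH _ _ _ _).trans ?_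
        have n1 : ‖(1 - s) • r • ω.2‖ + ‖r • ω.2‖ ≤ 2 * r * (1 + sqnorm ω.2) := by
          rw [norm_smul, norm_smul, Real.norm_eq_abs, Real.norm_eq_abs, abs_of_nonneg hr0,
              abs_of_nonneg (by linarith [hsm.2])]
          have h4 := norm_le_one_add_sqnorm ω.2
          have h5 : r * ‖ω.2‖ ≤ r * (1 + sqnorm ω.2) := mul_le_mul_of_nonneg_left h4 hr0
          have h6 : 0 ≤ r * ‖ω.2‖ := by positivity
          nlinarith [hsm.1]
        have n2 : 1 + sqnorm (α s ω.1) + sqnorm (r • ω.2)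
            ≤ 2 * ((1 + sqnorm (α s ω.1)) * (1 + sqnorm ω.2)) := by
          rw [sqnorm_smul]
          have a1 := sqnorm_nonneg (α s ω.1)
          have a2 := sqnorm_nonneg ω.2
          have a3 : r^2 * sqnorm ω.2 ≤ 2 * sqnorm ω.2 := mul_le_mul_of_nonneg_right hr2 a2
          nlinarith [mul_nonneg a1 a2]
        have a1 := sqnorm_nonneg (α s ω.1)
        have a2 := sqnorm_nonneg ω.2
        have a3 := sqnorm_nonneg (r • ω.2)
        have n3 : CH * (‖(1 - s) • r • ω.2‖ + ‖r • ω.2‖) * (1 + sqnorm (α s ω.1) + sqnorm (r • ω.2))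
            ≤ CH * (2 * r * (1 + sqnorm ω.2)) * (2 * ((1 + sqnorm (α s ω.1)) * (1 + sqnorm ω.2))) := by
          gcongr
        refine (add_le_add_right n3 _).trans (le_of_eq ?_)
        ring
      · simp only [Pi.add_apply]
        rw [integral_add j1 (j2.const_mul _), integral_const_mul]
        have q1 := integral_prod_mul (μ := (m s : Measure (Td d))) (ν := gam d)
          (fun y => S.Hstar (secT y) (α s y)) (fun _ => (1:ℝ))
        simp only [mul_one, integral_const, smul_eq_mul, probReal_univ] at q1
        have q2 := integral_prod_mul (μ := (m s : Measure (Td d))) (ν := gam d)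
          (fun y => 1 + sqnorm (α s y)) (fun ξ => (1 + sqnorm ξ)^2)
        rw [integral_add (integrable_const _) hsE] at q2
        simp only [integral_const, smul_eq_mul, probReal_univ, mul_one] at q2
        rw [q1, q2]
    have htot : runCost S (nzM κ r) α' s ≤ runCost S m α s + G * r * (1 + E s) := by
      refine hs.trans ?_
      unfold runCost
      have : LF S * (r * M1) ≤ LF S * M1 * r * (1 + E s) := by
        have : 0 ≤ LF S * M1 * r * E s := mul_nonneg (by positivity) (hE0 s)
        nlinarith
      rw [hG]
      nlinarith
    have he : Real.exp (-δ * s) ≤ 1 := Real.exp_le_one_iff.2 (by nlinarith [hsm.1])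
    have he0 := Real.exp_pos (-δ * s)
    have hq : 0 ≤ G * r * (1 + E s) := by have := hE0 s; positivity
    nlinarith [mul_le_mul_of_nonneg_left htot he0.le, mul_le_mul_of_nonneg_right he hq]
  have hi' : IntegrableOn (runCost S (nzM κ r) α') (Ioc 0 1) :=
    (intervalIntegrable_iff_integrableOn_Ioc_of_le zero_le_one).1 hα'.2.2.2.2.2
  have hi : IntegrableOn (runCost S m α) (Ioc 0 1) :=
    (intervalIntegrable_iff_integrableOn_Ioc_of_le zero_le_one).1 hrun
  have hiE1 : IntegrableOn (fun s => 1 + E s) (Ioc 0 1) := (integrable_const _).add iE'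
  have hiE2 : IntegrableOn (fun s => G * r * (1 + E s)) (Ioc 0 1) := hiE1.const_mul _
  have h1 := integral_mono_ae (exp_run_int (δ := δ) hi') ((exp_run_int (δ := δ) hi).add hiE2) hpt
  simp only [Pi.add_apply] at h1
  rw [integral_add (exp_run_int hi) hiE2, integral_const_mul, integral_add (integrable_const _) iE'] at h1
  simp only [integral_const, MeasurableSet.univ, measureReal_restrict_apply, univ_inter,
    Real.volume_real_Ioc, sub_zero, smul_eq_mul, mul_one] at h1
  have hmax : max (1:ℝ) 0 = 1 := by norm_num
  rw [hmax] at h1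
  have hI0 : 0 ≤ ∫ s in Ioc (0:ℝ) 1, E s := integral_nonneg hE0
  have h2 : G * r * (1 + ∫ s in Ioc (0:ℝ) 1, E s) ≤ 2 * G * √τ * (1 + ∫ s in Ioc (0:ℝ) 1, E s) := by
    refine mul_le_mul_of_nonneg_right ?_ (by positivity)
    nlinarith
  linarith

/-! ### Uniform oscillation and equicontinuity estimates -/

def enrg {d : ℕ} (m : ℝ → PTd d) (α : ℝ → Td d → Vd d) : ℝ :=
  ∫ s in Ioc (0:ℝ) 1, ∫ y, sqnorm (α s y) ∂(m s : Measure (Td d))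

lemma enrg_nonneg {d : ℕ} (m : ℝ → PTd d) (α : ℝ → Td d → Vd d) : 0 ≤ enrg m α :=
  integral_nonneg fun _ => integral_nonneg fun _ => sqnorm_nonneg _

lemma keyV {d : ℕ} (S : MFGSetting d) : ∃ C, 0 ≤ C ∧ ∀ (δ : ℝ) (_ : 0 < δ) (τ : ℝ) (_ : 0 < τ) (_ : τ ≤ 1)
    (μ₁ μ₀ : PTd d) (pc : Measure (Td d × Td d)) (_ : pc.map Prod.fst = μ₁) (_ : pc.map Prod.snd = μ₀)
    (m : ℝ → PTd d) (α : ℝ → Td d → Vd d), AdmDisc S 1 δ μ₀ m α →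
    Vfun S 1 δ μ₁ ≤ C * (τ + (∫ p, dist p.1 p.2 ^ 2 ∂pc) / τ)
      + Real.exp (-δ * τ) * (costDisc S δ m α + C * √τ * (1 + enrg m α)) := by
  obtain ⟨C1, hC1, h1⟩ := piece1 S
  obtain ⟨C2, hC2, h2⟩ := piece2 S
  obtain ⟨CV, hCV, hV⟩ := Vfun_bounds S
  refine ⟨C1 + C2, by positivity, fun δ hδ τ hτ hτ1 μ₁ μ₀ pc hp1 hp0 m α hadm => ?_⟩
  obtain ⟨m1, α1, a1, e1, c1⟩ := h1 δ hδ τ hτ μ₁ μ₀ pc hp1 hp0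
  obtain ⟨m2, α2, a2, e2, c2⟩ := h2 δ hδ τ hτ hτ1 μ₀ m α (hadm.admOn hδ zero_le_one)
  obtain ⟨a3, c3⟩ := hadm.shift zero_le_one
  obtain ⟨m4, α4, a4, c4⟩ := concat hδ zero_le_one a2 e2 a3
  obtain ⟨m5, α5, a5, c5⟩ := concat hδ hτ.le a1 e1 a4
  refine ((hV δ hδ).2.1 _ _ _ a5).trans ?_
  rw [c5]
  have hD : 0 ≤ τ + (∫ p, dist p.1 p.2 ^ 2 ∂pc) / τ := by
    have : 0 ≤ ∫ p, dist p.1 p.2 ^ 2 ∂pc := integral_nonneg fun p => sq_nonneg _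
    positivity
  have hen := enrg_nonneg m α
  refine add_le_add (c1.trans ?_) (mul_le_mul_of_nonneg_left ?_ (Real.exp_nonneg _))
  · exact mul_le_mul_of_nonneg_right (by linarith) hD
  · rw [c4, c3]
    have h5 : C2 * √τ * (1 + enrg m α) ≤ (C1 + C2) * √τ * (1 + enrg m α) := by
      have : 0 ≤ C1 * √τ * (1 + enrg m α) := by positivity
      nlinarith
    have c2' : _ ≤ _ + C2 * √τ * (1 + enrg m α) := c2
    linarith

lemma exp_V {δ τ v C : ℝ} (hδ : 0 < δ) (hτ : 0 < τ) (h : |δ * v| ≤ C) :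
    |Real.exp (-δ * τ) * v - v| ≤ C * τ := by
  have h1 := Real.add_one_le_exp (-δ * τ)
  have h2 : Real.exp (-δ * τ) ≤ 1 := Real.exp_le_one_iff.2 (by nlinarith)
  have e : Real.exp (-δ * τ) * v - v = -((1 - Real.exp (-δ * τ)) * v) := by ring
  rw [e, abs_neg, abs_mul, abs_of_nonneg (by linarith)]
  calc (1 - Real.exp (-δ * τ)) * |v| ≤ (δ * τ) * |v| :=
        mul_le_mul_of_nonneg_right (by linarith) (abs_nonneg _)
    _ = |δ * v| * τ := by rw [abs_mul, abs_of_pos hδ]; ring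
    _ ≤ C * τ := mul_le_mul_of_nonneg_right h hτ.le

lemma enerV {d : ℕ} (S : MFGSetting d) : ∃ C, 0 ≤ C ∧ ∀ (δ : ℝ) (_ : 0 < δ) (_ : δ ≤ 1) (μ₀ : PTd d)
    (B : ℝ) (_ : ∀ ν, Vfun S 1 δ μ₀ - Vfun S 1 δ ν ≤ B)
    (m : ℝ → PTd d) (α : ℝ → Td d → Vd d), AdmDisc S 1 δ μ₀ m α →
    costDisc S δ m α ≤ Vfun S 1 δ μ₀ + 1 → enrg m α ≤ C * (1 + B) := by
  obtain ⟨c, C0, hc, hC0, hrc⟩ := runCost_lower S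
  obtain ⟨CV, hCV, hV⟩ := Vfun_bounds S
  refine ⟨(C0 + 1 + CV) * Real.exp 1 / c, by positivity, fun δ hδ hδ1 μ₀ B hB m α hadm hcost => ?_⟩
  have hB0 : 0 ≤ B := by have := hB μ₀; simpa using this
  obtain ⟨hVb, hVle, -⟩ := hV δ hδ
  obtain ⟨a3, c3⟩ := hadm.shift zero_le_one
  obtain ⟨hm0, hm, hfp, hα, hE, hrun⟩ := hadm.admOn hδ zero_le_one
  have h1 := hVle _ _ _ a3
  have h2 := hB (m 1)
  have hsqm : Measurable (fun p : ℝ × Td d => sqnorm (α p.1 p.2)) := sqnorm_meas.comp hα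
  have iE := (adm_int zero_le_one hm hα hE (f := fun p => sqnorm (α p.1 p.2)) hsqm (C := 1)
    (fun s _ y => by
      have := sqnorm_nonneg (α s y)
      rw [abs_of_nonneg this]; linarith)).2
  simp only at iE
  have hi : IntegrableOn (runCost S m α) (Ioc 0 1) :=
    (intervalIntegrable_iff_integrableOn_Ioc_of_le zero_le_one).1 hrun
  have h3 : Real.exp (-1) * c * enrg m α - C0 ≤ ∫ s in Ioc (0:ℝ) 1, Real.exp (-δ * s) * runCost S m α s := by
    have hii : IntegrableOn (fun s => Real.exp (-1) * c * (∫ y, sqnorm (α s y) ∂(m s : Measure (Td d))) - C0)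
      (Ioc 0 1) := (iE.const_mul _).sub (integrable_const _)
    have := setIntegral_mono_on hii (exp_run_int (δ := δ) hi) measurableSet_Ioc fun s hs => by
      have q1 := hrc m α hα s
      have q2 : 0 ≤ ∫ y, sqnorm (α s y) ∂(m s : Measure (Td d)) :=
        integral_nonneg fun _ => sqnorm_nonneg _
      have he : Real.exp (-δ * s) ≤ 1 := Real.exp_le_one_iff.2 (by nlinarith [hs.1])
      have he0 : Real.exp (-1) ≤ Real.exp (-δ * s) := Real.exp_le_exp.2 (by nlinarith [hs.1, hs.2])
      have q3 := mul_le_mul_of_nonneg_left q1 (Real.exp_nonneg (-δ * s))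
      have q4 := mul_le_mul_of_nonneg_right he0 (mul_nonneg hc.le q2)
      have q5 := mul_le_mul_of_nonneg_right he hC0
      show _ ≤ _
      nlinarith
    rw [integral_sub (iE.const_mul _) (integrable_const _), integral_const_mul] at this
    simpa [enrg] using this
  have h4 := exp_V hδ one_pos (hVb μ₀)
  simp only [mul_one] at h4
  have he : Real.exp (-δ) ≤ 1 := Real.exp_le_one_iff.2 (by linarith)
  have he0 := Real.exp_pos (-δ)
  have h5 : Real.exp (-1) * c * enrg m α ≤ (C0 + 1 + CV) * (1 + B) := by
    have q1 : Real.exp (-δ) * (Vfun S 1 δ μ₀ - B)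
        ≤ Real.exp (-δ) * costDisc S δ (fun s => m (s + 1)) (fun s => α (s + 1)) :=
      mul_le_mul_of_nonneg_left (by linarith) he0.le
    have q2 := (abs_le.1 h4).1
    have q3 : Real.exp (-δ) * B ≤ B := by nlinarith
    rw [c3] at hcost
    simp only [mul_one] at hcost
    nlinarith [mul_nonneg (add_nonneg hC0 hCV) hB0]
  have h6 : enrg m α = (Real.exp (-1) * c * enrg m α) * (Real.exp 1 / c) := by
    rw [Real.exp_neg]
    field_simp
  rw [h6]
  refine (mul_le_mul_of_nonneg_right h5 (by positivity)).trans (le_of_eq ?_)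
  ring

lemma oscV {d : ℕ} (S : MFGSetting d) : ∃ B, 0 ≤ B ∧ ∀ (δ : ℝ) (_ : 0 < δ) (_ : δ ≤ 1) (μ ν : PTd d),
    Vfun S 1 δ μ - Vfun S 1 δ ν ≤ B := by
  obtain ⟨C1, hC1, h1⟩ := keyV S
  obtain ⟨C2, hC2, h2⟩ := enerV S
  obtain ⟨CV, hCV, hV⟩ := Vfun_bounds S
  refine ⟨1 + 2 * C1 + CV + 1 + C1 * (1 + C2 * 2), by positivity, fun δ hδ hδ1 μ ν => ?_⟩
  obtain ⟨hVb, hVle, hVε⟩ := hV δ hδ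
  have hbdd : BddBelow (range (Vfun S 1 δ)) := by
    refine ⟨-(CV / δ), ?_⟩
    rintro _ ⟨μ, rfl⟩
    have := (abs_le.1 (hVb μ)).1
    rw [neg_le, ← sub_nonneg]
    have e : CV / δ - - Vfun S 1 δ μ = (CV + δ * Vfun S 1 δ μ) / δ := by field_simp; ring
    rw [e]
    exact div_nonneg (by linarith) hδ.le
  obtain ⟨_, ⟨μ₀, rfl⟩, hμ₀⟩ := exists_lt_of_csInf_lt (range_nonempty (Vfun S 1 δ))
    (lt_add_one (sInf (range (Vfun S 1 δ))))
  have hB : ∀ ν, Vfun S 1 δ μ₀ - Vfun S 1 δ ν ≤ 1 := fun ν => by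
    have := csInf_le hbdd (mem_range_self ν)
    linarith
  obtain ⟨m, α, hadm, hcost⟩ := hVε μ₀ 1 one_pos
  have hen := h2 δ hδ hδ1 μ₀ 1 hB m α hadm hcost.le
  have hk := h1 δ hδ 1 one_pos le_rfl μ μ₀ ((μ : Measure (Td d)).prod μ₀)
    (by rw [Measure.map_fst_prod, measure_univ, one_smul])
    (by rw [Measure.map_snd_prod, measure_univ, one_smul]) m α hadm
  have hD : ∫ p : Td d × Td d, dist p.1 p.2 ^ 2 ∂((μ : Measure (Td d)).prod (μ₀ : Measure (Td d))) ≤ 1 := by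
    have := norm_integral_le_of_norm_le_const (μ := (μ : Measure (Td d)).prod (μ₀ : Measure (Td d)))
      (f := fun p : Td d × Td d => dist p.1 p.2 ^ 2) (C := 1) (Eventually.of_forall fun p => by
        rw [Real.norm_eq_abs, abs_of_nonneg (sq_nonneg _)]
        have : dist p.1 p.2 ≤ 1 := dist_Td_le _ _
        exact pow_le_one₀ dist_nonneg this)
    simp only [probReal_univ, mul_one] at this
    exact (Real.le_norm_self _).trans this
  have h4 := (abs_le.1 (exp_V hδ one_pos (hVb μ₀))).2
  simp only [mul_one, Real.sqrt_one, div_one] at hk h4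
  have he : Real.exp (-δ) ≤ 1 := Real.exp_le_one_iff.2 (by linarith)
  have he0 := Real.exp_pos (-δ)
  have hen0 := enrg_nonneg m α
  have q1 : Real.exp (-δ) * (costDisc S δ m α + C1 * (1 + enrg m α))
      ≤ Real.exp (-δ) * Vfun S 1 δ μ₀ + (1 + C1 * (1 + C2 * 2)) := by
    have q2 : costDisc S δ m α + C1 * (1 + enrg m α) ≤ Vfun S 1 δ μ₀ + (1 + C1 * (1 + C2 * 2)) := by
      have := mul_le_mul_of_nonneg_left hen hC1
      nlinarith
    have q3 := mul_le_mul_of_nonneg_left q2 he0.le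
    have q4 : Real.exp (-δ) * (1 + C1 * (1 + C2 * 2)) ≤ 1 * (1 + C1 * (1 + C2 * 2)) :=
      mul_le_mul_of_nonneg_right he (by positivity)
    linarith
  have q5 := mul_le_mul_of_nonneg_left hD hC1
  have := hB ν
  linarith

lemma equiV {d : ℕ} (S : MFGSetting d) : ∃ C, 0 ≤ C ∧ ∀ (δ : ℝ) (_ : 0 < δ) (_ : δ ≤ 1)
    (τ : ℝ) (_ : 0 < τ) (_ : τ ≤ 1)
    (μ₁ μ₀ : PTd d) (pc : Measure (Td d × Td d)) (_ : pc.map Prod.fst = μ₁) (_ : pc.map Prod.snd = μ₀),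
    Vfun S 1 δ μ₁ - Vfun S 1 δ μ₀ ≤ C * (√τ + (∫ p, dist p.1 p.2 ^ 2 ∂pc) / τ) := by
  obtain ⟨C1, hC1, h1⟩ := keyV S
  obtain ⟨C2, hC2, h2⟩ := enerV S
  obtain ⟨CV, hCV, hV⟩ := Vfun_bounds S
  obtain ⟨B, hB0, hB⟩ := oscV S
  refine ⟨C1 + CV + 1 + C1 * (1 + C2 * (1 + B)), by positivity,
    fun δ hδ hδ1 τ hτ hτ1 μ μ₀ pc hp1 hp0 => ?_⟩
  obtain ⟨hVb, hVle, hVε⟩ := hV δ hδ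
  have hsq : 0 < √τ := Real.sqrt_pos.2 hτ
  have hsq1 : √τ ≤ 1 := Real.sqrt_le_one.2 hτ1
  have hsq2 : √τ * √τ = τ := Real.mul_self_sqrt hτ.le
  have hτs : τ ≤ √τ := by nlinarith
  obtain ⟨m, α, hadm, hcost⟩ := hVε μ₀ (√τ) hsq
  have hen := h2 δ hδ hδ1 μ₀ B (fun ν => hB δ hδ hδ1 μ₀ ν) m α hadm (by linarith)
  have hk := h1 δ hδ τ hτ hτ1 μ μ₀ pc hp1 hp0 m α hadm
  have hD : 0 ≤ (∫ p, dist p.1 p.2 ^ 2 ∂pc) / τ :=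
    div_nonneg (integral_nonneg fun p => sq_nonneg _) hτ.le
  have h4 := (abs_le.1 (exp_V hδ hτ (hVb μ₀))).2
  have he : Real.exp (-δ * τ) ≤ 1 := Real.exp_le_one_iff.2 (by nlinarith)
  have he0 := Real.exp_pos (-δ * τ)
  have hen0 := enrg_nonneg m α
  have q1 : Real.exp (-δ * τ) * (costDisc S δ m α + C1 * √τ * (1 + enrg m α))
      ≤ Real.exp (-δ * τ) * Vfun S 1 δ μ₀ + (√τ + C1 * √τ * (1 + C2 * (1 + B))) := by
    have q2 : costDisc S δ m α + C1 * √τ * (1 + enrg m α)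
        ≤ Vfun S 1 δ μ₀ + (√τ + C1 * √τ * (1 + C2 * (1 + B))) := by
      have := mul_le_mul_of_nonneg_left hen (mul_nonneg hC1 hsq.le)
      nlinarith
    have q3 := mul_le_mul_of_nonneg_left q2 he0.le
    have q4 : Real.exp (-δ * τ) * (√τ + C1 * √τ * (1 + C2 * (1 + B)))
        ≤ 1 * (√τ + C1 * √τ * (1 + C2 * (1 + B))) :=
      mul_le_mul_of_nonneg_right he (by positivity)
    linarith
  have q5 : 0 ≤ (CV + 1 + C1 * (1 + C2 * (1 + B))) * ((∫ p, dist p.1 p.2 ^ 2 ∂pc) / τ) := by positivity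
  have q6 := mul_le_mul_of_nonneg_left hτs (add_nonneg hC1 hCV)
  nlinarith

lemma resid_coupling {X : Type*} [MeasurableSpace X] (μ ν : Measure X) [IsProbabilityMeasure μ]
    [IsProbabilityMeasure ν] (p₀ : Measure (X × X)) (h1 : p₀.map Prod.fst ≤ μ)
    (h2 : p₀.map Prod.snd ≤ ν) :
    ∃ pc : Measure (X × X), pc.map Prod.fst = μ ∧ pc.map Prod.snd = ν ∧
      ∀ s, MeasurableSet s → pc s ≤ p₀ s + (1 - p₀ univ) := by
  have m1 : (p₀.map Prod.fst) univ = p₀ univ := by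
    rw [Measure.map_apply measurable_fst MeasurableSet.univ, preimage_univ]
  have m2 : (p₀.map Prod.snd) univ = p₀ univ := by
    rw [Measure.map_apply measurable_snd MeasurableSet.univ, preimage_univ]
  have hle : p₀ univ ≤ 1 := by
    rw [← m1]; exact (h1 univ).trans_eq measure_univ
  have : IsFiniteMeasure p₀ := ⟨hle.trans_lt ENNReal.one_lt_top⟩
  set μ' := μ - p₀.map Prod.fst with hμ'
  set ν' := ν - p₀.map Prod.snd with hν'
  have e1 : μ' + p₀.map Prod.fst = μ := Measure.sub_add_cancel_of_le h1
  have e2 : ν' + p₀.map Prod.snd = ν := Measure.sub_add_cancel_of_le h2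
  set r := 1 - p₀ univ with hr
  have r1 : μ' univ = r := by
    rw [hμ', Measure.sub_apply MeasurableSet.univ h1, measure_univ, m1]
  have r2 : ν' univ = r := by
    rw [hν', Measure.sub_apply MeasurableSet.univ h2, measure_univ, m2]
  have hrt : r ≠ ⊤ := by rw [hr]; exact ENNReal.sub_ne_top ENNReal.one_ne_top
  have : IsFiniteMeasure μ' := ⟨by rw [r1]; exact lt_top_iff_ne_top.2 hrt⟩
  have : IsFiniteMeasure ν' := ⟨by rw [r2]; exact lt_top_iff_ne_top.2 hrt⟩
  have key : ∀ ρ : Measure X, ρ univ = r → r⁻¹ • (r • ρ) = ρ := by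
    intro ρ hρ
    by_cases h0 : r = 0
    · have : ρ = 0 := Measure.measure_univ_eq_zero.1 (hρ.trans h0)
      simp [this]
    · rw [smul_smul, ENNReal.inv_mul_cancel h0 hrt, one_smul]
  refine ⟨p₀ + r⁻¹ • μ'.prod ν', ?_, ?_, fun s hs => ?_⟩
  · rw [Measure.map_add _ _ measurable_fst, Measure.map_smul, Measure.map_fst_prod, r2, key _ r1,
      add_comm, e1]
  · rw [Measure.map_add _ _ measurable_snd, Measure.map_smul, Measure.map_snd_prod, r1, key _ r2,
      add_comm, e2]
  · rw [Measure.add_apply, Measure.smul_apply]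
    gcongr
    calc r⁻¹ • (μ'.prod ν') s ≤ r⁻¹ • (μ'.prod ν') univ := by
          gcongr; exact subset_univ _
      _ = r⁻¹ * r * r := by
          rw [← univ_prod_univ, Measure.prod_prod, r1, r2, smul_eq_mul, mul_assoc]
      _ ≤ 1 * r := by gcongr; exact ENNReal.inv_mul_le_one _
      _ = r := one_mul _

lemma part_coupling {X ι : Type*} [MeasurableSpace X] [Fintype ι] (μ ν : Measure X)
    [IsProbabilityMeasure μ] [IsProbabilityMeasure ν] (ψ : ι → X → ENNReal)
    (hψ : ∀ i, Measurable (ψ i)) (hs : ∀ x, ∑ i, ψ i x = 1) (s : Set (X × X)) (hsm : MeasurableSet s)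
    (hz : ∀ p ∈ s, ∀ i, ψ i p.1 = 0 ∨ ψ i p.2 = 0) :
    ∃ pc : Measure (X × X), pc.map Prod.fst = μ ∧ pc.map Prod.snd = ν ∧
      pc s ≤ ∑ i, ((∫⁻ x, ψ i x ∂μ) - ∫⁻ x, ψ i x ∂ν) := by
  classical
  have hsum : ∀ ρ : Measure X, ∑ i, ρ.withDensity (ψ i) = ρ := by
    intro ρ
    ext t ht
    rw [Measure.finsetSum_apply]
    simp_rw [withDensity_apply _ ht]
    rw [← lintegral_finsetSum _ (fun i _ => hψ i)]
    simp [hs]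
  set a : ι → ENNReal := fun i => ∫⁻ x, ψ i x ∂μ with ha
  set b : ι → ENNReal := fun i => ∫⁻ x, ψ i x ∂ν with hb
  have hle : ∀ i x, ψ i x ≤ 1 := fun i x => by
    rw [← hs x]; exact Finset.single_le_sum (f := fun i => ψ i x) (fun _ _ => zero_le) (Finset.mem_univ i)
  have fin : ∀ (ρ : Measure X) [IsProbabilityMeasure ρ] i, ∫⁻ x, ψ i x ∂ρ ≤ 1 := fun ρ _ i => by
    calc _ ≤ ∫⁻ x, 1 ∂ρ := lintegral_mono (hle i)
      _ = 1 := by simp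
  have mu : ∀ i, (μ.withDensity (ψ i)) univ = a i := fun i => by simp [ha]
  have nu : ∀ i, (ν.withDensity (ψ i)) univ = b i := fun i => by simp [hb]
  have : ∀ i, IsFiniteMeasure (μ.withDensity (ψ i)) := fun i =>
    ⟨by rw [mu]; exact (fin μ i).trans_lt ENNReal.one_lt_top⟩
  have : ∀ i, IsFiniteMeasure (ν.withDensity (ψ i)) := fun i =>
    ⟨by rw [nu]; exact (fin ν i).trans_lt ENNReal.one_lt_top⟩
  let q : ι → Measure (X × X) := fun i =>
    (max (a i) (b i))⁻¹ • (μ.withDensity (ψ i)).prod (ν.withDensity (ψ i))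
  have mapsum : ∀ (f : X × X → X), Measurable f → (∑ i, q i).map f = ∑ i, (q i).map f := by
    intro f hf
    ext t ht
    rw [Measure.map_apply hf ht, Measure.finsetSum_apply, Measure.finsetSum_apply]
    exact Finset.sum_congr rfl fun i _ => (Measure.map_apply hf ht).symm
  have smulle : ∀ (c : ENNReal) (ρ : Measure X), c ≤ 1 → c • ρ ≤ ρ := by
    intro c ρ hc t
    rw [Measure.smul_apply, smul_eq_mul]
    exact mul_le_of_le_one_left zero_le hc
  have sumle : ∀ (f g : ι → Measure X), (∀ i, f i ≤ g i) → ∑ i, f i ≤ ∑ i, g i := by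
    intro f g h t
    rw [Measure.finsetSum_apply, Measure.finsetSum_apply]
    exact Finset.sum_le_sum fun i _ => h i t
  obtain ⟨pc, p1, p2, p3⟩ := resid_coupling μ ν (∑ i, q i) (by
    rw [mapsum _ measurable_fst]
    conv_rhs => rw [← hsum μ]
    refine sumle _ _ fun i => ?_
    simp only [q]
    rw [Measure.map_smul, Measure.map_fst_prod, nu, smul_smul]
    exact smulle _ _ ((mul_le_mul_right (le_max_right _ _) _).trans (ENNReal.inv_mul_le_one _))) (by
    rw [mapsum _ measurable_snd]
    conv_rhs => rw [← hsum ν]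
    refine sumle _ _ fun i => ?_
    simp only [q]
    rw [Measure.map_smul, Measure.map_snd_prod, mu, smul_smul]
    exact smulle _ _ ((mul_le_mul_right (le_max_left _ _) _).trans (ENNReal.inv_mul_le_one _)))
  refine ⟨pc, p1, p2, (p3 s hsm).trans ?_⟩
  have z0 : (∑ i, q i) s = 0 := by
    rw [Measure.finsetSum_apply]
    refine Finset.sum_eq_zero fun i _ => ?_
    simp only [q]
    rw [Measure.smul_apply, smul_eq_mul]
    refine mul_eq_zero_of_right _ ?_
    have zz : ∀ ρ : Measure X, (ρ.withDensity (ψ i)) {x | ψ i x = 0} = 0 := fun ρ => by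
      have hm : MeasurableSet {x | ψ i x = 0} := hψ i (measurableSet_singleton 0)
      rw [withDensity_apply _ hm, lintegral_eq_zero_iff (hψ i)]
      exact (ae_restrict_iff' hm).2 (Eventually.of_forall fun x hx => hx)
    refine measure_mono_null (t := {x | ψ i x = 0} ×ˢ univ ∪ univ ×ˢ {x | ψ i x = 0}) ?_
      (measure_union_null ?_ ?_)
    · intro p hp
      rcases hz p hp i with h | h
      · exact Or.inl ⟨h, mem_univ _⟩
      · exact Or.inr ⟨mem_univ _, h⟩
    · rw [Measure.prod_prod, zz, zero_mul]
    · rw [Measure.prod_prod, zz, mul_zero]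
  rw [z0, zero_add, tsub_le_iff_right]
  have one : (1 : ENNReal) = ∑ i, a i := by
    rw [ha, ← lintegral_finsetSum _ (fun i _ => hψ i)]
    simp [hs]
  rw [one, Measure.finsetSum_apply, ← Finset.sum_add_distrib]
  refine Finset.sum_le_sum fun i _ => ?_
  have qi : q i univ = (max (a i) (b i))⁻¹ * (a i * b i) := by
    simp only [q]
    rw [Measure.smul_apply, ← univ_prod_univ, Measure.prod_prod, mu, nu, smul_eq_mul]
  rw [qi]
  have fa : a i ≠ ⊤ := ((fin μ i).trans_lt ENNReal.one_lt_top).ne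
  have fb : b i ≠ ⊤ := ((fin ν i).trans_lt ENNReal.one_lt_top).ne
  rcases le_total (a i) (b i) with h | h
  · rw [max_eq_right h]
    by_cases h0 : b i = 0
    · rw [h0] at h; simp [le_zero_iff.1 h]
    · rw [mul_comm (a i), ← mul_assoc, ENNReal.inv_mul_cancel h0 fb, one_mul]
      exact le_add_self
  · rw [max_eq_left h]
    by_cases h0 : a i = 0
    · simp [h0]
    · rw [← mul_assoc, ENNReal.inv_mul_cancel h0 fa, one_mul, tsub_add_cancel_of_le h]

lemma exists_pou (d : ℕ) {ε : ℝ} (hε : 0 < ε) : ∃ (t : Finset (Td d))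
    (ψ : t → BoundedContinuousFunction (Td d) NNReal), (∀ x, ∑ i, ψ i x = 1) ∧
      ∀ i x y, 2 * ε < dist x y → ψ i x = 0 ∨ ψ i y = 0 := by
  obtain ⟨t₀, -, hfin, hcov⟩ := (isCompact_univ : IsCompact (univ : Set (Td d))).finite_cover_balls hε
  let t := hfin.toFinset
  let u : t → Td d → NNReal := fun c x => Real.toNNReal (ε - dist x c)
  have hu : ∀ c, Continuous (u c) := fun c => by
    simp only [u]
    fun_prop
  let σ : Td d → NNReal := fun x => ∑ c, u c x
  have hσ : Continuous σ := continuous_finsetSum _ fun c _ => hu c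
  have hpos : ∀ x, σ x ≠ 0 := by
    intro x
    have hx := hcov (mem_univ x)
    simp only [mem_iUnion, Metric.mem_ball] at hx
    obtain ⟨c, hc, hxc⟩ := hx
    have hct : c ∈ t := hfin.mem_toFinset.2 hc
    have h1 : 0 < u ⟨c, hct⟩ x := by
      simp only [u]
      exact Real.toNNReal_pos.2 (by linarith)
    have h2 : u ⟨c, hct⟩ x ≤ σ x :=
      Finset.single_le_sum (f := fun c => u c x) (fun _ _ => zero_le) (Finset.mem_univ _)
    exact (h1.trans_le h2).ne'
  refine ⟨t, fun c => BoundedContinuousFunction.mkOfCompact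
    ⟨fun x => u c x / σ x, (hu c).div hσ hpos⟩, fun x => ?_, fun c x y hxy => ?_⟩
  · simp only [BoundedContinuousFunction.mkOfCompact_apply, ContinuousMap.coe_mk]
    rw [← Finset.sum_div]
    exact div_self (hpos x)
  · simp only [BoundedContinuousFunction.mkOfCompact_apply, ContinuousMap.coe_mk]
    by_cases h : ε ≤ dist x c
    · left
      have : u c x = 0 := Real.toNNReal_of_nonpos (by linarith)
      rw [this, zero_div]
    · right
      have h3 := dist_triangle x c y
      rw [dist_comm (c : Td d) y] at h3
      have : u c y = 0 := Real.toNNReal_of_nonpos (by linarith [not_le.1 h])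
      rw [this, zero_div]

lemma weak_coupling {d : ℕ} (μ : PTd d) {D : ℝ} (hD : 0 < D) : ∀ᶠ ν : PTd d in nhds μ,
    (∃ pc : Measure (Td d × Td d), pc.map Prod.fst = μ ∧ pc.map Prod.snd = ν ∧
      ∫ p, dist p.1 p.2 ^ 2 ∂pc ≤ D) ∧
    (∃ pc : Measure (Td d × Td d), pc.map Prod.fst = ν ∧ pc.map Prod.snd = μ ∧
      ∫ p, dist p.1 p.2 ^ 2 ∂pc ≤ D) := by
  set ε := √(D / 2) / 2 with hε
  have hε0 : 0 < ε := by positivity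
  have h4 : (2 * ε) ^ 2 = D / 2 := by
    rw [hε, mul_div_cancel₀ _ two_ne_zero, Real.sq_sqrt (by positivity)]
  obtain ⟨t, ψ, hs, hz⟩ := exists_pou d hε0
  have hψm : ∀ i, Measurable (fun x => (ψ i x : ENNReal)) := fun i =>
    (ψ i).continuous.measurable.coe_nnreal_ennreal
  have hs' : ∀ x, ∑ i, (ψ i x : ENNReal) = 1 := fun x => by
    rw [← ENNReal.coe_finsetSum, hs, ENNReal.coe_one]
  have hfin : ∀ (ρ : PTd d) i, ∫⁻ x, ψ i x ∂(ρ : Measure (Td d)) ≠ ⊤ := fun ρ i => by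
    have : ∫⁻ x, ψ i x ∂(ρ : Measure (Td d)) ≤ ∫⁻ x, 1 ∂(ρ : Measure (Td d)) :=
      lintegral_mono fun x => by
        rw [← hs' x]
        exact Finset.single_le_sum (f := fun i => (ψ i x : ENNReal)) (fun _ _ => zero_le) (Finset.mem_univ i)
    refine (this.trans_lt ?_).ne
    simp
  have htend : ∀ i, Tendsto (fun ν : PTd d => ∫⁻ x, ψ i x ∂(ν : Measure (Td d))) (nhds μ)
      (nhds (∫⁻ x, ψ i x ∂(μ : Measure (Td d)))) := fun i =>
    ProbabilityMeasure.tendsto_iff_forall_lintegral_tendsto.1 tendsto_id (ψ i)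
  have hA : Tendsto (fun ν : PTd d => ∑ i, ((∫⁻ x, ψ i x ∂(μ : Measure (Td d))) -
      ∫⁻ x, ψ i x ∂(ν : Measure (Td d)))) (nhds μ) (nhds 0) := by
    have := tendsto_finsetSum Finset.univ fun (i : t) _ =>
      ENNReal.Tendsto.sub (tendsto_const_nhds (x := ∫⁻ x, ψ i x ∂(μ : Measure (Td d)))) (htend i)
        (Or.inl (hfin μ i))
    simpa using this
  have hB : Tendsto (fun ν : PTd d => ∑ i, ((∫⁻ x, ψ i x ∂(ν : Measure (Td d))) -
      ∫⁻ x, ψ i x ∂(μ : Measure (Td d)))) (nhds μ) (nhds 0) := by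
    have := tendsto_finsetSum Finset.univ fun (i : t) _ =>
      ENNReal.Tendsto.sub (htend i) (tendsto_const_nhds (x := ∫⁻ x, ψ i x ∂(μ : Measure (Td d))))
        (Or.inl (hfin μ i))
    simpa using this
  have hD2 : (0 : ENNReal) < ENNReal.ofReal (D / 2) := ENNReal.ofReal_pos.2 (by positivity)
  let s : Set (Td d × Td d) := {p | 2 * ε < dist p.1 p.2}
  have hsm : MeasurableSet s := (isOpen_lt continuous_const continuous_dist).measurableSet
  have key : ∀ (ρ₁ ρ₂ : PTd d), ∑ i, ((∫⁻ x, ψ i x ∂(ρ₁ : Measure (Td d))) -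
      ∫⁻ x, ψ i x ∂(ρ₂ : Measure (Td d))) < ENNReal.ofReal (D / 2) →
      ∃ pc : Measure (Td d × Td d), pc.map Prod.fst = ρ₁ ∧ pc.map Prod.snd = ρ₂ ∧
      ∫ p, dist p.1 p.2 ^ 2 ∂pc ≤ D := by
    intro ρ₁ ρ₂ h
    obtain ⟨pc, p1, p2, p3⟩ := part_coupling (ρ₁ : Measure (Td d)) (ρ₂ : Measure (Td d))
      (fun i x => (ψ i x : ENNReal)) hψm hs' s hsm (fun p hp i => by
        rcases hz i p.1 p.2 hp with h | h
        · left; simp [h]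
        · right; simp [h])
    have hpu : pc univ = 1 := by
      have : (pc.map Prod.fst) univ = 1 := by rw [p1]; exact measure_univ
      rwa [Measure.map_apply measurable_fst MeasurableSet.univ, preimage_univ] at this
    have : IsProbabilityMeasure pc := ⟨hpu⟩
    refine ⟨pc, p1, p2, ?_⟩
    have hps : pc.real s ≤ D / 2 :=
      ENNReal.toReal_le_of_le_ofReal (by positivity) (p3.trans h.le)
    have i1 : Integrable (s.indicator (fun _ => (1 : ℝ))) pc :=
      (integrable_const _).indicator hsm
    calc ∫ p, dist p.1 p.2 ^ 2 ∂pc ≤ ∫ p, (D / 2 + s.indicator (fun _ => (1 : ℝ)) p) ∂pc := by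
          refine integral_mono_of_nonneg (Eventually.of_forall fun p => by positivity)
            ((integrable_const _).add i1) (Eventually.of_forall fun p => ?_)
          by_cases hp : p ∈ s
          · simp only [indicator_of_mem hp]
            have := dist_Td_le p.1 p.2
            have h0 : 0 ≤ dist p.1 p.2 := dist_nonneg
            nlinarith
          · simp only [indicator_of_notMem hp, add_zero]
            rw [← h4]
            have : dist p.1 p.2 ≤ 2 * ε := not_lt.1 hp
            gcongr
      _ = D / 2 + pc.real s := by
          rw [integral_add (integrable_const _) i1, integral_indicator hsm]
          simp
      _ ≤ D := by linarith
  filter_upwards [hA.eventually (gt_mem_nhds hD2), hB.eventually (gt_mem_nhds hD2)] with ν h1 h2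
  exact ⟨key μ ν h1, key ν μ h2⟩

lemma equicontV {d : ℕ} (S : MFGSetting d) (μ : PTd d) {ε : ℝ} (hε : 0 < ε) :
    ∀ᶠ ν : PTd d in nhds μ, ∀ (δ : ℝ) (_ : 0 < δ) (_ : δ ≤ 1),
      |Vfun S 1 δ ν - Vfun S 1 δ μ| < ε := by
  obtain ⟨C, hC, h⟩ := equiV S
  set s := min 1 (ε / (4 * (C + 1))) with hs
  have hs0 : 0 < s := by positivity
  have hs1 : s ≤ 1 := min_le_left _ _
  have hsC : (C + 1) * s ≤ ε / 4 := by
    have : s ≤ ε / (4 * (C + 1)) := min_le_right _ _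
    calc (C + 1) * s ≤ (C + 1) * (ε / (4 * (C + 1))) := by gcongr
      _ = ε / 4 := by field_simp
  have hτ1 : s ^ 2 ≤ 1 := pow_le_one₀ hs0.le hs1
  filter_upwards [weak_coupling μ (D := s ^ 3) (by positivity)] with ν hν δ hδ hδ1
  obtain ⟨⟨p, p1, p2, p3⟩, ⟨q, q1, q2, q3⟩⟩ := hν
  have b : ∀ x : ℝ, x ≤ s ^ 3 → C * (√(s ^ 2) + x / s ^ 2) ≤ ε / 2 := by
    intro x hx
    rw [Real.sqrt_sq hs0.le]
    have : x / s ^ 2 ≤ s := by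
      rw [div_le_iff₀ (by positivity)]
      linarith [show s * s ^ 2 = s ^ 3 by ring]
    nlinarith
  have h1 := h δ hδ hδ1 (s ^ 2) (by positivity) hτ1 μ ν p p1 p2
  have h2 := h δ hδ hδ1 (s ^ 2) (by positivity) hτ1 ν μ q q1 q2
  have b1 := b _ p3
  have b2 := b _ q3
  rw [abs_lt]
  constructor <;> linarith

lemma W1Continuous_of_continuous {d : ℕ} {χ : PTd d → ℝ} (h : Continuous χ) : W1Continuous χ := by
  intro μ ε hε
  by_contra hcon
  push Not at hcon
  choose ν hν1 hν2 using fun n : ℕ => hcon (1 / ((n : ℝ) + 1)) (by positivity)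
  have ht : Tendsto ν atTop (nhds μ) := by
    rw [tendsto_iff_forall_lipschitz_integral_tendsto]
    rintro f - ⟨L, hL⟩
    rw [tendsto_iff_dist_tendsto_zero]
    have h0 : Tendsto (fun n : ℕ => (L : ℝ) * (1 / ((n : ℝ) + 1))) atTop (nhds 0) := by
      simpa using (tendsto_one_div_add_atTop_nhds_zero_nat (𝕜 := ℝ)).const_mul (L : ℝ)
    refine squeeze_zero (fun _ => dist_nonneg) (fun n => ?_) h0
    have := lip_W1 μ (ν n) (φ := f) L.2 (fun a b => by
      have := hL.dist_le_mul a b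
      rwa [Real.dist_eq] at this)
    rw [dist_comm, Real.dist_eq]
    exact this.trans (mul_le_mul_of_nonneg_left (hν1 n).le L.2)
  have h2 := (h.tendsto μ).comp ht
  rw [Metric.tendsto_atTop] at h2
  obtain ⟨N, hN⟩ := h2 ε hε
  have := hN N le_rfl
  rw [Real.dist_eq] at this
  exact absurd (hν2 N) (not_le.2 this)

lemma final_aux {d : ℕ} (S : MFGSetting d) (η : PTd d) :
    ∃ (δseq : ℕ → ℝ) (χ : PTd d → ℝ) (lam : ℝ),
      (∀ n, 0 < δseq n) ∧ Tendsto δseq atTop (nhds 0) ∧ W1Continuous χ ∧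
      (∀ ε > 0, ∃ N, ∀ n ≥ N, ∀ μ,
        |(Vfun S 1 (δseq n) μ - Vfun S 1 (δseq n) η) - χ μ| < ε) ∧
      (∀ ε > 0, ∃ N, ∀ n ≥ N, ∀ μ, |δseq n * Vfun S 1 (δseq n) μ - (-lam)| < ε) := by
  obtain ⟨B, hB0, hB⟩ := oscV S
  obtain ⟨C, hC0, hC⟩ := Vfun_bounds S
  let dl : ℕ → ℝ := fun n => 1 / ((n : ℝ) + 1)
  have dl0 : ∀ n, 0 < dl n := fun n => by simp only [dl]; positivity
  have dl1 : ∀ n, dl n ≤ 1 := fun n => by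
    simp only [dl]
    rw [div_le_one (by positivity)]
    have : (0 : ℝ) ≤ n := Nat.cast_nonneg n
    linarith
  have dlt : Tendsto dl atTop (nhds 0) := tendsto_one_div_add_atTop_nhds_zero_nat
  have hcont : ∀ n, Continuous fun μ : PTd d => Vfun S 1 (dl n) μ - Vfun S 1 (dl n) η := fun n => by
    refine Continuous.sub ?_ continuous_const
    rw [continuous_iff_continuousAt]
    intro μ
    rw [ContinuousAt, Metric.tendsto_nhds]
    intro ε hε
    filter_upwards [equicontV S μ hε] with ν hν
    exact hν _ (dl0 n) (dl1 n)
  let f : ℕ → BoundedContinuousFunction (PTd d) ℝ := fun n =>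
    BoundedContinuousFunction.mkOfCompact ⟨_, hcont n⟩
  have hf : ∀ n μ, f n μ = Vfun S 1 (dl n) μ - Vfun S 1 (dl n) η := fun n μ => rfl
  have hK : IsCompact (closure (range f)) := by
    refine BoundedContinuousFunction.arzela_ascoli (Icc (-B) B) isCompact_Icc (range f) ?_ ?_
    · rintro _ μ ⟨n, rfl⟩
      rw [hf]
      have h1 := hB _ (dl0 n) (dl1 n) μ η
      have h2 := hB _ (dl0 n) (dl1 n) η μ
      exact ⟨by linarith, h1⟩
    · intro μ
      rw [Metric.equicontinuousAt_iff_right]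
      intro ε hε
      filter_upwards [equicontV S μ hε] with ν hν
      rintro ⟨_, n, rfl⟩
      have := hν _ (dl0 n) (dl1 n)
      rw [dist_comm, Real.dist_eq]
      simp only [hf]
      convert this using 2
      ring
  obtain ⟨⟨χ, l⟩, -, φ, hφ, hlim⟩ := (hK.prod (isCompact_Icc (a := -C) (b := C))).tendsto_subseq
    (x := fun n => (f n, dl n * Vfun S 1 (dl n) η))
    (fun n => ⟨subset_closure ⟨n, rfl⟩, abs_le.1 ((hC _ (dl0 n)).1 η)⟩)
  rw [nhds_prod_eq, tendsto_prod_iff'] at hlim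
  obtain ⟨hl1, hl2⟩ := hlim
  have hd : Tendsto (fun n => dl (φ n)) atTop (nhds 0) := dlt.comp hφ.tendsto_atTop
  refine ⟨fun n => dl (φ n), χ, -l, fun n => dl0 _, hd,
    W1Continuous_of_continuous χ.continuous, fun ε hε => ?_, fun ε hε => ?_⟩
  · obtain ⟨N, hN⟩ := Metric.tendsto_atTop.1 hl1 ε hε
    refine ⟨N, fun n hn μ => ?_⟩
    have h1 := (BoundedContinuousFunction.dist_coe_le_dist (f := f (φ n)) (g := χ) μ).trans_lt (hN n hn)
    rwa [Real.dist_eq, hf] at h1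
  · obtain ⟨N1, hN1⟩ := Metric.tendsto_atTop.1 hl2 (ε / 2) (by positivity)
    obtain ⟨N2, hN2⟩ := Metric.tendsto_atTop.1 hd (ε / (2 * (B + 1))) (by positivity)
    refine ⟨max N1 N2, fun n hn μ => ?_⟩
    have h1 := hN1 n (le_of_max_le_left hn)
    have h2 := hN2 n (le_of_max_le_right hn)
    have hp := dl0 (φ n)
    rw [Real.dist_eq] at h1 h2
    rw [sub_zero, abs_of_pos hp, lt_div_iff₀ (by positivity)] at h2
    have h3 := hB _ (dl0 (φ n)) (dl1 (φ n)) μ η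
    have h4 := hB _ (dl0 (φ n)) (dl1 (φ n)) η μ
    simp only [Function.comp_apply] at h1
    rw [abs_lt] at h1 ⊢
    rw [neg_neg]
    constructor <;> nlinarith

/-- Proposition 1.6 of the paper.  For any fixed `η ∈ P(𝕋^d)` there is a
sequence `δₙ → 0⁺` along which `𝒱_{δₙ}(·) - 𝒱_{δₙ}(η)` converges uniformly to a continuous
function `χ`, and `δₙ 𝒱_{δₙ}(·)` converges uniformly to a constant `-λ`. -/
theorem subsequence_convergence (d : ℕ) (S : MFGSetting d) (η : PTd d) :
    ∃ (δseq : ℕ → ℝ) (χ : PTd d → ℝ) (lam : ℝ),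
      (∀ n : ℕ, 0 < δseq n) ∧
      Filter.Tendsto δseq Filter.atTop (nhds 0) ∧
      W1Continuous χ ∧
      (∀ ε > 0, ∃ N : ℕ, ∀ n ≥ N, ∀ μ : PTd d,
        |(Vfun S 1 (δseq n) μ - Vfun S 1 (δseq n) η) - χ μ| < ε) ∧
      (∀ ε > 0, ∃ N : ℕ, ∀ n ≥ N, ∀ μ : PTd d,
        |δseq n * Vfun S 1 (δseq n) μ - (-lam)| < ε) := by
  exact final_aux S η
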